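/- arXiv:2310.13750 — 3 statements merged into one kernel-verified Lean document; each statement's English description precedes it below -/
import Mathlib

section
/- Let 0 ≤ β ≤ α < ∞ and 1 < r, q < ∞, and assume one of: (i) α > 1/q and 2β ≥ 2/q − 1/r′; (ii) α = 1/q and 2β > 2/q − 1/r′; (iii) α < 1/q, α + β > 2/q − 1/2 and α + 2β ≥ 3/q − 1/r′. Then there is C > 0 such that for every measurable F : ℝ → ℂ one has sup_{t>0} t·|{(x,y) ∈ ℝ² : |R*_{α,β}F(x,y)| > t}|^{1/q} ≤ C · sup_{t>0} t·|{φ ∈ [0,2π] : |F(φ)| > t}|^{1/r}. -/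
open MeasureTheory Real Set Filter
open scoped ENNReal

noncomputable section

/-- Fourier extension operator of the unit circle,
`(R*F)(x,y) = (1/(2π)) ∫_0^{2π} F(φ) exp(i(x cos φ + y sin φ)) dφ`. -/
def Rext (F : ℝ → ℂ) (x y : ℝ) : ℂ :=
  Complex.ofReal (1 / (2 * π)) *
    ∫ φ in (0:ℝ)..(2 * π),
      F φ * Complex.exp (Complex.I * Complex.ofReal (x * Real.cos φ + y * Real.sin φ))

/-- Weighted extension operator with product weight `(1+|x|)^{-α}(1+|y|)^{-β}`. -/
def Rab (α β : ℝ) (F : ℝ → ℂ) (x y : ℝ) : ℂ :=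
  Rext F x y * Complex.ofReal ((1 + |x|) ^ (-α) * (1 + |y|) ^ (-β))

/-- Weighted extension operator with weight `(1+|x|+|y|)^{-γ}`. -/
def Rgamma (γ : ℝ) (F : ℝ → ℂ) (x y : ℝ) : ℂ :=
  Rext F x y * Complex.ofReal ((1 + |x| + |y|) ^ (-γ))

/-- `L^r` norm on the circle, parametrized by `[0, 2π]`. -/
def circleLp (r : ℝ≥0∞) (F : ℝ → ℂ) : ℝ≥0∞ :=
  eLpNorm F r (volume.restrict (Ioc (0:ℝ) (2 * π)))

/-- `L^q` quasinorm on the plane. -/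
def planeLp (q : ℝ≥0∞) (g : ℝ × ℝ → ℂ) : ℝ≥0∞ :=
  eLpNorm g q (volume : Measure (ℝ × ℝ))

/-- Weak `L^q` quasinorm on the line. -/
def wline (q : ℝ) (g : ℝ → ℂ) : ℝ≥0∞ :=
  ⨆ (t : ℝ) (_ : 0 < t), ENNReal.ofReal t * (volume {x : ℝ | t < ‖g x‖}) ^ (1 / q)

/-- Weak `L^q` quasinorm on the line, for `ℝ≥0∞`-valued functions. -/
def wlineE (q : ℝ) (g : ℝ → ℝ≥0∞) : ℝ≥0∞ :=
  ⨆ (t : ℝ) (_ : 0 < t), ENNReal.ofReal t * (volume {x : ℝ | ENNReal.ofReal t < g x}) ^ (1 / q)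

/-- Mixed weak quasinorm `L^{q,∞}_x(L^{q,∞}_y)`. -/
def mixedXY (q : ℝ) (g : ℝ × ℝ → ℂ) : ℝ≥0∞ :=
  wlineE q fun x => wline q fun y => g (x, y)

/-- Mixed weak quasinorm `L^{q,∞}_y(L^{q,∞}_x)`. -/
def mixedYX (q : ℝ) (g : ℝ × ℝ → ℂ) : ℝ≥0∞ :=
  wlineE q fun y => wline q fun x => g (x, y)

/-- Weak `L^q` quasinorm on the plane. -/
def wplane (q : ℝ) (g : ℝ × ℝ → ℂ) : ℝ≥0∞ :=
  ⨆ (t : ℝ) (_ : 0 < t), ENNReal.ofReal t * (volume {p : ℝ × ℝ | t < ‖g p‖}) ^ (1 / q)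

/-- Lorentz `L^{r,1}` norm on the circle. -/
def lorentz1 (r : ℝ) (F : ℝ → ℂ) : ℝ≥0∞ :=
  ∫⁻ t in Ioi (0:ℝ), (volume {φ ∈ Icc (0:ℝ) (2 * π) | t < ‖F φ‖}) ^ (1 / r)

/-- Weak `L^r` quasinorm on the circle. -/
def wcircle (r : ℝ) (F : ℝ → ℂ) : ℝ≥0∞ :=
  ⨆ (t : ℝ) (_ : 0 < t), ENNReal.ofReal t * (volume {φ ∈ Icc (0:ℝ) (2 * π) | t < ‖F φ‖}) ^ (1 / r)

section Planch
variable {V : Type} [NormedAddCommGroup V] [InnerProductSpace ℝ V] [FiniteDimensional ℝ V]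
  [MeasurableSpace V] [BorelSpace V] {Ω : Type} [MeasurableSpace Ω]

/-- Oscillatory integral. -/
def oscI (ν : Measure Ω) (ψ : Ω → V) (h : Ω → ℂ) (v : V) : ℂ :=
  ∫ ω, h ω * Complex.exp (Complex.I * ((inner ℝ (ψ ω) v : ℝ) : ℂ)) ∂ν

/-- The Gaussian kernel. -/
def gK (V : Type) [NormedAddCommGroup V] [InnerProductSpace ℝ V] (b : ℝ) (w : V) : ℝ :=
  (π / b) ^ (Module.finrank ℝ V / 2 : ℝ) * Real.exp (-(1 / (4 * b)) * ‖w‖ ^ 2)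

lemma norm_expI (t : ℝ) : ‖Complex.exp (Complex.I * (t : ℂ))‖ = 1 := by
  rw [mul_comm]; exact Complex.norm_exp_ofReal_mul_I t

lemma gauss_int (b : ℝ) (hb : 0 < b) (w : V) :
    ∫ v : V, (Real.exp (-b * ‖v‖ ^ 2) : ℂ) * Complex.exp (Complex.I * ((inner ℝ w v : ℝ) : ℂ))
      = ((gK V b w : ℝ) : ℂ) := by
  have h := GaussianFourier.integral_cexp_neg_mul_sq_norm_add (V := V) (b := (b : ℂ))
    (by simpa using hb) Complex.I w
  have e : ∀ v : V, (Real.exp (-b * ‖v‖ ^ 2) : ℂ) *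
      Complex.exp (Complex.I * ((inner ℝ w v : ℝ) : ℂ)) =
      Complex.exp (-(b : ℂ) * (‖v‖ : ℂ) ^ 2 + Complex.I * ((inner ℝ w v : ℝ) : ℂ)) := by
    intro v
    rw [Complex.exp_add]
    push_cast
    rfl
  simp_rw [e]
  rw [h, gK]
  push_cast
  congr 1
  · rw [← Complex.ofReal_div, Complex.ofReal_cpow (by positivity)]
    push_cast; rfl
  · congr 1
    rw [Complex.I_sq]
    field_simp

lemma gK_nonneg (b : ℝ) (hb : 0 < b) (w : V) : 0 ≤ gK V b w := by
  unfold gK; positivity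

lemma gK_symm (b : ℝ) (w w' : V) : gK V b (w - w') = gK V b (w' - w) := by
  unfold gK; rw [norm_sub_rev]

lemma gauss_integrable (b : ℝ) (hb : 0 < b) :
    Integrable (fun v : V => Real.exp (-b * ‖v‖ ^ 2)) := by
  have h := (GaussianFourier.integrable_cexp_neg_mul_sq_norm_add (V := V) (b := (b : ℂ))
    (by simpa using hb) 0 0).norm
  refine h.congr (ae_of_all _ fun v => ?_)
  simp only [Complex.norm_exp]
  congr 1
  simp [← Complex.ofReal_pow]

lemma gK_cont (b : ℝ) : Continuous (fun w : V => gK V b w) := by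
  unfold gK; fun_prop

lemma gK_lint (b : ℝ) (hb : 0 < b) :
    ∫⁻ w : V, ENNReal.ofReal (gK V b w) =
      ENNReal.ofReal ((4 * π ^ 2) ^ (Module.finrank ℝ V / 2 : ℝ)) := by
  have hb' : 0 < 1 / (4 * b) := by positivity
  rw [← ofReal_integral_eq_lintegral_ofReal]
  · congr 1
    unfold gK
    rw [integral_const_mul, GaussianFourier.integral_rexp_neg_mul_sq_norm hb',
      ← Real.mul_rpow (by positivity) (by positivity)]
    congr 1
    field_simp
  · exact (gauss_integrable _ hb').const_mul _
  · exact ae_of_all _ fun w => gK_nonneg b hb w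

variable {ν : Measure Ω} [SFinite ν] {ψ : Ω → V} {h : Ω → ℂ}

lemma oscI_bound (v : V) : ‖oscI ν ψ h v‖ ≤ ∫ ω, ‖h ω‖ ∂ν := by
  unfold oscI
  refine (norm_integral_le_integral_norm _).trans (le_of_eq ?_)
  congr 1; ext ω; rw [norm_mul, norm_expI, mul_one]

lemma oscI_meas (hψ : Measurable ψ) (hh : Measurable h) : Measurable (oscI ν ψ h) := by
  have : StronglyMeasurable (fun p : V × Ω =>
      h p.2 * Complex.exp (Complex.I * ((inner ℝ (ψ p.2) p.1 : ℝ) : ℂ))) := by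
    apply Measurable.stronglyMeasurable
    fun_prop
  exact (this.integral_prod_right' (ν := ν)).measurable

lemma osc_sq (v : V) :
    ((‖oscI ν ψ h v‖ ^ 2 : ℝ) : ℂ) =
      ∫ p : Ω × Ω, (h p.1 * (starRingEnd ℂ) (h p.2)) *
        Complex.exp (Complex.I * ((inner ℝ (ψ p.1 - ψ p.2) v : ℝ) : ℂ)) ∂(ν.prod ν) := by
  have h1 : ((‖oscI ν ψ h v‖ ^ 2 : ℝ) : ℂ) = oscI ν ψ h v * (starRingEnd ℂ) (oscI ν ψ h v) := by
    rw [Complex.mul_conj, Complex.normSq_eq_norm_sq]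
  rw [h1]
  conv_lhs => rw [oscI, ← integral_conj, ← integral_prod_mul]
  congr 1; ext p
  simp only [map_mul, ← Complex.exp_conj, Complex.conj_I, Complex.conj_ofReal, inner_sub_left]
  rw [mul_mul_mul_comm, ← Complex.exp_add]
  congr 2
  push_cast; ring

lemma gauss_osc (hψ : Measurable ψ) (hh : Measurable h) (hi : Integrable h ν) (b : ℝ)
    (hb : 0 < b) :
    ∫⁻ v, ENNReal.ofReal (Real.exp (-b * ‖v‖ ^ 2)) * ‖oscI ν ψ h v‖ₑ ^ 2 ≤
      ∫⁻ p : Ω × Ω, ‖h p.1‖ₑ * ‖h p.2‖ₑ * ENNReal.ofReal (gK V b (ψ p.1 - ψ p.2)) ∂(ν.prod ν) := by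
  have e1 : ∀ v, ENNReal.ofReal (Real.exp (-b * ‖v‖ ^ 2)) * ‖oscI ν ψ h v‖ₑ ^ 2 =
      ENNReal.ofReal (Real.exp (-b * ‖v‖ ^ 2) * ‖oscI ν ψ h v‖ ^ 2) := by
    intro v
    rw [ENNReal.ofReal_mul (by positivity), ENNReal.ofReal_pow (by positivity), ofReal_norm]
  simp_rw [e1]
  have hgi : Integrable (fun v : V => Real.exp (-b * ‖v‖ ^ 2) * ‖oscI ν ψ h v‖ ^ 2) := by
    refine Integrable.mul_bdd (c := (∫ ω, ‖h ω‖ ∂ν) ^ 2) (gauss_integrable b hb) ?_ ?_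
    · exact ((oscI_meas hψ hh).norm.pow_const 2).aestronglyMeasurable
    · refine ae_of_all _ fun v => ?_
      rw [norm_pow, norm_norm]
      exact pow_le_pow_left₀ (norm_nonneg _) (oscI_bound v) 2
  rw [← ofReal_integral_eq_lintegral_ofReal hgi (ae_of_all _ fun v => by positivity)]
  have e2 : ((∫ v : V, Real.exp (-b * ‖v‖ ^ 2) * ‖oscI ν ψ h v‖ ^ 2 : ℝ) : ℂ) =
      ∫ p : Ω × Ω, (h p.1 * (starRingEnd ℂ) (h p.2)) * ((gK V b (ψ p.1 - ψ p.2) : ℝ) : ℂ)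
        ∂(ν.prod ν) := by
    rw [← integral_complex_ofReal]
    have : ∀ v : V, ((Real.exp (-b * ‖v‖ ^ 2) * ‖oscI ν ψ h v‖ ^ 2 : ℝ) : ℂ) =
      ∫ p : Ω × Ω, (Real.exp (-b * ‖v‖ ^ 2) : ℂ) * ((h p.1 * (starRingEnd ℂ) (h p.2)) *
        Complex.exp (Complex.I * ((inner ℝ (ψ p.1 - ψ p.2) v : ℝ) : ℂ))) ∂(ν.prod ν) := by
      intro v
      rw [integral_const_mul, ← osc_sq]
      push_cast; rfl
    simp_rw [this]
    rw [integral_integral_swap]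
    · congr 1; ext p
      rw [← gauss_int b hb, ← integral_const_mul]
      congr 1; ext v; ring
    · have hA : Integrable (fun p : Ω × Ω => h p.1 * (starRingEnd ℂ) (h p.2)) (ν.prod ν) := by
        refine Integrable.mul_prod (f := h) (g := fun x => (starRingEnd ℂ) (h x)) hi ?_
        exact (integrable_norm_iff (by fun_prop)).1 (by simpa using hi.norm)
      have hB := Integrable.mul_prod (μ := (volume : Measure V))
        (f := fun v : V => ((Real.exp (-b * ‖v‖ ^ 2) : ℝ) : ℂ))
        (gauss_integrable (V := V) b hb).ofReal hA
      refine hB.mono ?_ (ae_of_all _ fun p => ?_)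
      · apply Measurable.aestronglyMeasurable
        have h2 : Measurable (starRingEnd ℂ) := Complex.continuous_conj.measurable
        simp only [Function.uncurry_def]
        fun_prop
      · simp only [Function.uncurry, norm_mul, norm_expI, mul_one, le_refl]
  have e3 : ENNReal.ofReal (∫ v : V, Real.exp (-b * ‖v‖ ^ 2) * ‖oscI ν ψ h v‖ ^ 2) =
      ‖((∫ v : V, Real.exp (-b * ‖v‖ ^ 2) * ‖oscI ν ψ h v‖ ^ 2 : ℝ) : ℂ)‖ₑ := by
    rw [← ofReal_norm, Complex.norm_real, Real.norm_of_nonneg]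
    exact integral_nonneg fun v => by positivity
  rw [e3, e2]
  refine (enorm_integral_le_lintegral_enorm _).trans (le_of_eq ?_)
  congr 1; ext p
  rw [enorm_mul, enorm_mul]
  congr 1
  · congr 1; rw [← ofReal_norm, ← ofReal_norm, RCLike.norm_conj]
  · rw [← ofReal_norm, Complex.norm_real, Real.norm_of_nonneg (gK_nonneg b hb _)]

lemma amgm (a b s t : ℝ) (hs : a ≠ 0 → 0 < s) (ht : b ≠ 0 → 0 < t) (ha : 0 ≤ a) (hb : 0 ≤ b)
    (hs0 : 0 ≤ s) (ht0 : 0 ≤ t) :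
    2 * (a * b) ≤ a ^ 2 / s * t + b ^ 2 / t * s := by
  by_cases h1 : a = 0
  · subst h1; simp; positivity
  by_cases h2 : b = 0
  · subst h2; simp; positivity
  have := hs h1
  have := ht h2
  have e : a ^ 2 / s * t + b ^ 2 / t * s - 2 * (a * b) = (a * t - b * s) ^ 2 / (s * t) := by
    field_simp; ring
  have : 0 ≤ (a * t - b * s) ^ 2 / (s * t) := by positivity
  linarith

theorem planch (hψ : Measurable ψ) (hh : Measurable h) (hi : Integrable h ν)
    (J : Ω → ℝ) (hJm : Measurable J) (hJ0 : ∀ ω, 0 ≤ J ω) (hJh : ∀ ω, h ω ≠ 0 → 0 < J ω)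
    (m : ℝ≥0∞)
    (hJ : ∀ K : V → ℝ≥0∞, Measurable K → ∫⁻ ω, ENNReal.ofReal (J ω) * K (ψ ω) ∂ν ≤ m * ∫⁻ v, K v) :
    ∫⁻ v, ‖oscI ν ψ h v‖ₑ ^ 2 ≤
      m * ENNReal.ofReal ((4 * π ^ 2) ^ (Module.finrank ℝ V / 2 : ℝ)) *
        ∫⁻ ω, ENNReal.ofReal (‖h ω‖ ^ 2 / J ω) ∂ν := by
  set R := m * ENNReal.ofReal ((4 * π ^ 2) ^ (Module.finrank ℝ V / 2 : ℝ)) *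
        ∫⁻ ω, ENNReal.ofReal (‖h ω‖ ^ 2 / J ω) ∂ν with hR
  have key : ∀ b : ℝ, 0 < b →
      ∫⁻ v, ENNReal.ofReal (Real.exp (-b * ‖v‖ ^ 2)) * ‖oscI ν ψ h v‖ₑ ^ 2 ≤ R := by
    intro b hb
    refine (gauss_osc hψ hh hi b hb).trans ?_
    set A : Ω → ℝ≥0∞ := fun ω => ENNReal.ofReal (‖h ω‖ ^ 2 / J ω) with hA
    set B : Ω → ℝ≥0∞ := fun ω => ENNReal.ofReal (J ω) with hB
    have hAm : Measurable A := by fun_prop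
    have hBm : Measurable B := by fun_prop
    have hKm : Measurable (fun p : Ω × Ω => ENNReal.ofReal (gK V b (ψ p.1 - ψ p.2))) := by
      have := (gK_cont (V := V) b).measurable
      fun_prop
    have hKm' : Measurable (fun w : V => ENNReal.ofReal (gK V b w)) :=
      (gK_cont (V := V) b).measurable.ennreal_ofReal
    have one : ∫⁻ p : Ω × Ω, A p.1 * B p.2 * ENNReal.ofReal (gK V b (ψ p.1 - ψ p.2)) ∂(ν.prod ν)
        ≤ R := by
      rw [lintegral_prod _ (by fun_prop)]
      have : ∀ x, ∫⁻ y, A x * B y * ENNReal.ofReal (gK V b (ψ x - ψ y)) ∂ν ≤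
          A x * (m * ENNReal.ofReal ((4 * π ^ 2) ^ (Module.finrank ℝ V / 2 : ℝ))) := by
        intro x
        simp_rw [mul_assoc]
        rw [lintegral_const_mul _ (by have := (gK_cont (V := V) b).measurable; fun_prop)]
        refine mul_le_mul_right ?_ _
        refine (hJ (fun w => ENNReal.ofReal (gK V b (ψ x - w))) (by
          have := (gK_cont (V := V) b).measurable; fun_prop)).trans ?_
        refine mul_le_mul_right (le_of_eq ?_) _
        rw [lintegral_sub_left_eq_self (fun w => ENNReal.ofReal (gK V b w))]
        exact gK_lint b hb
      refine (lintegral_mono this).trans ?_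
      rw [lintegral_mul_const _ hAm, mul_comm]
    have two : ∫⁻ p : Ω × Ω, A p.2 * B p.1 * ENNReal.ofReal (gK V b (ψ p.1 - ψ p.2)) ∂(ν.prod ν)
        ≤ R := by
      rw [← lintegral_prod_swap]
      refine le_trans (le_of_eq ?_) one
      congr 1; ext p
      simp only [Prod.fst_swap, Prod.snd_swap]
      rw [gK_symm]
    have h2 : 2 * ∫⁻ p : Ω × Ω, ‖h p.1‖ₑ * ‖h p.2‖ₑ *
        ENNReal.ofReal (gK V b (ψ p.1 - ψ p.2)) ∂(ν.prod ν) ≤ 2 * R := by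
      rw [← lintegral_const_mul _ (by fun_prop), two_mul R]
      refine le_trans ?_ (add_le_add one two)
      rw [← lintegral_add_left (by fun_prop)]
      refine lintegral_mono fun p => ?_
      rw [← add_mul, ← mul_assoc]
      refine mul_le_mul_left ?_ _
      simp only [hA, hB]
      rw [← ofReal_norm, ← ofReal_norm, ← ENNReal.ofReal_mul (norm_nonneg _),
        ← ENNReal.ofReal_mul (by have := hJ0 p.1; positivity),
        ← ENNReal.ofReal_mul (by have := hJ0 p.2; positivity),
        ← ENNReal.ofReal_add (by have := hJ0 p.1; have := hJ0 p.2; positivity)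
          (by have := hJ0 p.1; have := hJ0 p.2; positivity),
        show (2 : ℝ≥0∞) = ENNReal.ofReal 2 by simp, ← ENNReal.ofReal_mul (by norm_num)]
      apply ENNReal.ofReal_le_ofReal
      exact amgm _ _ _ _ (fun hn => hJh _ (norm_ne_zero_iff.1 hn))
        (fun hn => hJh _ (norm_ne_zero_iff.1 hn)) (norm_nonneg _) (norm_nonneg _) (hJ0 _) (hJ0 _)
    exact (ENNReal.mul_le_mul_iff_right (by norm_num) (by norm_num)).1 h2
  have hlim : ∀ v : V, Tendsto (fun n : ℕ =>
      ENNReal.ofReal (Real.exp (-(1 / ((n : ℝ) + 1)) * ‖v‖ ^ 2)) * ‖oscI ν ψ h v‖ₑ ^ 2) atTop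
      (nhds (‖oscI ν ψ h v‖ₑ ^ 2)) := by
    intro v
    have t1 : Tendsto (fun n : ℕ => Real.exp (-(1 / ((n : ℝ) + 1)) * ‖v‖ ^ 2)) atTop
        (nhds (Real.exp (-0 * ‖v‖ ^ 2))) :=
      (Real.continuous_exp.tendsto _).comp
        ((tendsto_one_div_add_atTop_nhds_zero_nat (𝕜 := ℝ)).neg.mul_const _)
    have t2 := ENNReal.Tendsto.mul_const (b := ‖oscI ν ψ h v‖ₑ ^ 2)
      (ENNReal.tendsto_ofReal t1) (Or.inr (by finiteness))
    simpa using t2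
  have hmeas := oscI_meas (ν := ν) hψ hh
  calc ∫⁻ v, ‖oscI ν ψ h v‖ₑ ^ 2
      = ∫⁻ v, liminf (fun n : ℕ => ENNReal.ofReal (Real.exp (-(1 / ((n : ℝ) + 1)) * ‖v‖ ^ 2)) *
          ‖oscI ν ψ h v‖ₑ ^ 2) atTop := by
        congr 1; ext v; exact (hlim v).liminf_eq.symm
    _ ≤ liminf (fun n : ℕ => ∫⁻ v, ENNReal.ofReal (Real.exp (-(1 / ((n : ℝ) + 1)) * ‖v‖ ^ 2)) *
          ‖oscI ν ψ h v‖ₑ ^ 2) atTop := lintegral_liminf_le fun n => by fun_prop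
    _ ≤ R := by
        refine liminf_le_of_le (by isBoundedDefault) ?_
        intro c hc
        obtain ⟨n, hn⟩ := hc.exists
        exact hn.trans (key _ (by positivity))

/-- Near/far splitting. -/
theorem nearfar (hψ : Measurable ψ) (hh : Measurable h) (hi : Integrable h ν)
    (J : Ω → ℝ) (hJm : Measurable J) (hJ0 : ∀ ω, 0 ≤ J ω)
    (m : ℝ≥0∞)
    (hJ : ∀ K : V → ℝ≥0∞, Measurable K → ∫⁻ ω, ENNReal.ofReal (J ω) * K (ψ ω) ∂ν ≤ m * ∫⁻ v, K v)
    (ρ μ : ℝ) (hρ : 0 < ρ) (hμ : 0 < μ) (B : ℝ≥0∞)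
    (hnear : ∫⁻ ω in {ω | J ω < ρ}, ‖h ω‖ₑ ∂ν ≤ ENNReal.ofReal (μ / 2))
    (hfar : ∫⁻ ω in {ω | ρ ≤ J ω}, ENNReal.ofReal (‖h ω‖ ^ 2 / J ω) ∂ν ≤ B) :
    volume {v | μ < ‖oscI ν ψ h v‖} ≤
      ENNReal.ofReal (4 * μ ^ (-2 : ℝ)) *
        (m * ENNReal.ofReal ((4 * π ^ 2) ^ (Module.finrank ℝ V / 2 : ℝ)) * B) := by
  set N : Set Ω := {ω | J ω < ρ} with hN
  have hNm : MeasurableSet N := measurableSet_lt hJm measurable_const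
  have hNc : Nᶜ = {ω | ρ ≤ J ω} := by ext ω; simp [hN]
  set h1 := N.indicator h with hh1
  set h2 := Nᶜ.indicator h with hh2
  have i1 : Integrable h1 ν := hi.indicator hNm
  have i2 : Integrable h2 ν := hi.indicator hNm.compl
  have m2 : Measurable h2 := hh.indicator hNm.compl
  have hmul : ∀ (g : Ω → ℂ), Integrable g ν → ∀ v : V,
      Integrable (fun ω => g ω * Complex.exp (Complex.I * ((inner ℝ (ψ ω) v : ℝ) : ℂ))) ν := by
    intro g hg v
    refine hg.mul_bdd (c := 1) (Measurable.aestronglyMeasurable (by fun_prop)) ?_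
    exact ae_of_all _ fun ω => (norm_expI _).le
  have hsum : ∀ v, oscI ν ψ h v = oscI ν ψ h1 v + oscI ν ψ h2 v := by
    intro v
    unfold oscI
    rw [← integral_add (hmul _ i1 v) (hmul _ i2 v)]
    congr 1; ext ω
    rw [← add_mul]
    congr 1
    exact congrFun (Set.indicator_self_add_compl N h).symm ω
  have hb1 : ∀ v, ‖oscI ν ψ h1 v‖ ≤ μ / 2 := by
    intro v
    refine (oscI_bound v).trans ?_
    rw [integral_norm_eq_lintegral_enorm i1.aestronglyMeasurable]
    refine ENNReal.toReal_le_of_le_ofReal (by positivity) ?_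
    refine le_trans (le_of_eq ?_) hnear
    rw [← lintegral_indicator hNm]
    congr 1; ext ω
    rw [hh1, enorm_indicator_eq_indicator_enorm]
  have hsub : {v | μ < ‖oscI ν ψ h v‖} ⊆
      {v | ENNReal.ofReal ((μ / 2) ^ 2) ≤ ‖oscI ν ψ h2 v‖ₑ ^ 2} := by
    intro v hv
    simp only [mem_setOf_eq] at hv ⊢
    rw [← ofReal_norm, ← ENNReal.ofReal_pow (norm_nonneg _)]
    apply ENNReal.ofReal_le_ofReal
    apply pow_le_pow_left₀ (by positivity)
    have := norm_add_le (oscI ν ψ h1 v) (oscI ν ψ h2 v)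
    rw [← hsum] at this
    linarith [hb1 v]
  refine (measure_mono hsub).trans ?_
  have hpos : 0 < (μ / 2) ^ 2 := by positivity
  refine (meas_ge_le_lintegral_div (by
    have := oscI_meas (ν := ν) hψ m2; fun_prop) (by simpa using hμ.ne') ENNReal.ofReal_ne_top).trans ?_
  rw [ENNReal.div_eq_inv_mul, ← ENNReal.ofReal_inv_of_pos hpos]
  have e4 : ((μ / 2) ^ 2)⁻¹ = 4 * μ ^ (-2 : ℝ) := by
    rw [Real.rpow_neg hμ.le]; norm_num; field_simp; ring
  rw [e4]
  refine mul_le_mul_right ?_ _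
  refine (planch hψ m2 i2 J hJm hJ0 ?_ m hJ).trans ?_
  · intro ω hω
    have : ω ∈ Nᶜ := Set.mem_of_indicator_ne_zero hω
    rw [hNc] at this
    exact hρ.trans_le this
  · refine mul_le_mul_right ?_ _
    refine le_trans (le_of_eq ?_) hfar
    rw [← hNc, ← lintegral_indicator hNm.compl]
    congr 1; ext ω
    by_cases hω : ω ∈ Nᶜ <;> simp [hh2, hω]
end Planch

/-- Lebesgue measure on `(0, 2π]`. -/
def ν0 : Measure ℝ := volume.restrict (Ioc (0:ℝ) (2 * π))

instance : IsFiniteMeasure ν0 := by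
  unfold ν0; infer_instance

lemma near_pt (t : ℝ) (ht : |t| ≤ 2 * π) :
    ∃ k ∈ Finset.Icc (-2 : ℤ) 2, 2 / π * |t - k * π| ≤ |sin t| := by
  have hp := Real.pi_pos
  have hr := abs_sub_round (t / π)
  have e : |t - round (t / π) * π| ≤ π / 2 := by
    have : t - round (t / π) * π = (t / π - round (t / π)) * π := by field_simp
    rw [this, abs_mul, abs_of_pos hp]; nlinarith
  refine ⟨round (t / π), ?_, ?_⟩
  · rw [abs_le] at ht e
    rw [Finset.mem_Icc]
    have h1 : (round (t / π) : ℝ) * π ≤ 2.5 * π := by linarith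
    have h2 : (-2.5) * π ≤ (round (t / π) : ℝ) * π := by linarith
    have h3 : (round (t / π) : ℝ) < 3 := by nlinarith
    have h4 : (-3 : ℝ) < (round (t / π) : ℝ) := by nlinarith
    have h5 : round (t / π) < 3 := by exact_mod_cast h3
    have h6 : -3 < round (t / π) := by exact_mod_cast h4
    omega
  · have := Real.mul_abs_le_abs_sin e
    rwa [Real.sin_sub_int_mul_pi, abs_mul, abs_zpow, abs_neg, abs_one, one_zpow, one_mul] at this

lemma pow_int (ε δ : ℝ) (hε : 0 < ε) (hδ : 0 < δ) :
    ∫⁻ s in Ioo (-δ) δ, ENNReal.ofReal (|s| ^ (ε - 1)) ≤ ENNReal.ofReal (2 / ε * δ ^ ε) := by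
  have h1 : ∫⁻ s in Ioc 0 δ, ENNReal.ofReal (|s| ^ (ε - 1)) = ENNReal.ofReal (δ ^ ε / ε) := by
    have hi : IntegrableOn (fun s : ℝ => s ^ (ε - 1)) (Ioc 0 δ) := by
      have := intervalIntegral.intervalIntegrable_rpow' (a := 0) (b := δ) (r := ε - 1) (by linarith)
      rwa [intervalIntegrable_iff_integrableOn_Ioc_of_le hδ.le] at this
    rw [setLIntegral_congr_fun (g := fun s => ENNReal.ofReal (s ^ (ε - 1))) measurableSet_Ioc
      (fun s hs => by simp only [abs_of_pos hs.1])]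
    rw [← ofReal_integral_eq_lintegral_ofReal hi]
    · congr 1
      rw [← intervalIntegral.integral_of_le hδ.le, integral_rpow (Or.inl (by linarith))]
      rw [sub_add_cancel, Real.zero_rpow hε.ne', sub_zero]
    · filter_upwards [self_mem_ae_restrict measurableSet_Ioc] with s hs
      have : 0 < s := hs.1
      positivity
  have h2 : ∫⁻ s in Ico (-δ) 0, ENNReal.ofReal (|s| ^ (ε - 1)) =
      ∫⁻ s in Ioc 0 δ, ENNReal.ofReal (|s| ^ (ε - 1)) := by
    rw [← lintegral_indicator measurableSet_Ico, ← lintegral_indicator measurableSet_Ioc,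
      ← lintegral_neg_eq_self]
    congr 1; ext s
    by_cases hs : s ∈ Ioc 0 δ
    · rw [Set.indicator_of_mem hs, Set.indicator_of_mem (by constructor <;> linarith [hs.1, hs.2]),
        abs_neg]
    · rw [Set.indicator_of_notMem hs, Set.indicator_of_notMem]
      intro h; apply hs; constructor <;> linarith [h.1, h.2]
  have hsub : Ioo (-δ) δ ⊆ (Ico (-δ) 0 ∪ Ioc 0 δ) ∪ {0} := by
    intro s hs
    rcases lt_trichotomy s 0 with h | h | h
    · exact Or.inl (Or.inl ⟨hs.1.le, h⟩)
    · exact Or.inr h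
    · exact Or.inl (Or.inr ⟨h, hs.2.le⟩)
  refine (lintegral_mono_set hsub).trans ?_
  refine (lintegral_union_le _ _ _).trans ?_
  have h0 : ∫⁻ s in ({0} : Set ℝ), ENNReal.ofReal (|s| ^ (ε - 1)) = 0 := by
    simp
  rw [h0, add_zero]
  refine (lintegral_union_le _ _ _).trans ?_
  rw [h2, h1, ← ENNReal.ofReal_add (by positivity) (by positivity)]
  apply ENNReal.ofReal_le_ofReal
  apply le_of_eq; ring

lemma pow_int_E (ε δ a : ℝ) (hε : 0 < ε) (hε1 : ε < 1) (hδ : 0 < δ) (E : Set ℝ)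
    (hE : volume E ≤ ENNReal.ofReal δ) :
    ∫⁻ t in E, ENNReal.ofReal (|t - a| ^ (ε - 1)) ≤ ENNReal.ofReal ((2 / ε + 1) * δ ^ ε) := by
  have hp : ∀ t, ENNReal.ofReal (|t - a| ^ (ε - 1)) ≤
      (Ioo (-δ) δ).indicator (fun s => ENNReal.ofReal (|s| ^ (ε - 1))) (t - a) +
        ENNReal.ofReal (δ ^ (ε - 1)) := by
    intro t
    by_cases h : t - a ∈ Ioo (-δ) δ
    · rw [Set.indicator_of_mem h]; exact le_self_add
    · rw [Set.indicator_of_notMem h, zero_add]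
      apply ENNReal.ofReal_le_ofReal
      have : δ ≤ |t - a| := by
        by_contra hc
        exact h (abs_lt.1 (not_le.1 hc))
      exact Real.rpow_le_rpow_of_nonpos hδ this (by linarith)
  refine (lintegral_mono hp).trans ?_
  rw [lintegral_add_right _ measurable_const, lintegral_const, Measure.restrict_apply_univ]
  have e1 : ∫⁻ t in E, (Ioo (-δ) δ).indicator (fun s => ENNReal.ofReal (|s| ^ (ε - 1))) (t - a) ≤
      ENNReal.ofReal (2 / ε * δ ^ ε) := by
    refine (setLIntegral_le_lintegral _ _).trans ?_
    rw [lintegral_sub_right_eq_self (fun t => (Ioo (-δ) δ).indicator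
      (fun s => ENNReal.ofReal (|s| ^ (ε - 1))) t) a, lintegral_indicator measurableSet_Ioo]
    exact pow_int ε δ hε hδ
  have e2 : ENNReal.ofReal (δ ^ (ε - 1)) * volume E ≤ ENNReal.ofReal (δ ^ ε) := by
    refine (mul_le_mul_right hE _).trans ?_
    rw [← ENNReal.ofReal_mul (by positivity)]
    apply ENNReal.ofReal_le_ofReal
    rw [Real.rpow_sub_one hδ.ne']
    apply le_of_eq; field_simp
  refine (add_le_add e1 e2).trans ?_
  rw [← ENNReal.ofReal_add (by positivity) (by positivity)]
  apply ENNReal.ofReal_le_ofReal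
  apply le_of_eq; ring

lemma sin_int_E (ε : ℝ) (hε : 0 < ε) (hε1 : ε < 1) :
    ∃ C : ℝ, 0 < C ∧ ∀ (δ c : ℝ), 0 < δ → c ∈ Icc 0 (2 * π) → ∀ E : Set ℝ, MeasurableSet E →
      volume E ≤ ENNReal.ofReal δ →
      ∫⁻ t in E, ENNReal.ofReal (|sin (t - c)| ^ (ε - 1)) ∂ν0 ≤ ENNReal.ofReal (C * δ ^ ε) := by
  refine ⟨5 * ((2 / π) ^ (ε - 1) * (2 / ε + 1)), by positivity, ?_⟩
  intro δ c hδ hc E hEm hE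
  have hp := Real.pi_pos
  have hrw : ν0.restrict E = (volume.restrict E).restrict (Ioc 0 (2 * π)) := by
    rw [ν0, Measure.restrict_restrict hEm, Measure.restrict_restrict measurableSet_Ioc, inter_comm]
  rw [hrw]
  have hpt : ∀ t ∈ Ioc 0 (2 * π), ENNReal.ofReal (|sin (t - c)| ^ (ε - 1)) ≤
      ∑ k ∈ Finset.Icc (-2 : ℤ) 2, ENNReal.ofReal ((2 / π) ^ (ε - 1)) *
        ENNReal.ofReal (|t - (c + k * π)| ^ (ε - 1)) := by
    intro t ht
    obtain ⟨k, hk, hle⟩ := near_pt (t - c) (by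
      rw [abs_le]; constructor <;> linarith [ht.1, ht.2, hc.1, hc.2])
    refine le_trans ?_ (Finset.single_le_sum (f := fun k : ℤ => ENNReal.ofReal ((2 / π) ^ (ε - 1)) *
        ENNReal.ofReal (|t - (c + k * π)| ^ (ε - 1))) (fun _ _ => zero_le) hk)
    rw [← ENNReal.ofReal_mul (by positivity), ← Real.mul_rpow (by positivity) (abs_nonneg _),
      ← sub_sub]
    apply ENNReal.ofReal_le_ofReal
    by_cases h0 : |t - c - k * π| = 0
    · have : sin (t - c) = 0 := by
        have : t - c = k * π := by linarith [abs_eq_zero.1 h0]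
        rw [this, Real.sin_int_mul_pi]
      rw [this, abs_zero, Real.zero_rpow (by linarith)]
      positivity
    · have : 0 < |t - c - k * π| := lt_of_le_of_ne (abs_nonneg _) (Ne.symm h0)
      exact Real.rpow_le_rpow_of_nonpos (by positivity) hle (by linarith)
  refine (setLIntegral_mono' measurableSet_Ioc hpt).trans ?_
  refine (setLIntegral_le_lintegral _ _).trans ?_
  rw [lintegral_finsetSum _ (fun k _ => by fun_prop)]
  have : ∀ k ∈ Finset.Icc (-2 : ℤ) 2, ∫⁻ t in E, ENNReal.ofReal ((2 / π) ^ (ε - 1)) *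
        ENNReal.ofReal (|t - (c + k * π)| ^ (ε - 1)) ≤
        ENNReal.ofReal ((2 / π) ^ (ε - 1) * ((2 / ε + 1) * δ ^ ε)) := by
    intro k _
    rw [lintegral_const_mul _ (by fun_prop), ENNReal.ofReal_mul (by positivity)]
    exact mul_le_mul_right (pow_int_E ε δ _ hε hε1 hδ E hE) _
  refine (Finset.sum_le_sum this).trans ?_
  rw [Finset.sum_const, nsmul_eq_mul]
  have hc5 : (Finset.Icc (-2 : ℤ) 2).card = 5 := by decide
  rw [hc5, show ((5 : ℕ) : ℝ≥0∞) = ENNReal.ofReal 5 by simp, ← ENNReal.ofReal_mul (by norm_num)]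
  apply ENNReal.ofReal_le_ofReal
  apply le_of_eq; ring

lemma sin_near (ρ c : ℝ) (hc : c ∈ Icc 0 (2 * π)) :
    ν0 {t | |sin (t - c)| < ρ} ≤ ENNReal.ofReal (5 * π * ρ) := by
  have hp := Real.pi_pos
  rcases le_or_gt ρ 0 with h | hρ
  · have : {t | |sin (t - c)| < ρ} = ∅ := by
      ext t; simp; exact h.trans (abs_nonneg _)
    rw [this]; simp
  rw [ν0, Measure.restrict_apply (measurableSet_lt (by fun_prop) measurable_const)]
  have hsub : {t | |sin (t - c)| < ρ} ∩ Ioc 0 (2 * π) ⊆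
      ⋃ k ∈ Finset.Icc (-2 : ℤ) 2, Metric.closedBall (c + k * π) (π / 2 * ρ) := by
    rintro t ⟨h1, ht⟩
    obtain ⟨k, hk, hle⟩ := near_pt (t - c) (by
      rw [abs_le]; constructor <;> linarith [ht.1, ht.2, hc.1, hc.2])
    simp only [mem_iUnion]
    refine ⟨k, hk, ?_⟩
    rw [Metric.mem_closedBall, Real.dist_eq, ← sub_sub]
    have h2 := hle.trans h1.le
    rw [div_mul_eq_mul_div, div_le_iff₀ hp] at h2
    linarith
  refine (measure_mono hsub).trans ((measure_biUnion_finset_le _ _).trans ?_)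
  simp only [Real.volume_closedBall]
  rw [Finset.sum_const, nsmul_eq_mul]
  have hc5 : (Finset.Icc (-2 : ℤ) 2).card = 5 := by decide
  rw [hc5, show ((5 : ℕ) : ℝ≥0∞) = ENNReal.ofReal 5 by simp, ← ENNReal.ofReal_mul (by norm_num)]
  apply ENNReal.ofReal_le_ofReal
  apply le_of_eq; ring

lemma push_piece (f f' : ℝ → ℝ) (S : Set ℝ) (hS : MeasurableSet S)
    (hf : ∀ x, HasDerivAt f (f' x) x) (hinj : InjOn f S) (K : ℝ → ℝ≥0∞) :
    ∫⁻ x in S, ENNReal.ofReal |f' x| * K (f x) ≤ ∫⁻ v, K v := by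
  rw [← lintegral_image_eq_lintegral_abs_deriv_mul hS (fun x _ => (hf x).hasDerivWithinAt) hinj]
  exact setLIntegral_le_lintegral _ _

lemma push_sin (K : ℝ → ℝ≥0∞) :
    ∫⁻ x, ENNReal.ofReal |cos x| * K (sin x) ∂ν0 ≤ 3 * ∫⁻ v, K v := by
  have hp := Real.pi_pos
  have hsub : Ioc (0:ℝ) (2 * π) ⊆ (Icc (-(π / 2)) (π / 2) ∪ Icc (π / 2) (3 * π / 2)) ∪
      Icc (3 * π / 2) (2 * π) := by
    intro x hx
    rcases le_total x (π / 2) with h | h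
    · exact Or.inl (Or.inl ⟨by linarith [hx.1], h⟩)
    rcases le_total x (3 * π / 2) with h2 | h2
    · exact Or.inl (Or.inr ⟨h, h2⟩)
    · exact Or.inr ⟨h2, hx.2⟩
  refine (lintegral_mono_set hsub).trans ?_
  refine (lintegral_union_le _ _ _).trans ?_
  refine (add_le_add_left (lintegral_union_le _ _ _) _).trans ?_
  rw [show (3 : ℝ≥0∞) * ∫⁻ v, K v = (∫⁻ v, K v) + (∫⁻ v, K v) + ∫⁻ v, K v by ring]
  refine add_le_add (add_le_add ?_ ?_) ?_
  · exact push_piece sin cos _ measurableSet_Icc Real.hasDerivAt_sin Real.injOn_sin K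
  · refine push_piece sin cos _ measurableSet_Icc Real.hasDerivAt_sin ?_ K
    intro x hx y hy hxy
    have := Real.injOn_sin (x₁ := π - x) (x₂ := π - y) ⟨by linarith [hx.2], by linarith [hx.1]⟩
      ⟨by linarith [hy.2], by linarith [hy.1]⟩ (by simpa using hxy)
    linarith
  · refine push_piece sin cos _ measurableSet_Icc Real.hasDerivAt_sin ?_ K
    intro x hx y hy hxy
    have := Real.injOn_sin (x₁ := x - 2 * π) (x₂ := y - 2 * π)
      ⟨by linarith [hx.1], by linarith [hx.2]⟩
      ⟨by linarith [hy.1], by linarith [hy.2]⟩ (by simpa using hxy)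
    linarith

lemma push_cos (K : ℝ → ℝ≥0∞) :
    ∫⁻ x, ENNReal.ofReal |sin x| * K (cos x) ∂ν0 ≤ 3 * ∫⁻ v, K v := by
  have hp := Real.pi_pos
  have hsub : Ioc (0:ℝ) (2 * π) ⊆ Icc 0 π ∪ Icc π (2 * π) := by
    intro x hx
    rcases le_total x π with h | h
    · exact Or.inl ⟨by linarith [hx.1], h⟩
    · exact Or.inr ⟨h, hx.2⟩
  refine (lintegral_mono_set hsub).trans ?_
  refine (lintegral_union_le _ _ _).trans ?_
  refine le_trans ?_ (mul_le_mul_left (show (2 : ℝ≥0∞) ≤ 3 by norm_num) _)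
  rw [two_mul (∫⁻ v, K v)]
  have hd : ∀ x : ℝ, HasDerivAt cos (-sin x) x := Real.hasDerivAt_cos
  refine add_le_add (?_ : _ ≤ (∫⁻ v, K v : ℝ≥0∞)) (?_ : _ ≤ (∫⁻ v, K v : ℝ≥0∞))
  · have := push_piece cos (fun x => -sin x) _ measurableSet_Icc hd Real.injOn_cos K
    simpa only [abs_neg] using this
  · have key := push_piece cos (fun x => -sin x) (Icc π (2 * π)) measurableSet_Icc hd ?_ K
    · simpa only [abs_neg] using key
    intro x hx y hy hxy
    have := Real.injOn_cos (x₁ := 2 * π - x) (x₂ := 2 * π - y)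
      ⟨by linarith [hx.2], by linarith [hx.1]⟩
      ⟨by linarith [hy.2], by linarith [hy.1]⟩ (by simpa using hxy)
    linarith

lemma ang_eq (x y : ℝ) (hx : x ∈ Ioc 0 (2 * π)) (hy : y ∈ Ioc 0 (2 * π))
    (hc : cos x = cos y) (hs : sin x = sin y) : x = y := by
  have h : cos (x - y) = 1 := by
    rw [Real.cos_sub, hc, hs]; nlinarith [Real.sin_sq_add_cos_sq y]
  have := (Real.cos_eq_one_iff_of_lt_of_lt (x := x - y)
    (by linarith [hx.1, hx.2, hy.1, hy.2]) (by linarith [hx.1, hx.2, hy.1, hy.2])).1 h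
  linarith

/-- algebraic injectivity: two unit vectors with given sum. -/
lemma unit_sum0 (a b X Y a' b' : ℝ) (h1 : a ^ 2 + b ^ 2 = 1) (h2 : (X - a) ^ 2 + (Y - b) ^ 2 = 1)
    (h1' : a' ^ 2 + b' ^ 2 = 1) (h2' : (X - a') ^ 2 + (Y - b') ^ 2 = 1)
    (hs : 0 < (b * X - a * Y) * (b' * X - a' * Y)) : a = a' ∧ b = b' := by
  have e2 : a * X + b * Y = a' * X + b' * Y := by linarith
  have q1 : (b * X - a * Y) ^ 2 + (a * X + b * Y) ^ 2 = X ^ 2 + Y ^ 2 := by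
    linear_combination (X ^ 2 + Y ^ 2) * h1
  have q1' : (b' * X - a' * Y) ^ 2 + (a' * X + b' * Y) ^ 2 = X ^ 2 + Y ^ 2 := by
    linear_combination (X ^ 2 + Y ^ 2) * h1'
  have sq : (b * X - a * Y) ^ 2 = (b' * X - a' * Y) ^ 2 := by rw [e2] at q1; linarith
  have ss : b * X - a * Y = b' * X - a' * Y := by
    rcases sq_eq_sq_iff_eq_or_eq_neg.1 sq with h | h
    · exact h
    · rw [h] at hs
      have := mul_self_nonneg (b' * X - a' * Y)
      linarith
  have hR0 : X ^ 2 + Y ^ 2 ≠ 0 := by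
    intro h0
    rw [h0] at q1
    have : (b * X - a * Y) ^ 2 = 0 := by
      have := sq_nonneg (b * X - a * Y)
      have := sq_nonneg (a * X + b * Y)
      linarith
    have : b * X - a * Y = 0 := by simpa using this
    rw [this] at hs; simp at hs
  have ha : (a - a') * (X ^ 2 + Y ^ 2) = 0 := by linear_combination X * e2 - Y * ss
  have hb : (b - b') * (X ^ 2 + Y ^ 2) = 0 := by linear_combination Y * e2 + X * ss
  exact ⟨sub_eq_zero.1 ((mul_eq_zero.1 ha).resolve_right hR0),
    sub_eq_zero.1 ((mul_eq_zero.1 hb).resolve_right hR0)⟩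

lemma unit_sum (a b c d a' b' c' d' : ℝ) (h1 : a ^ 2 + b ^ 2 = 1) (h2 : c ^ 2 + d ^ 2 = 1)
    (h1' : a' ^ 2 + b' ^ 2 = 1) (h2' : c' ^ 2 + d' ^ 2 = 1)
    (hx : a + c = a' + c') (hy : b + d = b' + d')
    (hs : 0 < (b * c - a * d) * (b' * c' - a' * d')) : a = a' ∧ b = b' ∧ c = c' ∧ d = d' := by
  have h := unit_sum0 a b (a + c) (b + d) a' b' h1 (by ring_nf; linarith) h1'
    (by rw [hx, hy]; ring_nf; linarith)
    (by
      have e1 : b * (a + c) - a * (b + d) = b * c - a * d := by ring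
      have e2 : b' * (a + c) - a' * (b + d) = b' * c' - a' * d' := by rw [hx, hy]; ring
      rw [e1, e2]; exact hs)
  exact ⟨h.1, h.2, by linarith [h.1], by linarith [h.2]⟩

/-- Sum map on the torus. -/
def Phi (p : ℝ × ℝ) : ℝ × ℝ := (cos p.1 + cos p.2, sin p.1 + sin p.2)

/-- Its derivative. -/
def dPhi (p : ℝ × ℝ) : ℝ × ℝ →L[ℝ] ℝ × ℝ :=
  (Matrix.toLin (.finTwoProd ℝ) (.finTwoProd ℝ)
    !![-sin p.1, -sin p.2; cos p.1, cos p.2]).toContinuousLinearMap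

lemma hasFDerivAt_Phi (p : ℝ × ℝ) : HasFDerivAt Phi (dPhi p) p := by
  unfold dPhi
  rw [Matrix.toLin_finTwoProd_toContinuousLinearMap]
  convert!
    HasFDerivAt.prodMk (𝕜 := ℝ)
      (((hasDerivAt_cos p.1).comp_hasFDerivAt p hasFDerivAt_fst).add
        ((hasDerivAt_cos p.2).comp_hasFDerivAt p hasFDerivAt_snd))
      (((hasDerivAt_sin p.1).comp_hasFDerivAt p hasFDerivAt_fst).add
        ((hasDerivAt_sin p.2).comp_hasFDerivAt p hasFDerivAt_snd)) using 2

lemma det_dPhi (p : ℝ × ℝ) : |(dPhi p).det| = |sin (p.1 - p.2)| := by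
  conv_lhs => rw [dPhi, LinearMap.det_toContinuousLinearMap, LinearMap.det_toLin,
    Matrix.det_fin_two_of]
  rw [← abs_neg, Real.sin_sub]
  congr 1; ring

lemma push_Phi_piece (S : Set (ℝ × ℝ)) (hS : MeasurableSet S) (hinj : InjOn Phi S)
    (K : ℝ × ℝ → ℝ≥0∞) :
    ∫⁻ p in S, ENNReal.ofReal |sin (p.1 - p.2)| * K (Phi p) ≤ ∫⁻ v, K v := by
  have := lintegral_image_eq_lintegral_abs_det_fderiv_mul volume hS
    (fun p _ => (hasFDerivAt_Phi p).hasFDerivWithinAt) hinj K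
  simp_rw [det_dPhi] at this
  rw [← this]
  exact setLIntegral_le_lintegral _ _

lemma push_Phi (K : ℝ × ℝ → ℝ≥0∞) :
    ∫⁻ p, ENNReal.ofReal |sin (p.1 - p.2)| * K (Phi p) ∂(ν0.prod ν0) ≤ 2 * ∫⁻ v, K v := by
  have e : ν0.prod ν0 = (volume : Measure (ℝ × ℝ)).restrict (Ioc 0 (2 * π) ×ˢ Ioc 0 (2 * π)) := by
    rw [ν0, Measure.prod_restrict]; rfl
  rw [e]
  set Q : Set (ℝ × ℝ) := Ioc 0 (2 * π) ×ˢ Ioc 0 (2 * π) with hQ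
  have hQm : MeasurableSet Q := measurableSet_Ioc.prod measurableSet_Ioc
  set S1 : Set (ℝ × ℝ) := Q ∩ {p | 0 < sin (p.1 - p.2)} with hS1
  set S2 : Set (ℝ × ℝ) := Q ∩ {p | sin (p.1 - p.2) < 0} with hS2
  set S3 : Set (ℝ × ℝ) := Q ∩ {p | sin (p.1 - p.2) = 0} with hS3
  have m1 : MeasurableSet S1 := hQm.inter (measurableSet_lt measurable_const (by fun_prop))
  have m2 : MeasurableSet S2 := hQm.inter (measurableSet_lt (by fun_prop) measurable_const)
  have m3 : MeasurableSet S3 := hQm.inter (measurableSet_eq_fun (by fun_prop) measurable_const)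
  have hinj : ∀ p ∈ Q, ∀ p' ∈ Q, 0 < sin (p.1 - p.2) * sin (p'.1 - p'.2) → Phi p = Phi p' →
      p = p' := by
    intro p hp p' hp' hs h
    simp only [Phi, Prod.mk.injEq] at h
    rw [Real.sin_sub, Real.sin_sub] at hs
    obtain ⟨h1, h2, h3, h4⟩ := unit_sum (cos p.1) (sin p.1) (cos p.2) (sin p.2)
      (cos p'.1) (sin p'.1) (cos p'.2) (sin p'.2) (by simp) (by simp)
      (by simp) (by simp) h.1 h.2 hs
    exact Prod.ext (ang_eq _ _ hp.1 hp'.1 h1 h2) (ang_eq _ _ hp.2 hp'.2 h3 h4)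
  have hsub : Q ⊆ (S1 ∪ S2) ∪ S3 := by
    intro p hp
    rcases lt_trichotomy (sin (p.1 - p.2)) 0 with h | h | h
    · exact Or.inl (Or.inr ⟨hp, h⟩)
    · exact Or.inr ⟨hp, h⟩
    · exact Or.inl (Or.inl ⟨hp, h⟩)
  refine (lintegral_mono_set hsub).trans ?_
  refine (lintegral_union_le _ _ _).trans ?_
  have h3 : ∫⁻ p in S3, ENNReal.ofReal |sin (p.1 - p.2)| * K (Phi p) = 0 := by
    rw [setLIntegral_congr_fun (g := fun _ => 0) m3]
    · simp
    · intro p hp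
      have : sin (p.1 - p.2) = 0 := hp.2
      simp [this]
  rw [h3, add_zero]
  refine (lintegral_union_le _ _ _).trans ?_
  rw [two_mul]
  refine add_le_add (push_Phi_piece S1 m1 ?_ K) (push_Phi_piece S2 m2 ?_ K)
  · intro p hp p' hp' h
    exact hinj p hp.1 p' hp'.1 (mul_pos hp.2 hp'.2) h
  · intro p hp p' hp' h
    exact hinj p hp.1 p' hp'.1 (mul_pos_of_neg_of_neg hp.2 hp'.2) h

lemma push_PhiC (K : ℂ → ℝ≥0∞) :
    ∫⁻ p, ENNReal.ofReal |sin (p.1 - p.2)| * K ⟨(Phi p).1, (Phi p).2⟩ ∂(ν0.prod ν0) ≤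
      2 * ∫⁻ v, K v := by
  have h := push_Phi (fun p => K (Complex.measurableEquivRealProd.symm p))
  rw [(Complex.volume_preserving_equiv_real_prod.symm).lintegral_comp_emb
    Complex.measurableEquivRealProd.symm.measurableEmbedding K] at h
  exact h

/-- Normalized functions: bounded by one and supported on a set of measure at most `δ`. -/
def Nrm (f : ℝ → ℂ) (δ : ℝ) : Prop :=
  Measurable f ∧ (∀ φ, ‖f φ‖ ≤ 1) ∧
    ∃ E : Set ℝ, MeasurableSet E ∧ volume E ≤ ENNReal.ofReal δ ∧ ∀ φ, φ ∉ E → f φ = 0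

/-- Unnormalized extension operator. -/
def Tf (f : ℝ → ℂ) (x y : ℝ) : ℂ :=
  ∫ φ, f φ * Complex.exp (Complex.I * ((x * cos φ + y * sin φ : ℝ) : ℂ)) ∂ν0

lemma Nrm.mul {f : ℝ → ℂ} {δ : ℝ} (h : Nrm f δ) (g : ℝ → ℂ) (hg : Measurable g)
    (hg1 : ∀ φ, ‖g φ‖ ≤ 1) : Nrm (fun φ => f φ * g φ) δ := by
  obtain ⟨h1, h2, E, h3, h4, h5⟩ := h
  refine ⟨h1.mul hg, fun φ => ?_, E, h3, h4, fun φ hφ => by simp [h5 φ hφ]⟩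
  rw [norm_mul]
  exact mul_le_one₀ (h2 φ) (norm_nonneg _) (hg1 φ)

lemma Nrm.integrable {f : ℝ → ℂ} {δ : ℝ} (h : Nrm f δ) : Integrable f ν0 :=
  Integrable.of_bound h.1.aestronglyMeasurable 1 (ae_of_all _ h.2.1)

lemma Nrm.lint {f : ℝ → ℂ} {δ : ℝ} (h : Nrm f δ) : ∫⁻ φ, ‖f φ‖ₑ ∂ν0 ≤ ENNReal.ofReal δ := by
  obtain ⟨h1, h2, E, h3, h4, h5⟩ := h
  calc ∫⁻ φ, ‖f φ‖ₑ ∂ν0 ≤ ∫⁻ φ, E.indicator 1 φ ∂ν0 := by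
        refine lintegral_mono fun φ => ?_
        by_cases hφ : φ ∈ E
        · simp only [hφ, indicator_of_mem, Pi.one_apply]
          rw [← ofReal_norm]
          exact ENNReal.ofReal_le_one.2 (h2 φ)
        · simp [hφ, h5]
    _ = ν0 E := by rw [lintegral_indicator_one h3]
    _ ≤ volume E := Measure.restrict_apply_le _ _
    _ ≤ _ := h4

lemma one_gen (ψ : ℝ → ℝ) (hψ : Measurable ψ) (c : ℝ) (hc : c ∈ Icc 0 (2 * π))
    (hpush : ∀ K : ℝ → ℝ≥0∞, Measurable K →
      ∫⁻ t, ENNReal.ofReal |sin (t - c)| * K (ψ t) ∂ν0 ≤ 3 * ∫⁻ v, K v)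
    (ε : ℝ) (hε : 0 < ε) (hε1 : ε < 1) :
    ∃ C > 0, ∀ h δ μ, 0 < δ → 0 < μ → Nrm h δ →
      volume {v : ℝ | μ < ‖oscI ν0 ψ h v‖} ≤
        ENNReal.ofReal (C * (μ ^ (-2 : ℝ) * (δ / μ) ^ ε)) := by
  obtain ⟨C0, hC0, hint⟩ := sin_int_E ε hε hε1
  have hp := Real.pi_pos
  refine ⟨4 * (3 * (4 * π ^ 2) ^ (1 / 2 : ℝ) * ((10 * π) ^ ε * C0)), by positivity, ?_⟩
  intro h δ μ hδ hμ hN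
  have hi := hN.integrable
  obtain ⟨h1, h2, E, h3, h4, h5⟩ := hN
  have hρ : 0 < μ / (10 * π) := by positivity
  have hJm : Measurable (fun t => |sin (t - c)|) := by fun_prop
  have := nearfar (ν := ν0) (ψ := ψ) (h := h) hψ h1 hi (fun t => |sin (t - c)|) hJm
    (fun _ => abs_nonneg _) 3 hpush (μ / (10 * π)) μ hρ hμ
    (ENNReal.ofReal ((μ / (10 * π)) ^ (-ε)) * ENNReal.ofReal (C0 * δ ^ ε)) ?_ ?_
  · refine this.trans (le_of_eq ?_)
    rw [show (3 : ℝ≥0∞) = ENNReal.ofReal 3 by simp, ← ENNReal.ofReal_mul (by positivity),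
      ← ENNReal.ofReal_mul (by positivity), ← ENNReal.ofReal_mul (by positivity),
      ← ENNReal.ofReal_mul (by positivity)]
    congr 1
    rw [Real.rpow_neg hρ.le, Real.div_rpow hμ.le (by positivity), Real.div_rpow hδ.le hμ.le]
    simp only [Module.finrank_self, Nat.cast_one]
    have : μ ^ ε ≠ 0 := by positivity
    have : (10 * π) ^ ε ≠ 0 := by positivity
    field_simp
  · calc ∫⁻ ω in {ω | |sin (ω - c)| < μ / (10 * π)}, ‖h ω‖ₑ ∂ν0
        ≤ ∫⁻ ω in {ω | |sin (ω - c)| < μ / (10 * π)}, 1 ∂ν0 := by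
          refine lintegral_mono fun φ => ?_
          rw [← ofReal_norm]
          exact ENNReal.ofReal_le_one.2 (h2 φ)
      _ = ν0 {ω | |sin (ω - c)| < μ / (10 * π)} := by simp
      _ ≤ _ := sin_near _ c hc
      _ = _ := by congr 1; field_simp; norm_num
  · calc ∫⁻ ω in {ω | μ / (10 * π) ≤ |sin (ω - c)|},
          ENNReal.ofReal (‖h ω‖ ^ 2 / |sin (ω - c)|) ∂ν0
        ≤ ∫⁻ ω in {ω | μ / (10 * π) ≤ |sin (ω - c)|},
          E.indicator (fun t => ENNReal.ofReal ((μ / (10 * π)) ^ (-ε)) *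
            ENNReal.ofReal (|sin (t - c)| ^ (ε - 1))) ω ∂ν0 := by
          refine setLIntegral_mono' (measurableSet_le measurable_const hJm) fun t ht => ?_
          by_cases hφ : t ∈ E
          · simp only [hφ, indicator_of_mem]
            have ht : μ / (10 * π) ≤ |sin (t - c)| := ht
            have hpos := hρ.trans_le ht
            rw [← ENNReal.ofReal_mul (by positivity)]
            refine ENNReal.ofReal_le_ofReal ?_
            have e1 : |sin (t - c)| ^ (ε - 1) = |sin (t - c)| ^ ε / |sin (t - c)| := by
              rw [Real.rpow_sub hpos, Real.rpow_one]
            rw [e1, ← mul_div_assoc]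
            gcongr
            have e2 : 1 ≤ (μ / (10 * π)) ^ (-ε) * |sin (t - c)| ^ ε := by
              rw [Real.rpow_neg hρ.le, ← div_eq_inv_mul, one_le_div (by positivity)]
              exact Real.rpow_le_rpow hρ.le ht hε.le
            exact (pow_le_one₀ (norm_nonneg _) (h2 t)).trans e2
          · simp [hφ, h5]
      _ ≤ ∫⁻ ω, E.indicator (fun t => ENNReal.ofReal ((μ / (10 * π)) ^ (-ε)) *
            ENNReal.ofReal (|sin (t - c)| ^ (ε - 1))) ω ∂ν0 := setLIntegral_le_lintegral _ _
      _ = ENNReal.ofReal ((μ / (10 * π)) ^ (-ε)) *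
            ∫⁻ t in E, ENNReal.ofReal (|sin (t - c)| ^ (ε - 1)) ∂ν0 := by
          rw [lintegral_indicator h3, lintegral_const_mul _ (by fun_prop)]
      _ ≤ _ := mul_le_mul_right (hint δ c hδ hc E h3 h4) _

lemma one_bdd (ψ : ℝ → ℝ) (hψ : Measurable ψ) (J : ℝ → ℝ) (hJm : Measurable J)
    (hJ0 : ∀ t, 0 ≤ J t)
    (hpush : ∀ K : ℝ → ℝ≥0∞, Measurable K →
      ∫⁻ t, ENNReal.ofReal (J t) * K (ψ t) ∂ν0 ≤ 3 * ∫⁻ v, K v) :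
    ∃ C > 0, ∀ h δ μ, 0 < δ → 0 < μ → Nrm h δ → (∀ t, J t < 1 / 2 → h t = 0) →
      volume {v : ℝ | μ < ‖oscI ν0 ψ h v‖} ≤
        ENNReal.ofReal (C * (μ ^ (-2 : ℝ) * δ)) := by
  have hp := Real.pi_pos
  refine ⟨4 * (3 * (4 * π ^ 2) ^ (1 / 2 : ℝ) * 2), by positivity, ?_⟩
  intro h δ μ hδ hμ hN hsupp
  have hi := hN.integrable
  obtain ⟨h1, h2, E, h3, h4, h5⟩ := hN
  have := nearfar (ν := ν0) (ψ := ψ) (h := h) hψ h1 hi J hJm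
    hJ0 3 hpush (1 / 2) μ (by norm_num) hμ
    (2 * ENNReal.ofReal δ) ?_ ?_
  · refine this.trans (le_of_eq ?_)
    rw [show (3 : ℝ≥0∞) = ENNReal.ofReal 3 by simp, show (2 : ℝ≥0∞) = ENNReal.ofReal 2 by simp,
      ← ENNReal.ofReal_mul (by positivity),
      ← ENNReal.ofReal_mul (by positivity), ← ENNReal.ofReal_mul (by positivity),
      ← ENNReal.ofReal_mul (by positivity)]
    congr 1
    simp only [Module.finrank_self, Nat.cast_one]
    ring
  · refine le_trans (le_of_eq ?_) zero_le
    rw [setLIntegral_congr_fun (g := fun _ => 0) (measurableSet_lt hJm measurable_const)]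
    · simp
    · intro t ht
      simp [hsupp t ht]
  · calc ∫⁻ ω in {ω | 1 / 2 ≤ J ω}, ENNReal.ofReal (‖h ω‖ ^ 2 / J ω) ∂ν0
        ≤ ∫⁻ ω in {ω | 1 / 2 ≤ J ω}, E.indicator (fun t => 2) ω ∂ν0 := by
          refine setLIntegral_mono' (measurableSet_le measurable_const hJm) fun t ht => ?_
          by_cases hφ : t ∈ E
          · simp only [hφ, indicator_of_mem]
            have ht : 1 / 2 ≤ J t := ht
            rw [show (2 : ℝ≥0∞) = ENNReal.ofReal 2 by simp]
            refine ENNReal.ofReal_le_ofReal ?_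
            rw [div_le_iff₀ (by linarith)]
            have := pow_le_one₀ (n := 2) (norm_nonneg _) (h2 t)
            linarith
          · simp [hφ, h5]
      _ ≤ ∫⁻ ω, E.indicator (fun t => 2) ω ∂ν0 := setLIntegral_le_lintegral _ _
      _ = 2 * ν0 E := by rw [lintegral_indicator h3]; simp
      _ ≤ 2 * volume E := mul_le_mul_right (Measure.restrict_apply_le _ _) _
      _ ≤ _ := mul_le_mul_right h4 _

lemma ae_ν0 : ∀ᵐ t ∂ν0, t ∈ Icc 0 (2 * π) := by
  unfold ν0
  filter_upwards [ae_restrict_mem measurableSet_Ioc] with t ht using ⟨ht.1.le, ht.2⟩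

lemma Tf_sq (f : ℝ → ℂ) (x y : ℝ) :
    Tf f x y ^ 2 = oscI (ν0.prod ν0) (fun p : ℝ × ℝ => (⟨(Phi p).1, (Phi p).2⟩ : ℂ))
      (fun p => f p.1 * f p.2) ⟨x, y⟩ := by
  unfold Tf oscI
  rw [sq, ← integral_prod_mul]
  refine integral_congr_ae (ae_of_all _ fun p => ?_)
  simp only [Phi, Complex.inner, Complex.mul_re, Complex.conj_re, Complex.conj_im]
  rw [mul_mul_mul_comm, ← Complex.exp_add, ← mul_add, ← Complex.ofReal_add]
  congr 4
  ring

lemma two_gen (ε : ℝ) (hε : 0 < ε) (hε1 : ε < 1) :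
    ∃ C > 0, ∀ f δ μ, 0 < δ → 0 < μ → Nrm f δ →
      volume {p : ℝ × ℝ | μ < ‖Tf f p.1 p.2‖} ≤
        ENNReal.ofReal (C * (μ ^ (-4 : ℝ) * δ * (δ / μ) ^ ε)) := by
  obtain ⟨C0, hC0, hint⟩ := sin_int_E (ε / 2) (by linarith) (by linarith)
  have hp := Real.pi_pos
  refine ⟨4 * (2 * (4 * π ^ 2) ^ (2 / 2 : ℝ) * ((10 * π) ^ (ε / 2) * C0)), by positivity, ?_⟩
  intro h δ μ hδ hμ hN
  have hi := hN.integrable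
  have hl := hN.lint
  obtain ⟨h1, h2, E, h3, h4, h5⟩ := hN
  set ρ := μ ^ 2 / (10 * π * δ) with hρd
  have hρ : 0 < ρ := by positivity
  have hJm : Measurable (fun p : ℝ × ℝ => |sin (p.1 - p.2)|) := by fun_prop
  have hψ : Measurable (fun p : ℝ × ℝ => (⟨(Phi p).1, (Phi p).2⟩ : ℂ)) := by
    refine Complex.measurableEquivRealProd.symm.measurable.comp (g := _) (f := Phi) ?_
    unfold Phi; fun_prop
  have hE : ∀ t, ‖h t‖ₑ ≤ E.indicator 1 t := by
    intro t
    by_cases hφ : t ∈ E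
    · simp only [hφ, indicator_of_mem, Pi.one_apply]
      rw [← ofReal_norm]
      exact ENNReal.ofReal_le_one.2 (h2 t)
    · simp [hφ, h5]
  have := nearfar (ν := ν0.prod ν0) (ψ := fun p : ℝ × ℝ => (⟨(Phi p).1, (Phi p).2⟩ : ℂ))
    (h := fun p => h p.1 * h p.2) hψ (by fun_prop) (hi.mul_prod hi)
    (fun p => |sin (p.1 - p.2)|) hJm
    (fun _ => abs_nonneg _) 2 (fun K _ => push_PhiC K) ρ (μ ^ 2) hρ (by positivity)
    (ENNReal.ofReal (ρ ^ (-(ε / 2))) * (ENNReal.ofReal (C0 * δ ^ (ε / 2)) * ENNReal.ofReal δ)) ?_ ?_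
  · have ev : volume {p : ℝ × ℝ | μ < ‖Tf h p.1 p.2‖} = volume {v : ℂ | μ ^ 2 <
        ‖oscI (ν0.prod ν0) (fun p : ℝ × ℝ => (⟨(Phi p).1, (Phi p).2⟩ : ℂ))
          (fun p => h p.1 * h p.2) v‖} := by
      rw [← Complex.volume_preserving_equiv_real_prod.symm.measure_preimage_equiv]
      congr 1
      ext p
      have e : Complex.measurableEquivRealProd.symm p = ⟨p.1, p.2⟩ := rfl
      simp only [mem_ofPred_eq, mem_preimage, e]
      rw [← Tf_sq, norm_pow]
      exact (pow_lt_pow_iff_left₀ hμ.le (norm_nonneg _) (by norm_num)).symm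
    rw [ev]
    refine this.trans (le_of_eq ?_)
    rw [show (2 : ℝ≥0∞) = ENNReal.ofReal 2 by simp, ← ENNReal.ofReal_mul (by positivity),
      ← ENNReal.ofReal_mul (by positivity), ← ENNReal.ofReal_mul (by positivity),
      ← ENNReal.ofReal_mul (by positivity), ← ENNReal.ofReal_mul (by positivity)]
    congr 1
    have e1 : ρ ^ (-(ε / 2)) = (10 * π) ^ (ε / 2) * δ ^ (ε / 2) / μ ^ ε := by
      rw [Real.rpow_neg hρ.le, hρd, Real.div_rpow (by positivity) (by positivity),
        Real.mul_rpow (by positivity) hδ.le, inv_div, ← Real.rpow_natCast_mul hμ.le]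
      congr 2; push_cast; ring
    have e2 : (δ / μ) ^ ε = δ ^ (ε / 2) * δ ^ (ε / 2) / μ ^ ε := by
      rw [Real.div_rpow hδ.le hμ.le, ← Real.rpow_add hδ]; congr 2; ring
    have e3 : (μ ^ 2) ^ (-2 : ℝ) = μ ^ (-4 : ℝ) := by
      rw [← Real.rpow_natCast_mul hμ.le]; norm_num
    rw [e1, e2, e3, Complex.finrank_real_complex]
    push_cast
    ring
  · calc ∫⁻ p in {p : ℝ × ℝ | |sin (p.1 - p.2)| < ρ}, ‖h p.1 * h p.2‖ₑ ∂(ν0.prod ν0)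
        = ∫⁻ p, {p : ℝ × ℝ | |sin (p.1 - p.2)| < ρ}.indicator (fun p => ‖h p.1 * h p.2‖ₑ) p
            ∂(ν0.prod ν0) := by
          rw [lintegral_indicator (measurableSet_lt hJm measurable_const)]
      _ ≤ ∫⁻ p, ‖h p.1‖ₑ * {p : ℝ × ℝ | |sin (p.1 - p.2)| < ρ}.indicator 1 p
            ∂(ν0.prod ν0) := by
          refine lintegral_mono fun p => ?_
          by_cases hp' : p ∈ {p : ℝ × ℝ | |sin (p.1 - p.2)| < ρ}
          · simp only [hp', indicator_of_mem, Pi.one_apply]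
            rw [enorm_mul]
            refine mul_le_mul_right ?_ _
            rw [← ofReal_norm]
            exact ENNReal.ofReal_le_one.2 (h2 _)
          · simp [hp']
      _ = ∫⁻ s, ∫⁻ t, ‖h s‖ₑ * {p : ℝ × ℝ | |sin (p.1 - p.2)| < ρ}.indicator 1 (s, t) ∂ν0 ∂ν0 := by
          rw [lintegral_prod]
          refine Measurable.aemeasurable ?_
          refine (h1.comp measurable_fst).enorm.mul ?_
          exact measurable_one.indicator (measurableSet_lt hJm measurable_const)
      _ ≤ ∫⁻ s, ‖h s‖ₑ * ENNReal.ofReal (5 * π * ρ) ∂ν0 := by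
          refine lintegral_mono_ae ?_
          filter_upwards [ae_ν0] with s hs
          have hm : MeasurableSet {t : ℝ | |sin (t - s)| < ρ} :=
            measurableSet_lt (by fun_prop) measurable_const
          have e : ∀ t, ({p : ℝ × ℝ | |sin (p.1 - p.2)| < ρ}.indicator 1 (s, t) : ℝ≥0∞)
              = {t : ℝ | |sin (t - s)| < ρ}.indicator 1 t := by
            intro t
            have : |sin (s - t)| = |sin (t - s)| := by
              rw [← abs_neg, ← Real.sin_neg]; congr 2; ring
            simp only [indicator, mem_ofPred_eq, this, Pi.one_apply]
          simp_rw [e]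
          rw [lintegral_const_mul _ (measurable_one.indicator hm), lintegral_indicator_one hm]
          exact mul_le_mul_right (sin_near _ s hs) _
      _ = (∫⁻ s, ‖h s‖ₑ ∂ν0) * ENNReal.ofReal (5 * π * ρ) := by
          rw [lintegral_mul_const _ h1.enorm]
      _ ≤ ENNReal.ofReal δ * ENNReal.ofReal (5 * π * ρ) := mul_le_mul_left hl _
      _ = _ := by
          rw [← ENNReal.ofReal_mul hδ.le, hρd]
          congr 1; field_simp; norm_num
  · have hJE : Measurable (fun p : ℝ × ℝ => ENNReal.ofReal (|sin (p.1 - p.2)| ^ (ε / 2 - 1))) := by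
      fun_prop
    calc ∫⁻ p in {p : ℝ × ℝ | ρ ≤ |sin (p.1 - p.2)|},
          ENNReal.ofReal (‖h p.1 * h p.2‖ ^ 2 / |sin (p.1 - p.2)|) ∂(ν0.prod ν0)
        ≤ ∫⁻ p in {p : ℝ × ℝ | ρ ≤ |sin (p.1 - p.2)|}, ENNReal.ofReal (ρ ^ (-(ε / 2))) *
          (E ×ˢ E).indicator (fun p => 
            ENNReal.ofReal (|sin (p.1 - p.2)| ^ (ε / 2 - 1))) p ∂(ν0.prod ν0) := by
          refine setLIntegral_mono' (measurableSet_le measurable_const hJm) fun t ht => ?_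
          by_cases hφ : t ∈ E ×ˢ E
          · simp only [hφ, indicator_of_mem]
            have ht : ρ ≤ |sin (t.1 - t.2)| := ht
            have hpos := hρ.trans_le ht
            rw [← ENNReal.ofReal_mul (by positivity)]
            refine ENNReal.ofReal_le_ofReal ?_
            have e1 : |sin (t.1 - t.2)| ^ (ε / 2 - 1) = 
                |sin (t.1 - t.2)| ^ (ε / 2) / |sin (t.1 - t.2)| := by
              rw [Real.rpow_sub hpos, Real.rpow_one]
            rw [e1, ← mul_div_assoc]
            gcongr
            have e2 : 1 ≤ ρ ^ (-(ε / 2)) * |sin (t.1 - t.2)| ^ (ε / 2) := by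
              rw [Real.rpow_neg hρ.le, ← div_eq_inv_mul, one_le_div (by positivity)]
              exact Real.rpow_le_rpow hρ.le ht (by linarith)
            refine le_trans (pow_le_one₀ (norm_nonneg _) ?_) e2
            rw [norm_mul]
            exact mul_le_one₀ (h2 _) (norm_nonneg _) (h2 _)
          · have : h t.1 * h t.2 = 0 := by
              by_contra hne
              rw [mul_eq_zero, not_or] at hne
              exact hφ ⟨by by_contra h'; exact hne.1 (h5 _ h'),
                by by_contra h'; exact hne.2 (h5 _ h')⟩
            simp [hφ, this]
      _ ≤ ∫⁻ p, ENNReal.ofReal (ρ ^ (-(ε / 2))) *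
          (E ×ˢ E).indicator (fun p => 
            ENNReal.ofReal (|sin (p.1 - p.2)| ^ (ε / 2 - 1))) p ∂(ν0.prod ν0) :=
          setLIntegral_le_lintegral _ _
      _ = ENNReal.ofReal (ρ ^ (-(ε / 2))) * ∫⁻ s, ∫⁻ t,
          (E ×ˢ E).indicator (fun p => 
            ENNReal.ofReal (|sin (p.1 - p.2)| ^ (ε / 2 - 1))) (s, t) ∂ν0 ∂ν0 := by
          rw [lintegral_const_mul _ (hJE.indicator (h3.prod h3)), lintegral_prod]
          exact (hJE.indicator (h3.prod h3)).aemeasurable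
      _ ≤ ENNReal.ofReal (ρ ^ (-(ε / 2))) * ∫⁻ s, ENNReal.ofReal (C0 * δ ^ (ε / 2)) *
            E.indicator 1 s ∂ν0 := by
          refine mul_le_mul_right (lintegral_mono_ae ?_) _
          filter_upwards [ae_ν0] with s hs
          have e : ∀ t, (E ×ˢ E).indicator (fun p : ℝ × ℝ => 
              ENNReal.ofReal (|sin (p.1 - p.2)| ^ (ε / 2 - 1))) (s, t) =
              E.indicator 1 s * E.indicator (fun t =>
                ENNReal.ofReal (|sin (t - s)| ^ (ε / 2 - 1))) t := by
            intro t
            have : |sin (s - t)| = |sin (t - s)| := by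
              rw [← abs_neg, ← Real.sin_neg]; congr 2; ring
            by_cases hs' : s ∈ E <;> by_cases ht' : t ∈ E <;> simp [hs', ht', this]
          simp_rw [e]
          rw [lintegral_const_mul _ (Measurable.indicator (by fun_prop) h3),
            lintegral_indicator h3, mul_comm]
          exact mul_le_mul_left (hint δ s hδ hs E h3 h4) _
      _ = ENNReal.ofReal (ρ ^ (-(ε / 2))) * (ENNReal.ofReal (C0 * δ ^ (ε / 2)) * ν0 E) := by
          rw [lintegral_const_mul _ (measurable_one.indicator h3), lintegral_indicator_one h3]
      _ ≤ _ := by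
          refine mul_le_mul_right (mul_le_mul_right ?_ _) _
          exact (Measure.restrict_apply_le _ _).trans h4

lemma Tf_oscy (f : ℝ → ℂ) (x y : ℝ) :
    Tf f x y = oscI ν0 sin
      (fun φ => f φ * Complex.exp (Complex.I * ((x * cos φ : ℝ) : ℂ))) y := by
  unfold Tf oscI
  refine integral_congr_ae (ae_of_all _ fun p => ?_)
  simp only [mul_assoc]
  rw [← Complex.exp_add, ← mul_add, ← Complex.ofReal_add]
  rfl

lemma Tf_oscx (f : ℝ → ℂ) (x y : ℝ) :
    Tf f x y = oscI ν0 cos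
      (fun φ => f φ * Complex.exp (Complex.I * ((y * sin φ : ℝ) : ℂ))) x := by
  unfold Tf oscI
  refine integral_congr_ae (ae_of_all _ fun p => ?_)
  simp only [mul_assoc]
  rw [← Complex.exp_add, ← mul_add, ← Complex.ofReal_add, add_comm]
  rfl

lemma Nrm.expmul {f : ℝ → ℂ} {δ : ℝ} (h : Nrm f δ) (g : ℝ → ℝ) (hg : Measurable g) :
    Nrm (fun φ => f φ * Complex.exp (Complex.I * ((g φ : ℝ) : ℂ))) δ :=
  h.mul _ (by fun_prop) fun φ => (norm_expI _).le

lemma Tf_x (ε : ℝ) (hε : 0 < ε) (hε1 : ε < 1) :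
    ∃ C > 0, ∀ f δ μ, 0 < δ → 0 < μ → Nrm f δ → ∀ x : ℝ,
      volume {y : ℝ | μ < ‖Tf f x y‖} ≤
        ENNReal.ofReal (C * (μ ^ (-2 : ℝ) * (δ / μ) ^ ε)) := by
  have hp := Real.pi_pos
  obtain ⟨C, hC, h⟩ := one_gen sin Real.measurable_sin (π / 2) ⟨by linarith, by linarith⟩
    (by
      intro K _
      have := push_sin K
      simpa only [Real.sin_sub_pi_div_two, abs_neg] using this) ε hε hε1
  refine ⟨C, hC, fun f δ μ hδ hμ hf x => ?_⟩
  simp_rw [Tf_oscy]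
  exact h _ δ μ hδ hμ (hf.expmul _ (by fun_prop))

lemma Tf_y (ε : ℝ) (hε : 0 < ε) (hε1 : ε < 1) :
    ∃ C > 0, ∀ f δ μ, 0 < δ → 0 < μ → Nrm f δ → ∀ y : ℝ,
      volume {x : ℝ | μ < ‖Tf f x y‖} ≤
        ENNReal.ofReal (C * (μ ^ (-2 : ℝ) * (δ / μ) ^ ε)) := by
  have hp := Real.pi_pos
  obtain ⟨C, hC, h⟩ := one_gen cos Real.measurable_cos 0 ⟨by linarith, by linarith⟩
    (by
      intro K _
      have := push_cos K
      simpa only [sub_zero] using this) ε hε hε1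
  refine ⟨C, hC, fun f δ μ hδ hμ hf x => ?_⟩
  simp_rw [Tf_oscx]
  exact h _ δ μ hδ hμ (hf.expmul _ (by fun_prop))

lemma Tf_xb :
    ∃ C > 0, ∀ f δ μ, 0 < δ → 0 < μ → Nrm f δ → (∀ t, |cos t| < 1 / 2 → f t = 0) → ∀ x : ℝ,
      volume {y : ℝ | μ < ‖Tf f x y‖} ≤ ENNReal.ofReal (C * (μ ^ (-2 : ℝ) * δ)) := by
  obtain ⟨C, hC, h⟩ := one_bdd sin Real.measurable_sin (fun t => |cos t|) (by fun_prop)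
    (fun _ => abs_nonneg _) (fun K _ => push_sin K)
  refine ⟨C, hC, fun f δ μ hδ hμ hf hs x => ?_⟩
  simp_rw [Tf_oscy]
  exact h _ δ μ hδ hμ (hf.expmul _ (by fun_prop)) (fun t ht => by simp [hs t ht])

lemma Tf_yb :
    ∃ C > 0, ∀ f δ μ, 0 < δ → 0 < μ → Nrm f δ → (∀ t, |sin t| < 1 / 2 → f t = 0) → ∀ y : ℝ,
      volume {x : ℝ | μ < ‖Tf f x y‖} ≤ ENNReal.ofReal (C * (μ ^ (-2 : ℝ) * δ)) := by
  obtain ⟨C, hC, h⟩ := one_bdd cos Real.measurable_cos (fun t => |sin t|) (by fun_prop)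
    (fun _ => abs_nonneg _) (fun K _ => push_cos K)
  refine ⟨C, hC, fun f δ μ hδ hμ hf hs x => ?_⟩
  simp_rw [Tf_oscx]
  exact h _ δ μ hδ hμ (hf.expmul _ (by fun_prop)) (fun t ht => by simp [hs t ht])

lemma Tf_meas {f : ℝ → ℂ} (hf : Measurable f) :
    Measurable (fun p : ℝ × ℝ => Tf f p.1 p.2) := by
  unfold Tf
  have : StronglyMeasurable (Function.uncurry fun (p : ℝ × ℝ) (φ : ℝ) =>
      f φ * Complex.exp (Complex.I * ((p.1 * cos φ + p.2 * sin φ : ℝ) : ℂ))) := by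
    refine Measurable.stronglyMeasurable ?_
    simp only [Function.uncurry_def]
    fun_prop
  exact this.integral_prod_right.measurable

lemma Tf_bd {f : ℝ → ℂ} {δ : ℝ} (hδ : 0 ≤ δ) (hf : Nrm f δ) (x y : ℝ) : ‖Tf f x y‖ ≤ δ := by
  have h1 : ‖Tf f x y‖ₑ ≤ ENNReal.ofReal δ := by
    refine (enorm_integral_le_lintegral_enorm _).trans (le_trans (lintegral_mono fun φ => ?_) hf.lint)
    rw [enorm_mul, ← ofReal_norm (Complex.exp _), norm_expI]; simp
  rw [← ofReal_norm] at h1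
  exact (ENNReal.ofReal_le_ofReal_iff hδ).1 h1

lemma geo (a η : ℝ) (ha : 0 < a) (hη : 0 < η) :
    ∃ C : ℝ, 0 < C ∧ ∀ s : ℝ, ∑' n : ℤ, ENNReal.ofReal ((2:ℝ) ^ (-(η * |s + n * a|))) ≤
      ENNReal.ofReal C := by
  have hsum : Summable (fun n : ℤ => (2:ℝ) ^ (-(η * a * |(n:ℝ)|))) := by
    have hg : Summable (fun n : ℕ => (2:ℝ) ^ (-(η * a * (n:ℝ)))) := by
      have h2 : ((2:ℝ) ^ (-(η * a))) < 1 :=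
        Real.rpow_lt_one_of_one_lt_of_neg (by norm_num) (by nlinarith [mul_pos hη ha])
      have := summable_geometric_of_lt_one (by positivity) h2
      refine this.congr fun n => ?_
      rw [← Real.rpow_mul_natCast (by norm_num)]
      congr 1; ring
    refine Summable.of_nat_of_neg ?_ ?_
    · refine hg.congr fun n => ?_
      simp
    · refine hg.congr fun n => ?_
      simp
  refine ⟨2 ^ (η * a) * ∑' n : ℤ, (2:ℝ) ^ (-(η * a * |(n:ℝ)|)) + 1, ?_, ?_⟩
  · have : 0 ≤ ∑' n : ℤ, (2:ℝ) ^ (-(η * a * |(n:ℝ)|)) := tsum_nonneg fun _ => by positivity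
    positivity
  intro s
  set m := round (-s / a) with hm
  have hθ : |s + m * a| ≤ a := by
    have h1 := abs_sub_round (-s / a)
    have : s + m * a = -((-s / a - m) * a) := by field_simp; ring
    rw [this, abs_neg, abs_mul, abs_of_pos ha]
    nlinarith
  have hterm : ∀ n : ℤ, ENNReal.ofReal ((2:ℝ) ^ (-(η * |s + n * a|))) ≤
      ENNReal.ofReal (2 ^ (η * a)) * ENNReal.ofReal ((2:ℝ) ^ (-(η * a * |((n - m : ℤ):ℝ)|))) := by
    intro n
    rw [← ENNReal.ofReal_mul (by positivity), ← Real.rpow_add (by norm_num)]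
    refine ENNReal.ofReal_le_ofReal (Real.rpow_le_rpow_of_exponent_le (by norm_num) ?_)
    have h3 : a * |((n - m : ℤ):ℝ)| ≤ |s + n * a| + a := by
      have e : (((n - m : ℤ):ℝ)) * a = (s + n * a) - (s + m * a) := by push_cast; ring
      rw [mul_comm, ← abs_of_pos ha, ← abs_mul, abs_of_pos ha, e]
      exact (abs_sub _ _).trans (by linarith)
    nlinarith
  calc ∑' n : ℤ, ENNReal.ofReal ((2:ℝ) ^ (-(η * |s + n * a|)))
      ≤ ∑' n : ℤ, ENNReal.ofReal (2 ^ (η * a)) *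
        ENNReal.ofReal ((2:ℝ) ^ (-(η * a * |((n - m : ℤ):ℝ)|))) := ENNReal.tsum_le_tsum hterm
    _ = ENNReal.ofReal (2 ^ (η * a)) *
        ∑' n : ℤ, ENNReal.ofReal ((2:ℝ) ^ (-(η * a * |((n - m : ℤ):ℝ)|))) := ENNReal.tsum_mul_left
    _ = ENNReal.ofReal (2 ^ (η * a)) *
        ∑' n : ℤ, ENNReal.ofReal ((2:ℝ) ^ (-(η * a * |(n:ℝ)|))) := by
        congr 1
        exact (Equiv.subRight m).tsum_eq (fun n : ℤ =>
          ENNReal.ofReal ((2:ℝ) ^ (-(η * a * |(n:ℝ)|))))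
    _ = ENNReal.ofReal (2 ^ (η * a) * ∑' n : ℤ, (2:ℝ) ^ (-(η * a * |(n:ℝ)|))) := by
        rw [ENNReal.ofReal_mul (by positivity),
          ENNReal.ofReal_tsum_of_nonneg (fun _ => by positivity) hsum]
    _ ≤ _ := ENNReal.ofReal_le_ofReal (by linarith)

lemma partition (α q η : ℝ) (hα : 0 ≤ α) (hq : 0 < q) (hαq : α * q < 1) (hη : 0 < η) :
    ∃ C : ℝ, 0 < C ∧ ∀ τ : ℝ, 0 < τ → ∃ (D : ℕ → Set ℝ) (w a : ℕ → ℝ),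
      (∀ j, MeasurableSet (D j)) ∧ (∀ x, ∃ j, x ∈ D j) ∧ (∀ j, 0 < w j) ∧
      (∀ j x, x ∈ D j → w j ≤ (1 + |x|) ^ α) ∧
      (∀ j, 0 ≤ a j ∧ a j ≤ 1 ∧ α * q - η ≤ a j) ∧
      ∑' j, ENNReal.ofReal ((w j) ^ (-q)) * (ENNReal.ofReal τ * volume (D j)) ^ (a j) ≤
        ENNReal.ofReal (C * τ ^ (α * q)) := by
  rcases hα.eq_or_lt with h0 | h0
  · subst h0
    refine ⟨1, one_pos, fun τ hτ => ⟨fun j => if j = 0 then univ else ∅, fun _ => 1,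
      fun j => if j = 0 then 0 else 1, ?_, ?_, ?_, ?_, ?_, ?_⟩⟩
    · intro j; by_cases h : j = 0 <;> simp [h]
    · intro x; exact ⟨0, by simp⟩
    · simp
    · simp
    · intro j; by_cases h : j = 0 <;> simp [h] <;> linarith
    · rw [tsum_eq_single 0]
      · simp
      · intro j hj; simp [hj]
  set η' := min η (min (α * q) (1 - α * q)) with hη'
  have hαq0 : 0 < α * q := by positivity
  have e0 : 0 < η' := lt_min hη (lt_min hαq0 (by linarith))
  have e1 : η' ≤ η := min_le_left _ _
  have e2 : η' ≤ α * q := (min_le_right _ _).trans (min_le_left _ _)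
  have e3 : η' ≤ 1 - α * q := (min_le_right _ _).trans (min_le_right _ _)
  obtain ⟨C, hC, hgeo⟩ := geo 1 η' one_pos e0
  refine ⟨4 * C, by positivity, fun τ hτ => ?_⟩
  set t := Real.logb 2 τ with ht
  have hτt : τ = 2 ^ t := (Real.rpow_logb (by norm_num) (by norm_num) hτ).symm
  refine ⟨fun j => {x | (2:ℝ) ^ j ≤ 1 + |x| ∧ 1 + |x| < 2 ^ (j + 1)}, fun j => 2 ^ (j * α : ℝ),
    fun j => if (j:ℝ) + t ≤ 0 then α * q + η' else α * q - η', ?_, ?_, ?_, ?_, ?_, ?_⟩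
  · intro j
    have hm : Measurable (fun x : ℝ => 1 + |x|) := by fun_prop
    exact (measurableSet_le measurable_const hm).inter (measurableSet_lt hm measurable_const)
  · intro x
    obtain ⟨n, hn⟩ := exists_nat_pow_near (x := 1 + |x|) (y := 2) (by linarith [abs_nonneg x])
      (by norm_num)
    exact ⟨n, hn⟩
  · intro j; positivity
  · intro j x hx
    dsimp only
    rw [Real.rpow_mul (by norm_num), Real.rpow_natCast]
    exact Real.rpow_le_rpow (by positivity) hx.1 hα
  · intro j
    dsimp only
    split_ifs
    · exact ⟨by linarith, by linarith, by linarith⟩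
    · exact ⟨by linarith, by linarith, by linarith⟩
  · have hterm : ∀ j : ℕ, ENNReal.ofReal (((2:ℝ) ^ (j * α : ℝ)) ^ (-q)) *
        (ENNReal.ofReal τ * volume {x : ℝ | (2:ℝ) ^ j ≤ 1 + |x| ∧ 1 + |x| < 2 ^ (j + 1)}) ^
          (if (j:ℝ) + t ≤ 0 then α * q + η' else α * q - η') ≤
        ENNReal.ofReal (4 * τ ^ (α * q)) *
          ENNReal.ofReal ((2:ℝ) ^ (-(η' * |t + ((j : ℤ) : ℝ) * 1|))) := by
      intro j
      set a := (if (j:ℝ) + t ≤ 0 then α * q + η' else α * q - η') with ha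
      have ha0 : 0 ≤ a := by rw [ha]; split_ifs <;> linarith
      have ha1 : a ≤ 1 := by rw [ha]; split_ifs <;> linarith
      have hvol : volume {x : ℝ | (2:ℝ) ^ j ≤ 1 + |x| ∧ 1 + |x| < 2 ^ (j + 1)} ≤
          ENNReal.ofReal (4 * 2 ^ (j:ℝ)) := by
        calc _ ≤ volume (Icc (-(2:ℝ) ^ (j + 1)) (2 ^ (j + 1))) := by
              refine measure_mono fun x hx => ?_
              have := hx.2
              have h3 : |x| ≤ 2 ^ (j + 1) := by linarith
              exact abs_le.1 h3
          _ = _ := by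
              rw [Real.volume_Icc, Real.rpow_natCast]; congr 1; ring
      calc _ ≤ ENNReal.ofReal (((2:ℝ) ^ (j * α : ℝ)) ^ (-q)) *
            (ENNReal.ofReal τ * ENNReal.ofReal (4 * 2 ^ (j:ℝ))) ^ a := by gcongr
        _ = ENNReal.ofReal (((2:ℝ) ^ (j * α : ℝ)) ^ (-q) * (τ * (4 * 2 ^ (j:ℝ))) ^ a) := by
            rw [← ENNReal.ofReal_mul hτ.le, ENNReal.ofReal_rpow_of_nonneg (by positivity) ha0,
              ← ENNReal.ofReal_mul (by positivity)]
        _ ≤ ENNReal.ofReal (4 * τ ^ (α * q) * (2:ℝ) ^ (-(η' * |t + ((j : ℤ) : ℝ) * 1|))) := by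
            refine ENNReal.ofReal_le_ofReal ?_
            have f1 : (τ * (4 * 2 ^ (j:ℝ))) ^ a = 4 ^ a * 2 ^ (((j:ℝ) + t) * a) := by
              rw [hτt, Real.rpow_mul (by norm_num), Real.rpow_add (by norm_num),
                ← Real.mul_rpow (by norm_num) (by positivity)]
              congr 1; ring
            have f2 : (4:ℝ) ^ a ≤ 4 := by
              calc (4:ℝ) ^ a ≤ 4 ^ (1:ℝ) := Real.rpow_le_rpow_of_exponent_le (by norm_num) ha1
                _ = 4 := by simp
            have f3 : ((2:ℝ) ^ (j * α : ℝ)) ^ (-q) * 2 ^ (((j:ℝ) + t) * a) =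
                τ ^ (α * q) * (2:ℝ) ^ (-(η' * |t + ((j : ℤ) : ℝ) * 1|)) := by
              rw [hτt, ← Real.rpow_mul (by norm_num), ← Real.rpow_mul (by norm_num),
                ← Real.rpow_add (by norm_num), ← Real.rpow_add (by norm_num)]
              congr 1
              rw [ha]
              push_cast
              split_ifs with h
              · rw [abs_of_nonpos (by linarith)]; ring
              · rw [abs_of_nonneg (by linarith)]; ring
            rw [f1]
            calc _ = 4 ^ a * (((2:ℝ) ^ (j * α : ℝ)) ^ (-q) * 2 ^ (((j:ℝ) + t) * a)) := by ring
              _ ≤ 4 * (((2:ℝ) ^ (j * α : ℝ)) ^ (-q) * 2 ^ (((j:ℝ) + t) * a)) := by gcongr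
              _ = _ := by rw [f3]; ring
        _ = _ := by rw [ENNReal.ofReal_mul (by positivity)]
    refine (ENNReal.tsum_le_tsum hterm).trans ?_
    rw [ENNReal.tsum_mul_left]
    have h5 : ∑' j : ℕ, ENNReal.ofReal ((2:ℝ) ^ (-(η' * |t + ((j : ℤ) : ℝ) * 1|))) ≤
        ENNReal.ofReal C :=
      (ENNReal.tsum_comp_le_tsum_of_injective (f := fun j : ℕ => (j : ℤ)) Nat.cast_injective
        (fun n : ℤ => ENNReal.ofReal ((2:ℝ) ^ (-(η' * |t + (n:ℝ) * 1|))))).trans (hgeo t)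
    calc _ ≤ ENNReal.ofReal (4 * τ ^ (α * q)) * ENNReal.ofReal C := by gcongr
      _ = _ := by
        rw [← ENNReal.ofReal_mul (by positivity)]; congr 1; ring

lemma min_rpow (X : ℝ≥0∞) (a : ℝ) (ha : 0 ≤ a) (ha1 : a ≤ 1) : min 1 X ≤ X ^ a := by
  rcases le_total X 1 with h | h
  · refine (min_le_right _ _).trans ?_
    calc X = X ^ (1:ℝ) := by simp
      _ ≤ X ^ a := ENNReal.rpow_le_rpow_of_exponent_ge h ha1
  · exact (min_le_left _ _).trans (by simpa using ENNReal.rpow_le_rpow h ha)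

lemma four_min (N K X Y : ℝ≥0∞) (h1 : N ≤ K) (h2 : N ≤ K * X) (h3 : N ≤ K * Y)
    (h4 : N ≤ K * (X * Y)) : N ≤ K * (min 1 X * min 1 Y) := by
  rcases le_total 1 X with hX | hX <;> rcases le_total 1 Y with hY | hY <;> simp [*]

lemma RW2 (α β q : ℝ) (hα : 0 ≤ α) (hβ : 0 ≤ β) (hq : 0 < q) (hαq : α * q < 1) (hβq : β * q < 1)
    (h4 : 4 - 2 * (α + β) * q < q) :
    ∃ ε : ℝ, 0 < ε ∧ ε < 1 ∧ ∀ A : ℝ, 1 ≤ A → ∃ C : ℝ, 0 < C ∧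
      ∀ (g : ℝ → ℝ → ℝ) (δ : ℝ), 0 < δ → Measurable (fun p : ℝ × ℝ => g p.1 p.2) →
      (∀ x y, g x y ≤ δ) →
      (∀ μ, 0 < μ → μ < δ → volume {p : ℝ × ℝ | μ < g p.1 p.2} ≤
        ENNReal.ofReal (A * (μ ^ (-4 : ℝ) * δ * (δ / μ) ^ ε))) →
      (∀ μ, 0 < μ → μ < δ → ∀ x, volume {y : ℝ | μ < g x y} ≤
        ENNReal.ofReal (A * (μ ^ (-2 : ℝ) * (δ / μ) ^ ε))) →
      (∀ μ, 0 < μ → μ < δ → ∀ y, volume {x : ℝ | μ < g x y} ≤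
        ENNReal.ofReal (A * (μ ^ (-2 : ℝ) * δ))) →
      ∀ l : ℝ, 0 < l → volume {p : ℝ × ℝ | l * ((1 + |p.1|) ^ α * (1 + |p.2|) ^ β) < g p.1 p.2} ≤
        ENNReal.ofReal (C * (l ^ (-q) * δ ^ (q * (1 + α + 2 * β) - 3))) := by
  set s := q - (4 - 2 * (α + β) * q) with hs
  have hs0 : 0 < s := by linarith
  set η := s / 8 with hη
  have hη0 : 0 < η := by positivity
  set ε := min (s / 2) (1 / 2) with hε
  have hε0 : 0 < ε := lt_min (by linarith) (by norm_num)
  have hε1 : ε < 1 := (min_le_right _ _).trans_lt (by norm_num)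
  have hεs : ε ≤ s / 2 := min_le_left _ _
  obtain ⟨C1, hC1, part1⟩ := partition α q η hα hq hαq hη0
  obtain ⟨C2, hC2, part2⟩ := partition β q η hβ hq hβq hη0
  refine ⟨ε, hε0, hε1, fun A hA => ⟨A * (C1 * C2), by positivity, ?_⟩⟩
  intro g δ hδ hgm hgδ h1 hx hy l hl
  have hA0 : 0 < A := by linarith
  obtain ⟨D, w, a, Dm, Dc, w0, wle, ha, hsum⟩ := part1 δ hδ
  obtain ⟨D', w', b, Dm', Dc', w0', wle', hb, hsum'⟩ := part2 (δ ^ 2) (by positivity)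
  set S : ℕ → ℕ → Set (ℝ × ℝ) := fun j k =>
    {p | p.1 ∈ D j ∧ p.2 ∈ D' k ∧ l * (w j * w' k) < g p.1 p.2} with hS
  have hSm : ∀ μ : ℝ, MeasurableSet {p : ℝ × ℝ | μ < g p.1 p.2} := fun μ =>
    measurableSet_lt measurable_const hgm
  have hcov : {p : ℝ × ℝ | l * ((1 + |p.1|) ^ α * (1 + |p.2|) ^ β) < g p.1 p.2} ⊆
      ⋃ j, ⋃ k, S j k := by
    intro p hp
    obtain ⟨j, hj⟩ := Dc p.1
    obtain ⟨k, hk⟩ := Dc' p.2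
    refine mem_iUnion.2 ⟨j, mem_iUnion.2 ⟨k, hj, hk, lt_of_le_of_lt ?_ hp⟩⟩
    have := wle j _ hj
    have := wle' k _ hk
    have := w0 j
    have := w0' k
    gcongr
  have hbox : ∀ j k, volume (S j k) ≤ ENNReal.ofReal (A * (δ ^ (q - 3) * l ^ (-q))) *
      ((ENNReal.ofReal ((w j) ^ (-q)) * (ENNReal.ofReal δ * volume (D j)) ^ (a j)) *
      (ENNReal.ofReal ((w' k) ^ (-q)) * (ENNReal.ofReal (δ ^ 2) * volume (D' k)) ^ (b k))) := by
    intro j k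
    have hw := w0 j
    have hw' := w0' k
    set μ := l * (w j * w' k) with hμ
    have hμ0 : 0 < μ := by positivity
    rcases le_or_gt δ μ with hc | hc
    · have : S j k = ∅ := by
        ext p
        simp only [hS, mem_ofPred_eq, mem_empty_iff_false, iff_false, not_and, not_lt]
        intro _ _
        exact (hgδ _ _).trans hc
      rw [this]; simp
    set v := δ / μ with hv
    have hv1 : 1 ≤ v := by rw [hv, one_le_div hμ0]; exact hc.le
    have hv0 : 0 < v := by linarith
    have hμv : μ = δ / v := by rw [hv]; field_simp
    set K := A * (δ ^ (-3 : ℝ) * v ^ (4 + ε)) with hK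
    have hK0 : 0 < K := by positivity
    set X := ENNReal.ofReal (v ^ (-2 : ℝ)) * (ENNReal.ofReal δ * volume (D j)) with hX
    set Y := ENNReal.ofReal (v ^ (-2 : ℝ)) * (ENNReal.ofReal (δ ^ 2) * volume (D' k)) with hY
    have p4 : μ ^ (-4 : ℝ) = δ ^ (-4 : ℝ) * v ^ (4 : ℝ) := by
      rw [hμv, Real.div_rpow hδ.le hv0.le, Real.rpow_neg hv0.le, div_inv_eq_mul]
    have p2 : μ ^ (-2 : ℝ) = δ ^ (-2 : ℝ) * v ^ (2 : ℝ) := by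
      rw [hμv, Real.div_rpow hδ.le hv0.le, Real.rpow_neg hv0.le, div_inv_eq_mul]
    have d4 : δ ^ (-3 : ℝ) = δ ^ (-4 : ℝ) * δ := by
      rw [← Real.rpow_add_one hδ.ne']; norm_num
    have d3 : δ ^ (-2 : ℝ) = δ ^ (-3 : ℝ) * δ := by
      rw [← Real.rpow_add_one hδ.ne']; norm_num
    have v4 : v ^ (4 + ε) = v ^ (4:ℝ) * v ^ ε := Real.rpow_add hv0 _ _
    have v42 : v ^ (4 + ε) * v ^ (-2:ℝ) = v ^ (2:ℝ) * v ^ ε := by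
      rw [← Real.rpow_add hv0, ← Real.rpow_add hv0]; congr 1; ring
    have b1 : volume (S j k) ≤ ENNReal.ofReal K := by
      refine (measure_mono fun p hp => hp.2.2).trans ((h1 μ hμ0 hc).trans (le_of_eq ?_))
      congr 1
      rw [hK, p4, d4, v4]; ring
    have b2 : volume (S j k) ≤ ENNReal.ofReal K * X := by
      have e : ENNReal.ofReal K * X =
          ENNReal.ofReal (A * (μ ^ (-2 : ℝ) * (δ / μ) ^ ε)) * volume (D j) := by
        rw [hX, ← mul_assoc, ← mul_assoc, ← ENNReal.ofReal_mul hK0.le,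
          ← ENNReal.ofReal_mul (by positivity)]
        congr 2
        rw [p2, ← hv, d3, hK]
        linear_combination (A * δ ^ (-3 : ℝ) * δ) * v42
      rw [e]
      calc volume (S j k) ≤ volume ({p : ℝ × ℝ | p.1 ∈ D j} ∩ {p | μ < g p.1 p.2}) :=
            measure_mono fun p hp => ⟨hp.1, hp.2.2⟩
        _ = ∫⁻ x, volume (Prod.mk x ⁻¹' ({p : ℝ × ℝ | p.1 ∈ D j} ∩ {p | μ < g p.1 p.2})) :=
            Measure.prod_apply (((Dm j).preimage measurable_fst).inter (hSm μ))
        _ ≤ ∫⁻ x, (D j).indicator (fun _ =>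
              ENNReal.ofReal (A * (μ ^ (-2 : ℝ) * (δ / μ) ^ ε))) x := by
            refine lintegral_mono fun x => ?_
            by_cases hxD : x ∈ D j
            · simp only [hxD, indicator_of_mem]
              exact (measure_mono fun y hy => hy.2).trans (hx μ hμ0 hc x)
            · simp [hxD, preimage, inter_def]
        _ = _ := by rw [lintegral_indicator (Dm j)]; simp
    have b3 : volume (S j k) ≤ ENNReal.ofReal K * Y := by
      have e : ENNReal.ofReal (A * (μ ^ (-2 : ℝ) * δ)) * volume (D' k) ≤ ENNReal.ofReal K * Y := by
        rw [hY, ← mul_assoc (ENNReal.ofReal K), ← mul_assoc (ENNReal.ofReal K * _),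
          ← ENNReal.ofReal_mul hK0.le, ← ENNReal.ofReal_mul (by positivity)]
        refine mul_le_mul_left (ENNReal.ofReal_le_ofReal ?_) _
        rw [p2, d3, hK]
        have : 1 ≤ v ^ ε := Real.one_le_rpow hv1 hε0.le
        calc A * (δ ^ (-3 : ℝ) * δ * v ^ (2:ℝ) * δ) = 
              A * (δ ^ (-3 : ℝ) * δ * v ^ (2:ℝ) * δ) * 1 := by ring
          _ ≤ A * (δ ^ (-3 : ℝ) * δ * v ^ (2:ℝ) * δ) * v ^ ε := by gcongr
          _ = _ := by linear_combination (-A * δ ^ (-3 : ℝ) * δ ^ 2) * v42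
      refine le_trans ?_ e
      calc volume (S j k) ≤ volume ({p : ℝ × ℝ | p.2 ∈ D' k} ∩ {p | μ < g p.1 p.2}) :=
            measure_mono fun p hp => ⟨hp.2.1, hp.2.2⟩
        _ = ∫⁻ y, volume ((fun x => (x, y)) ⁻¹' 
              ({p : ℝ × ℝ | p.2 ∈ D' k} ∩ {p | μ < g p.1 p.2})) :=
            Measure.prod_apply_symm (((Dm' k).preimage measurable_snd).inter (hSm μ))
        _ ≤ ∫⁻ y, (D' k).indicator (fun _ =>
              ENNReal.ofReal (A * (μ ^ (-2 : ℝ) * δ))) y := by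
            refine lintegral_mono fun y => ?_
            by_cases hxD : y ∈ D' k
            · simp only [hxD, indicator_of_mem]
              exact (measure_mono fun x hx => hx.2).trans (hy μ hμ0 hc y)
            · simp [hxD, preimage, inter_def]
        _ = _ := by rw [lintegral_indicator (Dm' k)]; simp
    have b4 : volume (S j k) ≤ ENNReal.ofReal K * (X * Y) := by
      calc volume (S j k) ≤ volume (D j ×ˢ D' k) := measure_mono fun p hp => ⟨hp.1, hp.2.1⟩
        _ = ENNReal.ofReal 1 * (volume (D j) * volume (D' k)) := by
            rw [Measure.volume_eq_prod, Measure.prod_prod]; simp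
        _ ≤ ENNReal.ofReal (K * (v ^ (-2 : ℝ) * δ * (v ^ (-2:ℝ) * δ ^ 2))) *
            (volume (D j) * volume (D' k)) := by
            refine mul_le_mul_left (ENNReal.ofReal_le_ofReal ?_) _
            have h6 : 1 ≤ v ^ ε := Real.one_le_rpow hv1 hε0.le
            have h7 : δ ^ (-3:ℝ) * δ ^ 3 = 1 := by
              rw [← Real.rpow_natCast, ← Real.rpow_add hδ]; norm_num
            have h8 : v ^ (4 + ε) * v ^ (-2:ℝ) * v ^ (-2:ℝ) = v ^ ε := by
              rw [← Real.rpow_add hv0, ← Real.rpow_add hv0]; congr 1; ring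
            have : K * (v ^ (-2 : ℝ) * δ * (v ^ (-2:ℝ) * δ ^ 2)) = A * v ^ ε := by
              rw [hK]
              linear_combination (A * v ^ (4 + ε) * v ^ (-2:ℝ) * v ^ (-2:ℝ)) * h7 + A * h8
            rw [this]
            exact one_le_mul_of_one_le_of_one_le hA h6
        _ = _ := by
            rw [ENNReal.ofReal_mul hK0.le,
              ENNReal.ofReal_mul (p := v ^ (-2 : ℝ) * δ) (by positivity),
              ENNReal.ofReal_mul (p := v ^ (-2 : ℝ)) (q := δ) (by positivity),
              ENNReal.ofReal_mul (p := v ^ (-2 : ℝ)) (q := δ ^ 2) (by positivity), hX, hY]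
            ring
    have b5 := four_min _ _ _ _ b1 b2 b3 b4
    obtain ⟨ha0, ha1, ha2⟩ := ha j
    obtain ⟨hb0, hb1, hb2⟩ := hb k
    calc volume (S j k) ≤ ENNReal.ofReal K * (X ^ a j * Y ^ b k) :=
          b5.trans (mul_le_mul_right (mul_le_mul' (min_rpow _ _ ha0 ha1) (min_rpow _ _ hb0 hb1)) _)
      _ = ENNReal.ofReal (K * ((v ^ (-2:ℝ)) ^ a j * (v ^ (-2:ℝ)) ^ b k)) *
            ((ENNReal.ofReal δ * volume (D j)) ^ (a j) *
              (ENNReal.ofReal (δ ^ 2) * volume (D' k)) ^ (b k)) := by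
          rw [hX, hY, ENNReal.mul_rpow_of_nonneg _ _ ha0, ENNReal.mul_rpow_of_nonneg _ _ hb0,
            ENNReal.ofReal_mul hK0.le,
            ENNReal.ofReal_mul (p := (v ^ (-2:ℝ)) ^ a j) (by positivity),
            ENNReal.ofReal_rpow_of_nonneg (by positivity) ha0,
            ENNReal.ofReal_rpow_of_nonneg (by positivity) hb0]
          ring
      _ ≤ ENNReal.ofReal (A * (δ ^ (q - 3) * l ^ (-q)) * ((w j) ^ (-q) * (w' k) ^ (-q))) *
            ((ENNReal.ofReal δ * volume (D j)) ^ (a j) *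
              (ENNReal.ofReal (δ ^ 2) * volume (D' k)) ^ (b k)) := by
          refine mul_le_mul_left (ENNReal.ofReal_le_ofReal ?_) _
          have h9 : v ^ (4 + ε) * ((v ^ (-2:ℝ)) ^ a j * (v ^ (-2:ℝ)) ^ b k) ≤ v ^ q := by
            rw [← Real.rpow_mul hv0.le, ← Real.rpow_mul hv0.le, ← Real.rpow_add hv0,
              ← Real.rpow_add hv0]
            refine Real.rpow_le_rpow_of_exponent_le hv1 ?_
            rw [hη] at ha2 hb2
            nlinarith
          have h10 : v ^ q = δ ^ q * (l ^ (-q) * ((w j) ^ (-q) * (w' k) ^ (-q))) := by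
            rw [hv, Real.div_rpow hδ.le hμ0.le, hμ, Real.mul_rpow hl.le (by positivity),
              Real.mul_rpow hw.le hw'.le, Real.rpow_neg hl.le, Real.rpow_neg hw.le,
              Real.rpow_neg hw'.le, div_eq_mul_inv, mul_inv, mul_inv]
          have h11 : δ ^ (q - 3) = δ ^ (-3:ℝ) * δ ^ q := by
            rw [← Real.rpow_add hδ]; congr 1; ring
          calc K * ((v ^ (-2:ℝ)) ^ a j * (v ^ (-2:ℝ)) ^ b k)
              = A * δ ^ (-3:ℝ) * (v ^ (4 + ε) * ((v ^ (-2:ℝ)) ^ a j * (v ^ (-2:ℝ)) ^ b k)) := by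
                rw [hK]; ring
            _ ≤ A * δ ^ (-3:ℝ) * v ^ q := by gcongr
            _ = _ := by rw [h10, h11]; ring
      _ = _ := by
          rw [ENNReal.ofReal_mul (by positivity), ENNReal.ofReal_mul (p := w j ^ (-q)) (by positivity)]
          ring
  calc volume {p : ℝ × ℝ | l * ((1 + |p.1|) ^ α * (1 + |p.2|) ^ β) < g p.1 p.2}
      ≤ volume (⋃ j, ⋃ k, S j k) := measure_mono hcov
    _ ≤ ∑' j, ∑' k, volume (S j k) :=
        (measure_iUnion_le _).trans (ENNReal.tsum_le_tsum fun j => measure_iUnion_le _)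
    _ ≤ _ := ENNReal.tsum_le_tsum fun j => ENNReal.tsum_le_tsum fun k => hbox j k
    _ = ENNReal.ofReal (A * (δ ^ (q - 3) * l ^ (-q))) *
        ((∑' j, ENNReal.ofReal ((w j) ^ (-q)) * (ENNReal.ofReal δ * volume (D j)) ^ (a j)) *
        ∑' k, ENNReal.ofReal ((w' k) ^ (-q)) *
          (ENNReal.ofReal (δ ^ 2) * volume (D' k)) ^ (b k)) := by
        simp_rw [ENNReal.tsum_mul_left, ENNReal.tsum_mul_right]
    _ ≤ ENNReal.ofReal (A * (δ ^ (q - 3) * l ^ (-q))) * (ENNReal.ofReal (C1 * δ ^ (α * q)) *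
          ENNReal.ofReal (C2 * (δ ^ 2) ^ (β * q))) := by gcongr
    _ = _ := by
        rw [← ENNReal.ofReal_mul (by positivity), ← ENNReal.ofReal_mul (by positivity)]
        congr 1
        have : δ ^ (q * (1 + α + 2 * β) - 3) = δ ^ (q - 3) * δ ^ (α * q) * (δ ^ 2) ^ (β * q) := by
          rw [← Real.rpow_natCast_mul hδ.le, ← Real.rpow_add hδ, ← Real.rpow_add hδ]
          congr 1; push_cast; ring
        rw [this]; ring

lemma RW1 (β q : ℝ) (hβ : 0 ≤ β) (hq : 0 < q) (hβq : β * q < 1)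
    (h4 : 2 - 2 * β * q < q) :
    ∃ ε : ℝ, 0 < ε ∧ ε < 1 ∧ ∀ A : ℝ, 1 ≤ A → ∃ C : ℝ, 0 < C ∧
      ∀ (g : ℝ → ℝ) (δ : ℝ), 0 < δ →
      (∀ y, g y ≤ δ) →
      (∀ μ, 0 < μ → μ < δ → volume {y : ℝ | μ < g y} ≤
        ENNReal.ofReal (A * (μ ^ (-2 : ℝ) * (δ / μ) ^ ε))) →
      ∀ l : ℝ, 0 < l → volume {y : ℝ | l * (1 + |y|) ^ β < g y} ≤
        ENNReal.ofReal (C * (l ^ (-q) * δ ^ (q * (1 + 2 * β) - 2))) := by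
  set s := q - (2 - 2 * β * q) with hs
  have hs0 : 0 < s := by linarith
  set η := s / 8 with hη
  have hη0 : 0 < η := by positivity
  set ε := min (s / 2) (1 / 2) with hε
  have hε0 : 0 < ε := lt_min (by linarith) (by norm_num)
  have hε1 : ε < 1 := (min_le_right _ _).trans_lt (by norm_num)
  have hεs : ε ≤ s / 2 := min_le_left _ _
  obtain ⟨C2, hC2, part2⟩ := partition β q η hβ hq hβq hη0
  refine ⟨ε, hε0, hε1, fun A hA => ⟨A * C2, by positivity, ?_⟩⟩
  intro g δ hδ hgδ hx l hl
  have hA0 : 0 < A := by linarith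
  obtain ⟨D', w', b, Dm', Dc', w0', wle', hb, hsum'⟩ := part2 (δ ^ 2) (by positivity)
  set S : ℕ → Set ℝ := fun k => {y | y ∈ D' k ∧ l * w' k < g y} with hS
  have hcov : {y : ℝ | l * (1 + |y|) ^ β < g y} ⊆ ⋃ k, S k := by
    intro p hp
    obtain ⟨k, hk⟩ := Dc' p
    refine mem_iUnion.2 ⟨k, hk, lt_of_le_of_lt ?_ hp⟩
    have := wle' k _ hk
    gcongr
  have hbox : ∀ k, volume (S k) ≤ ENNReal.ofReal (A * (δ ^ (q - 2) * l ^ (-q))) *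
      (ENNReal.ofReal ((w' k) ^ (-q)) * (ENNReal.ofReal (δ ^ 2) * volume (D' k)) ^ (b k)) := by
    intro k
    have hw' := w0' k
    set μ := l * w' k with hμ
    have hμ0 : 0 < μ := by positivity
    rcases le_or_gt δ μ with hc | hc
    · have : S k = ∅ := by
        ext p
        simp only [hS, mem_ofPred_eq, mem_empty_iff_false, iff_false, not_and, not_lt]
        intro _
        exact (hgδ _).trans hc
      rw [this]; simp
    set v := δ / μ with hv
    have hv1 : 1 ≤ v := by rw [hv, one_le_div hμ0]; exact hc.le
    have hv0 : 0 < v := by linarith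
    have hμv : μ = δ / v := by rw [hv]; field_simp
    set K := A * (δ ^ (-2 : ℝ) * v ^ (2 + ε)) with hK
    have hK0 : 0 < K := by positivity
    set Y := ENNReal.ofReal (v ^ (-2 : ℝ)) * (ENNReal.ofReal (δ ^ 2) * volume (D' k)) with hY
    have p2 : μ ^ (-2 : ℝ) = δ ^ (-2 : ℝ) * v ^ (2 : ℝ) := by
      rw [hμv, Real.div_rpow hδ.le hv0.le, Real.rpow_neg hv0.le, div_inv_eq_mul]
    have v2 : v ^ (2 + ε) = v ^ (2:ℝ) * v ^ ε := Real.rpow_add hv0 _ _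
    have b1 : volume (S k) ≤ ENNReal.ofReal K := by
      refine (measure_mono fun p hp => hp.2).trans ((hx μ hμ0 hc).trans (le_of_eq ?_))
      congr 1
      rw [hK, p2, v2]; ring
    have b2 : volume (S k) ≤ ENNReal.ofReal K * Y := by
      calc volume (S k) ≤ volume (D' k) := measure_mono fun p hp => hp.1
        _ = ENNReal.ofReal 1 * volume (D' k) := by simp
        _ ≤ ENNReal.ofReal (K * (v ^ (-2:ℝ) * δ ^ 2)) * volume (D' k) := by
            refine mul_le_mul_left (ENNReal.ofReal_le_ofReal ?_) _
            have h6 : 1 ≤ v ^ ε := Real.one_le_rpow hv1 hε0.le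
            have h7 : δ ^ (-2:ℝ) * δ ^ 2 = 1 := by
              rw [← Real.rpow_natCast, ← Real.rpow_add hδ]; norm_num
            have h8 : v ^ (2 + ε) * v ^ (-2:ℝ) = v ^ ε := by
              rw [← Real.rpow_add hv0]; congr 1; ring
            have : K * (v ^ (-2:ℝ) * δ ^ 2) = A * v ^ ε := by
              rw [hK]
              linear_combination (A * v ^ (2 + ε) * v ^ (-2:ℝ)) * h7 + A * h8
            rw [this]
            exact one_le_mul_of_one_le_of_one_le hA h6
        _ = _ := by
            rw [ENNReal.ofReal_mul hK0.le,
              ENNReal.ofReal_mul (p := v ^ (-2 : ℝ)) (q := δ ^ 2) (by positivity), hY]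
            ring
    obtain ⟨hb0, hb1, hb2⟩ := hb k
    have b5 : volume (S k) ≤ ENNReal.ofReal K * min 1 Y := by
      rcases le_total 1 Y with h | h <;> simp [h, b1, b2]
    calc volume (S k) ≤ ENNReal.ofReal K * Y ^ b k :=
          b5.trans (mul_le_mul_right (min_rpow _ _ hb0 hb1) _)
      _ = ENNReal.ofReal (K * (v ^ (-2:ℝ)) ^ b k) *
              (ENNReal.ofReal (δ ^ 2) * volume (D' k)) ^ (b k) := by
          rw [hY, ENNReal.mul_rpow_of_nonneg _ _ hb0,
            ENNReal.ofReal_mul hK0.le,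
            ENNReal.ofReal_rpow_of_nonneg (by positivity) hb0]
          ring
      _ ≤ ENNReal.ofReal (A * (δ ^ (q - 2) * l ^ (-q)) * (w' k) ^ (-q)) *
              (ENNReal.ofReal (δ ^ 2) * volume (D' k)) ^ (b k) := by
          refine mul_le_mul_left (ENNReal.ofReal_le_ofReal ?_) _
          have h9 : v ^ (2 + ε) * (v ^ (-2:ℝ)) ^ b k ≤ v ^ q := by
            rw [← Real.rpow_mul hv0.le, ← Real.rpow_add hv0]
            refine Real.rpow_le_rpow_of_exponent_le hv1 ?_
            rw [hη] at hb2
            nlinarith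
          have h10 : v ^ q = δ ^ q * (l ^ (-q) * (w' k) ^ (-q)) := by
            rw [hv, Real.div_rpow hδ.le hμ0.le, hμ, Real.mul_rpow hl.le hw'.le,
              Real.rpow_neg hl.le, Real.rpow_neg hw'.le, div_eq_mul_inv, mul_inv]
          have h11 : δ ^ (q - 2) = δ ^ (-2:ℝ) * δ ^ q := by
            rw [← Real.rpow_add hδ]; congr 1; ring
          calc K * (v ^ (-2:ℝ)) ^ b k
              = A * δ ^ (-2:ℝ) * (v ^ (2 + ε) * (v ^ (-2:ℝ)) ^ b k) := by
                rw [hK]; ring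
            _ ≤ A * δ ^ (-2:ℝ) * v ^ q := by gcongr
            _ = _ := by rw [h10, h11]; ring
      _ = _ := by
          rw [ENNReal.ofReal_mul (by positivity)]
          ring
  calc volume {y : ℝ | l * (1 + |y|) ^ β < g y}
      ≤ volume (⋃ k, S k) := measure_mono hcov
    _ ≤ ∑' k, volume (S k) := measure_iUnion_le _
    _ ≤ _ := ENNReal.tsum_le_tsum fun k => hbox k
    _ = ENNReal.ofReal (A * (δ ^ (q - 2) * l ^ (-q))) *
        ∑' k, ENNReal.ofReal ((w' k) ^ (-q)) *
          (ENNReal.ofReal (δ ^ 2) * volume (D' k)) ^ (b k) := ENNReal.tsum_mul_left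
    _ ≤ ENNReal.ofReal (A * (δ ^ (q - 2) * l ^ (-q))) *
          ENNReal.ofReal (C2 * (δ ^ 2) ^ (β * q)) := by gcongr
    _ = _ := by
        rw [← ENNReal.ofReal_mul (by positivity)]
        congr 1
        have : δ ^ (q * (1 + 2 * β) - 2) = δ ^ (q - 2) * (δ ^ 2) ^ (β * q) := by
          rw [← Real.rpow_natCast_mul hδ.le, ← Real.rpow_add hδ]
          congr 1; push_cast; ring
        rw [this]; ring

lemma wcircle_vol (r : ℝ) (hr : 0 < r) (F : ℝ → ℂ) (W : ℝ) (hW : 0 < W)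
    (h : wcircle r F ≤ ENNReal.ofReal W) (t : ℝ) (ht : 0 < t) :
    volume {φ ∈ Icc (0:ℝ) (2 * π) | t < ‖F φ‖} ≤ ENNReal.ofReal ((W / t) ^ r) := by
  have h1 : ENNReal.ofReal t * (volume {φ ∈ Icc (0:ℝ) (2 * π) | t < ‖F φ‖}) ^ (1 / r) ≤
      ENNReal.ofReal W :=
    le_trans (le_iSup₂ (f := fun (t : ℝ) (_ : 0 < t) => ENNReal.ofReal t *
      (volume {φ ∈ Icc (0:ℝ) (2 * π) | t < ‖F φ‖}) ^ (1 / r)) t ht) h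
  have h2 : (volume {φ ∈ Icc (0:ℝ) (2 * π) | t < ‖F φ‖}) ^ (1 / r) ≤ ENNReal.ofReal (W / t) := by
    rw [ENNReal.ofReal_div_of_pos ht, ENNReal.le_div_iff_mul_le
      (Or.inl (by simpa using ht)) (Or.inl ENNReal.ofReal_ne_top), mul_comm]
    exact h1
  have h3 := ENNReal.rpow_le_rpow h2 hr.le
  rwa [← ENNReal.rpow_mul, one_div_mul_cancel hr.ne', ENNReal.rpow_one,
    ENNReal.ofReal_rpow_of_nonneg (by positivity) hr.le] at h3

lemma interp (q0 q q1 c d r C0 : ℝ) (hq0 : 0 < q0) (h01 : q0 < q) (h12 : q < q1) (hd : 0 < d)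
    (hr : 0 < r) (hrc : 1 / r = c - d / q) (hC0 : 0 < C0) :
    ∃ C : ℝ, 0 < C ∧ ∀ (Z : Type) [MeasurableSpace Z] (ζ : Measure Z) (k : Z → ℝ → ℂ),
      (∀ z, Measurable (k z)) → (∀ z φ, ‖k z φ‖ ≤ 1) →
      (∀ f δ l, 0 < δ → 0 < l → Nrm f δ →
        ζ {z | l < ‖∫ φ, f φ * k z φ ∂ν0‖} ≤ ENNReal.ofReal (C0 * (l ^ (-q0) * δ ^ (q0 * c - d))) ∧
        ζ {z | l < ‖∫ φ, f φ * k z φ ∂ν0‖} ≤ ENNReal.ofReal (C0 * (l ^ (-q1) * δ ^ (q1 * c - d)))) →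
      ∀ F : ℝ → ℂ, Measurable F → ∀ W : ℝ, 0 < W → wcircle r F ≤ ENNReal.ofReal W →
      ∀ l : ℝ, 0 < l → ζ {z | l < ‖∫ φ, F φ * k z φ ∂ν0‖} ≤ ENNReal.ofReal (C * (W / l) ^ q) := by
  have hq : 0 < q := hq0.trans h01
  have hq1 : 0 < q1 := hq.trans h12
  set a := r * d / q with ha
  have ha0 : 0 < a := by positivity
  have hrca : r * c = 1 + a := by
    have : c = 1 / r + d / q := by linarith
    rw [this, ha]; field_simp
  have hrda : r * d = a * q := by rw [ha]; field_simp
  set γ := min (q1 - q) (q - q0) with hγ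
  have hγ0 : 0 < γ := lt_min (by linarith) (by linarith)
  have hγ1 : γ ≤ q1 - q := min_le_left _ _
  have hγ2 : γ ≤ q - q0 := min_le_right _ _
  set ε := γ / (2 * q1) with hε
  have hε0 : 0 < ε := by positivity
  have hεq : ε * q1 = γ / 2 := by rw [hε]; field_simp
  obtain ⟨G1, hG1, geo1⟩ := geo a ε ha0 hε0
  obtain ⟨G2, hG2, geo2⟩ := geo a (γ / 2) ha0 (by positivity)
  set κ := G1 + 1 with hκ
  have hκ1 : 1 ≤ κ := by linarith
  refine ⟨C0 * (2 * κ) ^ q1 * G2, by positivity, ?_⟩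
  intro Z _ ζ k hkm hk1 hyp F hF W hW hWF l hl
  set ω := Real.logb 2 W with hω
  have hWω : W = 2 ^ ω := (Real.rpow_logb (by norm_num) (by norm_num) hW).symm
  set lm := Real.logb 2 l with hlm
  have hll : l = 2 ^ lm := (Real.rpow_logb (by norm_num) (by norm_num) hl).symm
  set s := lm - ω * (1 + a) with hs
  set y : ℤ → ℝ := fun n => s + n * a with hy
  set A : ℤ → Set ℝ := fun n =>
    {φ | φ ∈ Icc (0:ℝ) (2 * π) ∧ (2:ℝ) ^ (n:ℝ) < ‖F φ‖ ∧ ‖F φ‖ ≤ 2 ^ ((n:ℝ) + 1)} with hA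
  have hAm : ∀ n, MeasurableSet (A n) := by
    intro n
    exact measurableSet_Icc.inter ((measurableSet_lt measurable_const hF.norm).inter
      (measurableSet_le hF.norm measurable_const))
  have hAd : Pairwise (Function.onFun Disjoint A) := by
    have key : ∀ n m : ℤ, n < m → Disjoint (A n) (A m) := by
      intro n m hnm
      rw [Set.disjoint_left]
      intro φ h1 h2
      have h3 : ((n:ℝ) + 1) ≤ m := by exact_mod_cast hnm
      have h4 : (2:ℝ) ^ ((n:ℝ) + 1) ≤ 2 ^ (m:ℝ) :=
        Real.rpow_le_rpow_of_exponent_le (by norm_num) h3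
      linarith [h1.2.2, h2.2.1]
    intro n m hnm
    rcases lt_or_gt_of_ne hnm with h | h
    · exact key n m h
    · exact (key m n h).symm
  set f : ℤ → ℝ → ℂ := fun n => (A n).indicator
    (fun φ => (((2:ℝ) ^ (-((n:ℝ) + 1)) : ℝ) : ℂ) * F φ) with hf
  have hδ : ∀ n : ℤ, (0:ℝ) < 2 ^ (r * (ω - n)) := fun n => by positivity
  have hN : ∀ n, Nrm (f n) (2 ^ (r * (ω - n))) := by
    intro n
    refine ⟨(measurable_const.mul hF).indicator (hAm n), ?_, A n, hAm n, ?_, ?_⟩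
    · intro φ
      by_cases hφ : φ ∈ A n
      · simp only [hf, hφ, indicator_of_mem, norm_mul, Complex.norm_real]
        rw [Real.norm_of_nonneg (by positivity), Real.rpow_neg (by norm_num), ← div_eq_inv_mul,
          div_le_one (by positivity)]
        exact hφ.2.2
      · simp [hf, hφ]
    · calc volume (A n) ≤ volume {φ ∈ Icc (0:ℝ) (2 * π) | (2:ℝ) ^ (n:ℝ) < ‖F φ‖} :=
            measure_mono fun φ hφ => ⟨hφ.1, hφ.2.1⟩
        _ ≤ _ := wcircle_vol r hr F W hW hWF _ (by positivity)
        _ = _ := by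
            congr 1
            rw [hWω, ← Real.rpow_sub (by norm_num), ← Real.rpow_mul (by norm_num), mul_comm]
    · intro φ hφ; simp [hf, hφ]
  have hint : ∀ n z, ∫ φ in A n, F φ * k z φ ∂ν0 =
      (((2:ℝ) ^ ((n:ℝ) + 1) : ℝ) : ℂ) * ∫ φ, f n φ * k z φ ∂ν0 := by
    intro n z
    rw [← integral_const_mul, ← integral_indicator (hAm n)]
    refine integral_congr_ae (ae_of_all _ fun φ => ?_)
    by_cases hφ : φ ∈ A n
    · simp only [hf, hφ, indicator_of_mem]
      rw [← mul_assoc, ← mul_assoc, ← Complex.ofReal_mul, ← Real.rpow_add (by norm_num)]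
      simp
    · simp [hf, hφ]
  have hsum : ∀ z, ‖∫ φ, F φ * k z φ ∂ν0‖ₑ ≤ ∑' n : ℤ, ‖∫ φ in A n, F φ * k z φ ∂ν0‖ₑ := by
    intro z
    by_cases hi : Integrable (fun φ => F φ * k z φ) ν0
    · have h1 := integral_iUnion (μ := ν0) hAm hAd hi.integrableOn
      have h2 : ∫ φ in ⋃ n, A n, F φ * k z φ ∂ν0 = ∫ φ, F φ * k z φ ∂ν0 := by
        refine setIntegral_eq_integral_of_ae_compl_eq_zero ?_
        filter_upwards [ae_ν0] with φ hφ hnot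
        by_contra hne
        have hF0 : F φ ≠ 0 := fun h => hne (by simp [h])
        obtain ⟨n, hn⟩ := exists_mem_Ioc_zpow (x := ‖F φ‖) (y := 2) (norm_pos_iff.2 hF0)
          (by norm_num)
        refine hnot (mem_iUnion.2 ⟨n, hφ, ?_, ?_⟩)
        · rw [Real.rpow_intCast]; exact hn.1
        · have := hn.2
          rw [← Real.rpow_intCast] at this
          push_cast at this
          exact this
      rw [← h2, h1]
      exact enorm_tsum_le_tsum_enorm
    · rw [integral_undef hi]; simp
  set lev : ℤ → ℝ := fun n => 2 ^ (-(ε * |y n|)) * (l / κ) with hlev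
  have hlev0 : ∀ n, 0 < lev n := fun n => by simp only [hlev]; positivity
  have hcov : {z | l < ‖∫ φ, F φ * k z φ ∂ν0‖} ⊆
      ⋃ n : ℤ, {z | 2 ^ (-((n:ℝ) + 1)) * lev n < ‖∫ φ, f n φ * k z φ ∂ν0‖} := by
    intro z hz
    by_contra hnot
    simp only [mem_iUnion, mem_ofPred_eq, not_exists, not_lt] at hnot
    have h1 : ‖∫ φ, F φ * k z φ ∂ν0‖ₑ ≤ ENNReal.ofReal l := by
      calc _ ≤ _ := hsum z
        _ ≤ ∑' n : ℤ, ENNReal.ofReal (2 ^ (-(ε * |y n|))) * ENNReal.ofReal (l / κ) := by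
            refine ENNReal.tsum_le_tsum fun n => ?_
            rw [← ENNReal.ofReal_mul (by positivity), hint, ← ofReal_norm, norm_mul,
              Complex.norm_real, Real.norm_of_nonneg (by positivity)]
            refine ENNReal.ofReal_le_ofReal ?_
            calc _ ≤ (2:ℝ) ^ ((n:ℝ) + 1) * (2 ^ (-((n:ℝ) + 1)) * lev n) := by
                  gcongr; exact hnot n
              _ = lev n := by
                  rw [← mul_assoc, ← Real.rpow_add (by norm_num)]; simp
        _ = (∑' n : ℤ, ENNReal.ofReal (2 ^ (-(ε * |y n|)))) * ENNReal.ofReal (l / κ) :=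
            ENNReal.tsum_mul_right
        _ ≤ ENNReal.ofReal G1 * ENNReal.ofReal (l / κ) := mul_le_mul_left (geo1 s) _
        _ = ENNReal.ofReal (G1 * (l / κ)) := by rw [ENNReal.ofReal_mul hG1.le]
        _ ≤ _ := by
            refine ENNReal.ofReal_le_ofReal ?_
            rw [← mul_div_assoc, div_le_iff₀ (by linarith)]
            nlinarith
    rw [← ofReal_norm, ENNReal.ofReal_le_ofReal_iff hl.le] at h1
    exact absurd hz (not_lt.2 h1)
  have hexp : ∀ (n : ℤ) (p : ℝ), 0 < p → p ≤ q1 → ε * p * |y n| + (q - p) * y n ≤ -(γ / 2 * |y n|) →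
      C0 * ((2 ^ (-((n:ℝ) + 1)) * lev n) ^ (-p) * (2 ^ (r * (ω - n))) ^ (p * c - d)) ≤
      C0 * (2 * κ) ^ q1 * (W / l) ^ q * 2 ^ (-(γ / 2 * |y n|)) := by
    intro n p hp0 hp1 hle
    have e1 : (2 ^ (-((n:ℝ) + 1)) * lev n) ^ (-p) * ((2:ℝ) ^ (r * (ω - n))) ^ (p * c - d) =
        (2 * κ) ^ p * ((W / l) ^ q * 2 ^ (ε * p * |y n| + (q - p) * y n)) := by
      have e2 : (2:ℝ) ^ (-((n:ℝ) + 1)) * lev n = (2 * κ)⁻¹ * 2 ^ (-n - ε * |y n| + lm) := by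
        simp only [hlev]
        rw [hll, Real.rpow_add (by norm_num), Real.rpow_sub (by norm_num), neg_add,
          Real.rpow_add (by norm_num), Real.rpow_neg_one, Real.rpow_neg (x := 2) (y := ε * |y n|)
            (by norm_num)]
        field_simp
      rw [e2, Real.mul_rpow (by positivity) (by positivity), Real.inv_rpow (by positivity),
        Real.rpow_neg (by positivity), inv_inv, mul_assoc]
      congr 1
      rw [hWω, hll, ← Real.rpow_sub (by norm_num), ← Real.rpow_mul (by norm_num),
        ← Real.rpow_mul (by norm_num), ← Real.rpow_mul (by norm_num), ← Real.rpow_add (by norm_num),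
        ← Real.rpow_add (by norm_num)]
      congr 1
      simp only [hy, hs]
      linear_combination ((ω - n) * p) * hrca - (ω - n) * hrda
    rw [e1]
    calc C0 * ((2 * κ) ^ p * ((W / l) ^ q * 2 ^ (ε * p * |y n| + (q - p) * y n)))
        ≤ C0 * ((2 * κ) ^ q1 * ((W / l) ^ q * 2 ^ (-(γ / 2 * |y n|)))) := by
          gcongr
          · linarith
          · norm_num
      _ = _ := by ring
  have hterm : ∀ n : ℤ, ζ {z | 2 ^ (-((n:ℝ) + 1)) * lev n < ‖∫ φ, f n φ * k z φ ∂ν0‖} ≤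
      ENNReal.ofReal (C0 * (2 * κ) ^ q1 * (W / l) ^ q) *
        ENNReal.ofReal (2 ^ (-(γ / 2 * |y n|))) := by
    intro n
    have hl0 := hlev0 n
    obtain ⟨g0, g1⟩ := hyp (f n) (2 ^ (r * (ω - n))) (2 ^ (-((n:ℝ) + 1)) * lev n) (hδ n)
      (by positivity) (hN n)
    rw [← ENNReal.ofReal_mul (by positivity)]
    rcases le_total 0 (y n) with hyn | hyn
    · refine g1.trans (ENNReal.ofReal_le_ofReal (hexp n q1 hq1 le_rfl ?_))
      rw [abs_of_nonneg hyn, hεq]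
      nlinarith
    · refine g0.trans (ENNReal.ofReal_le_ofReal (hexp n q0 hq0 (by linarith) ?_))
      rw [abs_of_nonpos hyn]
      have : ε * q0 ≤ γ / 2 := by rw [← hεq]; gcongr; linarith
      nlinarith
  calc ζ {z | l < ‖∫ φ, F φ * k z φ ∂ν0‖}
      ≤ ∑' n : ℤ, ζ {z | 2 ^ (-((n:ℝ) + 1)) * lev n < ‖∫ φ, f n φ * k z φ ∂ν0‖} :=
        (measure_mono hcov).trans (measure_iUnion_le _)
    _ ≤ _ := ENNReal.tsum_le_tsum hterm
    _ = ENNReal.ofReal (C0 * (2 * κ) ^ q1 * (W / l) ^ q) *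
          ∑' n : ℤ, ENNReal.ofReal (2 ^ (-(γ / 2 * |y n|))) := ENNReal.tsum_mul_left
    _ ≤ ENNReal.ofReal (C0 * (2 * κ) ^ q1 * (W / l) ^ q) * ENNReal.ofReal G2 :=
        mul_le_mul_right (geo2 s) _
    _ = _ := by
        rw [← ENNReal.ofReal_mul (by positivity)]; congr 1; ring

lemma ker_eq (f ind : ℝ → ℂ) (w x y : ℝ) :
    ∫ φ, f φ * (((w⁻¹ : ℝ) : ℂ) * ind φ * Complex.exp (Complex.I * ((x * cos φ + y * sin φ : ℝ) : ℂ))) ∂ν0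
      = ((w⁻¹ : ℝ) : ℂ) * Tf (fun φ => f φ * ind φ) x y := by
  rw [Tf, ← integral_const_mul]
  congr 1
  funext φ
  ring

lemma ker_lt (f ind : ℝ → ℂ) (w x y l : ℝ) (hw : 0 < w) :
    l < ‖∫ φ, f φ * (((w⁻¹ : ℝ) : ℂ) * ind φ *
      Complex.exp (Complex.I * ((x * cos φ + y * sin φ : ℝ) : ℂ))) ∂ν0‖ ↔
    l * w < ‖Tf (fun φ => f φ * ind φ) x y‖ := by
  rw [ker_eq, norm_mul, Complex.norm_real, Real.norm_of_nonneg (by positivity), inv_mul_eq_div,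
    lt_div_iff₀ hw]

lemma interpT (q0 q q1 c d r C0 : ℝ) (hq0 : 0 < q0) (h01 : q0 < q) (h12 : q < q1) (hd : 0 < d)
    (hr : 0 < r) (hrc : 1 / r = c - d / q) (hC0 : 0 < C0) :
    ∃ C : ℝ, 0 < C ∧ ∀ (Z : Type) [MeasurableSpace Z] (ζ : Measure Z) (w X Y : Z → ℝ) (ind : ℝ → ℂ),
      (∀ z, 1 ≤ w z) → Measurable ind → (∀ φ, ‖ind φ‖ ≤ 1) →
      (∀ f δ l, 0 < δ → 0 < l → Nrm f δ → (∀ φ, ind φ = 0 → f φ = 0) →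
        ζ {z | l * w z < ‖Tf f (X z) (Y z)‖} ≤ ENNReal.ofReal (C0 * (l ^ (-q0) * δ ^ (q0 * c - d))) ∧
        ζ {z | l * w z < ‖Tf f (X z) (Y z)‖} ≤ ENNReal.ofReal (C0 * (l ^ (-q1) * δ ^ (q1 * c - d)))) →
      ∀ F : ℝ → ℂ, Measurable F → ∀ W : ℝ, 0 < W → wcircle r F ≤ ENNReal.ofReal W →
      ∀ l : ℝ, 0 < l → ζ {z | l * w z < ‖Tf (fun φ => F φ * ind φ) (X z) (Y z)‖} ≤
        ENNReal.ofReal (C * (W / l) ^ q) := by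
  obtain ⟨C, hC, h⟩ := interp q0 q q1 c d r C0 hq0 h01 h12 hd hr hrc hC0
  refine ⟨C, hC, fun Z _ ζ w X Y ind hw hind hind1 hyp F hF W hW hWF l hl => ?_⟩
  have hk := h Z ζ (fun z φ => (((w z)⁻¹ : ℝ) : ℂ) * ind φ *
      Complex.exp (Complex.I * ((X z * cos φ + Y z * sin φ : ℝ) : ℂ))) ?_ ?_ ?_ F hF W hW hWF l hl
  · have he : {z | l * w z < ‖Tf (fun φ => F φ * ind φ) (X z) (Y z)‖} = _ :=
      Set.ext fun z => (ker_lt F ind (w z) (X z) (Y z) l (by linarith [hw z])).symm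
    rw [he]; exact hk
  · intro z
    fun_prop
  · intro z φ
    rw [norm_mul, norm_mul, norm_expI, Complex.norm_real, mul_one]
    have h1 : ‖(w z)⁻¹‖ ≤ 1 := by
      rw [Real.norm_of_nonneg (inv_nonneg.2 (by linarith [hw z]))]
      exact inv_le_one_of_one_le₀ (hw z)
    calc _ ≤ (1:ℝ) * 1 := by gcongr; exact hind1 φ
      _ = 1 := by ring
  · intro f δ l hδ hl hf
    have he : {z | l * w z < ‖Tf (fun φ => f φ * ind φ) (X z) (Y z)‖} = _ :=
      Set.ext fun z => (ker_lt f ind (w z) (X z) (Y z) l (by linarith [hw z])).symm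
    have := hyp (fun φ => f φ * ind φ) δ l hδ hl (hf.mul ind hind hind1) (fun φ hφ => by simp [hφ])
    rw [he] at this
    exact this

lemma wt_one (x a : ℝ) (ha : 0 ≤ a) : 1 ≤ (1 + |x|) ^ a :=
  Real.one_le_rpow (by linarith [abs_nonneg x]) ha

lemma near_q (P : ℝ → Prop) (q : ℝ) (h : ∀ᶠ s in nhds q, P s) :
    ∃ q0 q1, q0 < q ∧ q < q1 ∧ P q0 ∧ P q1 := by
  obtain ⟨η, hη, h⟩ := Metric.eventually_nhds_iff.1 h
  refine ⟨q - η / 2, q + η / 2, by linarith, by linarith, h ?_, h ?_⟩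
  · rw [Real.dist_eq, abs_lt]; constructor <;> linarith
  · rw [Real.dist_eq, abs_lt]; constructor <;> linarith

lemma caseG (α β q r : ℝ) (hα : 0 ≤ α) (hβ : 0 ≤ β) (hq : 0 < q) (hαq : α * q < 1)
    (hβq : β * q < 1) (h4 : 4 - 2 * (α + β) * q < q) (hr : 0 < r)
    (hrc : 1 / r = 1 + α + 2 * β - 3 / q) (X Y : ℝ × ℝ → ℝ) (hX : Measurable X) (hY : Measurable Y)
    (ind : ℝ → ℂ) (hind : Measurable ind) (hind1 : ∀ φ, ‖ind φ‖ ≤ 1)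
    (hA : ∀ ε : ℝ, 0 < ε → ε < 1 → ∃ A : ℝ, 1 ≤ A ∧ ∀ f δ μ, 0 < δ → 0 < μ → Nrm f δ →
      (∀ φ, ind φ = 0 → f φ = 0) →
      volume {p : ℝ × ℝ | μ < ‖Tf f (X p) (Y p)‖} ≤ ENNReal.ofReal (A * (μ ^ (-4:ℝ) * δ * (δ / μ) ^ ε)) ∧
      (∀ x : ℝ, volume {y : ℝ | μ < ‖Tf f (X (x, y)) (Y (x, y))‖} ≤
        ENNReal.ofReal (A * (μ ^ (-2:ℝ) * (δ / μ) ^ ε))) ∧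
      (∀ y : ℝ, volume {x : ℝ | μ < ‖Tf f (X (x, y)) (Y (x, y))‖} ≤
        ENNReal.ofReal (A * (μ ^ (-2:ℝ) * δ)))) :
    ∃ C : ℝ, 0 < C ∧ ∀ F : ℝ → ℂ, Measurable F → ∀ W : ℝ, 0 < W → wcircle r F ≤ ENNReal.ofReal W →
      ∀ l : ℝ, 0 < l → volume {p : ℝ × ℝ | l * ((1 + |p.1|) ^ α * (1 + |p.2|) ^ β) <
        ‖Tf (fun φ => F φ * ind φ) (X p) (Y p)‖} ≤ ENNReal.ofReal (C * (W / l) ^ q) := by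
  obtain ⟨q0, q1, h01, h12, ⟨ha0, hb0, hc0, hd0⟩, ⟨ha1, hb1, hc1, hd1⟩⟩ := near_q
    (fun s => α * s < 1 ∧ β * s < 1 ∧ 4 - 2 * (α + β) * s < s ∧ 0 < s) q (by
      refine ((continuous_const.mul continuous_id).continuousAt.eventually_lt continuousAt_const hαq).and
        (((continuous_const.mul continuous_id).continuousAt.eventually_lt continuousAt_const hβq).and
        ((ContinuousAt.eventually_lt (f := fun s => 4 - 2 * (α + β) * s) (g := fun s => s)
          (by fun_prop) (by fun_prop) h4).and
        (lt_mem_nhds hq))))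
  have key : ∀ s : ℝ, α * s < 1 → β * s < 1 → 4 - 2 * (α + β) * s < s → 0 < s →
      ∃ C : ℝ, 0 < C ∧ ∀ f δ l, 0 < δ → 0 < l → Nrm f δ → (∀ φ, ind φ = 0 → f φ = 0) →
        volume {p : ℝ × ℝ | l * ((1 + |p.1|) ^ α * (1 + |p.2|) ^ β) < ‖Tf f (X p) (Y p)‖} ≤
        ENNReal.ofReal (C * (l ^ (-s) * δ ^ (s * (1 + α + 2 * β) - 3))) := by
    intro s h1 h2 h3 h5
    obtain ⟨ε, hε, hε1, h⟩ := RW2 α β s hα hβ h5 h1 h2 h3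
    obtain ⟨A, hA1, hA2⟩ := hA ε hε hε1
    obtain ⟨C, hC, h⟩ := h A hA1
    refine ⟨C, hC, fun f δ l hδ hl hf hz => ?_⟩
    refine h (fun x y => ‖Tf f (X (x, y)) (Y (x, y))‖) δ hδ ?_ ?_ ?_ ?_ ?_ l hl
    · have := (Tf_meas hf.1).comp (hX.prodMk hY)
      exact this.norm
    · intro x y; exact Tf_bd hδ.le hf _ _
    · intro μ hμ _; exact (hA2 f δ μ hδ hμ hf hz).1
    · intro μ hμ _; exact (hA2 f δ μ hδ hμ hf hz).2.1
    · intro μ hμ _; exact (hA2 f δ μ hδ hμ hf hz).2.2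
  obtain ⟨C1, hC1, k1⟩ := key q0 ha0 hb0 hc0 hd0
  obtain ⟨C2, hC2, k2⟩ := key q1 ha1 hb1 hc1 hd1
  obtain ⟨C, hC, h⟩ := interpT q0 q q1 (1 + α + 2 * β) 3 r (C1 + C2) hd0 h01 h12 (by norm_num) hr hrc
    (by positivity)
  refine ⟨C, hC, fun F hF W hW hWF l hl => ?_⟩
  refine h (ℝ × ℝ) volume (fun p => (1 + |p.1|) ^ α * (1 + |p.2|) ^ β) X Y ind ?_ hind hind1 ?_
    F hF W hW hWF l hl
  · intro z
    exact one_le_mul_of_one_le_of_one_le (wt_one _ _ hα) (wt_one _ _ hβ)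
  · intro f δ l hδ hl hf hz
    refine ⟨(k1 f δ l hδ hl hf hz).trans (ENNReal.ofReal_le_ofReal ?_),
      (k2 f δ l hδ hl hf hz).trans (ENNReal.ofReal_le_ofReal ?_)⟩
    · gcongr; linarith
    · gcongr; linarith

def Weak (α β r q : ℝ) : Prop :=
  ∃ C : ℝ, 0 < C ∧ ∀ F : ℝ → ℂ, Measurable F → ∀ W : ℝ, 0 < W → wcircle r F ≤ ENNReal.ofReal W →
      ∀ l : ℝ, 0 < l → volume {p : ℝ × ℝ | l * ((1 + |p.1|) ^ α * (1 + |p.2|) ^ β) <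
        ‖Tf F p.1 p.2‖} ≤ ENNReal.ofReal (C * (W / l) ^ q)

lemma Weak.mono {α β α' β' r q : ℝ} (h : Weak α β r q) (ha : α ≤ α') (hb : β ≤ β') :
    Weak α' β' r q := by
  obtain ⟨C, hC, h⟩ := h
  refine ⟨C, hC, fun F hF W hW hWF l hl => (measure_mono ?_).trans (h F hF W hW hWF l hl)⟩
  intro p hp
  have hp' : l * ((1 + |p.1|) ^ α' * (1 + |p.2|) ^ β') < ‖Tf F p.1 p.2‖ := hp
  refine lt_of_le_of_lt (b := l * ((1 + |p.1|) ^ α' * (1 + |p.2|) ^ β')) ?_ hp'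
  have h1 : ∀ x : ℝ, 1 ≤ 1 + |x| := fun x => by linarith [abs_nonneg x]
  gcongr
  · exact h1 _
  · exact h1 _

lemma wcircle_emb (r s : ℝ) (hs : 0 < s) (hsr : s ≤ r) :
    ∃ K : ℝ, 0 < K ∧ ∀ F : ℝ → ℂ, wcircle s F ≤ ENNReal.ofReal K * wcircle r F := by
  have hr : 0 < r := hs.trans_le hsr
  have he : 0 ≤ 1 / s - 1 / r := sub_nonneg.2 (one_div_le_one_div_of_le hs hsr)
  refine ⟨(2 * π) ^ (1 / s - 1 / r), by positivity, fun F => ?_⟩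
  refine iSup₂_le fun t ht => ?_
  set V := volume {φ ∈ Icc (0:ℝ) (2 * π) | t < ‖F φ‖} with hV
  have h1 : V ^ (1 / s) = V ^ (1 / s - 1 / r) * V ^ (1 / r) := by
    rw [← ENNReal.rpow_add_of_nonneg _ _ he (by positivity)]; congr 1; ring
  have h2 : V ≤ ENNReal.ofReal (2 * π) := by
    calc V ≤ volume (Icc (0:ℝ) (2 * π)) := measure_mono fun x hx => hx.1
      _ = _ := by simp
  have h3 : V ^ (1 / s - 1 / r) ≤ ENNReal.ofReal ((2 * π) ^ (1 / s - 1 / r)) := by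
    rw [← ENNReal.ofReal_rpow_of_pos (by positivity)]
    exact ENNReal.rpow_le_rpow h2 he
  have h4 : ENNReal.ofReal t * V ^ (1 / r) ≤ wcircle r F :=
    le_iSup₂ (f := fun (t : ℝ) (_ : 0 < t) => ENNReal.ofReal t *
      (volume {φ ∈ Icc (0:ℝ) (2 * π) | t < ‖F φ‖}) ^ (1 / r)) t ht
  calc ENNReal.ofReal t * V ^ (1 / s) = V ^ (1 / s - 1 / r) * (ENNReal.ofReal t * V ^ (1 / r)) := by
        rw [h1]; ring
    _ ≤ _ := mul_le_mul' h3 h4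

lemma wcircle_shift {r s : ℝ} (hs : 0 < s) (hsr : s ≤ r) :
    ∃ K : ℝ, 0 < K ∧ ∀ (F : ℝ → ℂ) (W : ℝ), 0 < W → wcircle r F ≤ ENNReal.ofReal W →
      wcircle s F ≤ ENNReal.ofReal (K * W) := by
  obtain ⟨K, hK, h⟩ := wcircle_emb r s hs hsr
  refine ⟨K, hK, fun F W hW hF => (h F).trans ?_⟩
  rw [ENNReal.ofReal_mul hK.le]
  exact mul_le_mul' le_rfl hF

lemma Weak.embed {α β r s q : ℝ} (h : Weak α β s q) (hs : 0 < s) (hsr : s ≤ r) :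
    Weak α β r q := by
  obtain ⟨K, hK, hK2⟩ := wcircle_shift hs hsr
  obtain ⟨C, hC, h⟩ := h
  refine ⟨C * K ^ q, by positivity, fun F hF W hW hWF l hl =>
    (h F hF (K * W) (by positivity) (hK2 F W hW hWF) l hl).trans_eq ?_⟩
  rw [mul_div_assoc, Real.mul_rpow hK.le (by positivity), mul_assoc]

lemma ind_meas (P : ℝ → Prop) (hP : MeasurableSet {φ | P φ}) [DecidablePred P] :
    Measurable (fun φ => if P φ then (1:ℂ) else 0) :=
  Measurable.ite hP measurable_const measurable_const

lemma cos_set_meas : MeasurableSet {φ : ℝ | |cos φ| < 1 / 2} :=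
  measurableSet_lt (by fun_prop) measurable_const

lemma sin_ge {φ : ℝ} (h : |cos φ| < 1 / 2) : ¬ |sin φ| < 1 / 2 := by
  intro h'
  have := sin_sq_add_cos_sq φ
  have h1 := sq_lt_sq' (by linarith [abs_nonneg (cos φ)]) h
  have h2 := sq_lt_sq' (by linarith [abs_nonneg (sin φ)]) h'
  rw [sq_abs] at h1 h2
  linarith

lemma ofR_mono {A B X : ℝ} (h : A ≤ B) (hX : 0 ≤ X) : ENNReal.ofReal (A * X) ≤ ENNReal.ofReal (B * X) :=
  ENNReal.ofReal_le_ofReal (mul_le_mul_of_nonneg_right h hX)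

open Classical in
lemma Tf_split (F : ℝ → ℂ) (hF : Measurable F) (P : ℝ → Prop) (hP : MeasurableSet {φ | P φ}) (x y : ℝ) :
    ‖Tf F x y‖ ≤ ‖Tf (fun φ => F φ * if P φ then (1:ℂ) else 0) x y‖ +
      ‖Tf (fun φ => F φ * if P φ then (0:ℂ) else 1) x y‖ := by
  set e : ℝ → ℂ := fun φ => Complex.exp (Complex.I * ((x * cos φ + y * sin φ : ℝ) : ℂ)) with he
  by_cases hi : Integrable (fun φ => F φ * e φ) ν0
  · have h0 : Measurable (fun φ => if P φ then (0:ℂ) else 1) :=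
      Measurable.ite hP measurable_const measurable_const
    have h1 : Measurable (fun φ => if P φ then (1:ℂ) else 0) :=
      Measurable.ite hP measurable_const measurable_const
    have i1 : Integrable (fun φ => (F φ * if P φ then (1:ℂ) else 0) * e φ) ν0 := by
      refine hi.mono (by fun_prop) (ae_of_all _ fun φ => ?_)
      by_cases h : P φ <;> simp [h]; positivity
    have i2 : Integrable (fun φ => (F φ * if P φ then (0:ℂ) else 1) * e φ) ν0 := by
      refine hi.mono (by fun_prop) (ae_of_all _ fun φ => ?_)
      by_cases h : P φ <;> simp [h]; positivity
    have : Tf F x y = Tf (fun φ => F φ * if P φ then (1:ℂ) else 0) x y +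
        Tf (fun φ => F φ * if P φ then (0:ℂ) else 1) x y := by
      refine Eq.trans ?_ (integral_add i1 i2)
      refine integral_congr_ae (ae_of_all _ fun φ => ?_)
      change F φ * e φ = (F φ * if P φ then (1:ℂ) else 0) * e φ + (F φ * if P φ then (0:ℂ) else 1) * e φ
      by_cases h : P φ <;> simp [h]
    rw [this]; exact norm_add_le _ _
  · have : Tf F x y = 0 := integral_undef hi
    rw [this, norm_zero]; positivity

open Classical in
lemma case3 (α β r q : ℝ) (hβ0 : 0 ≤ β) (hβα : β ≤ α) (hr : 1 < r) (hq : 1 < q)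
    (h1 : α < 1 / q) (h2 : 2 / q - 1 / 2 < α + β) (h3 : 3 / q - (1 - 1 / r) ≤ α + 2 * β) :
    Weak α β r q := by
  have hq0 : 0 < q := by linarith
  have hr0 : 0 < r := by linarith
  have hαq : α * q < 1 := by rwa [lt_div_iff₀ hq0] at h1
  have hβq : β * q < 1 := lt_of_le_of_lt (by gcongr) hαq
  have h4 : 4 - 2 * (α + β) * q < q := by
    have := mul_lt_mul_of_pos_right h2 hq0
    have e : (2 / q - 1 / 2) * q = 2 - q / 2 := by field_simp
    rw [e] at this; linarith
  have hrp : 0 < 1 / r := by positivity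
  set u := 1 + α + 2 * β - 3 / q with hu
  set v := 1 + β + 2 * α - 3 / q with hv
  have hu1 : 1 / r ≤ u := by linarith
  have hv1 : 1 / r ≤ v := by linarith
  have hu0 : 0 < u := by linarith
  have hv0 : 0 < v := by linarith
  have hur : 1 / u ≤ r := by rw [div_le_comm₀ hu0 hr0]; exact hu1
  have hvr : 1 / v ≤ r := by rw [div_le_comm₀ hv0 hr0]; exact hv1
  obtain ⟨C1, hC1, k1⟩ := caseG α β q (1 / u) (by linarith) hβ0 hq0 hαq hβq h4 (by positivity)
    (by rw [one_div_one_div]) Prod.fst Prod.snd measurable_fst measurable_snd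
    (fun φ => if |cos φ| < 1 / 2 then (1:ℂ) else 0)
    (Measurable.ite cos_set_meas measurable_const measurable_const) (by intro φ; split_ifs <;> simp) (by
      intro ε hε hε1
      obtain ⟨A1, hA1, a1⟩ := two_gen ε hε hε1
      obtain ⟨A2, hA2, a2⟩ := Tf_x ε hε hε1
      obtain ⟨A3, hA3, a3⟩ := Tf_yb
      refine ⟨1 + A1 + A2 + A3, by linarith, fun f δ μ hδ hμ hf hz => ⟨?_, ?_, ?_⟩⟩
      · exact (a1 f δ μ hδ hμ hf).trans (ofR_mono (by linarith) (by positivity))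
      · intro x; exact (a2 f δ μ hδ hμ hf x).trans (ofR_mono (by linarith) (by positivity))
      · intro y
        refine (a3 f δ μ hδ hμ hf ?_ y).trans (ofR_mono (by linarith) (by positivity))
        intro t ht
        refine hz t (if_neg fun h => sin_ge h ht))
  obtain ⟨C2, hC2, k2⟩ := caseG β α q (1 / v) hβ0 (by linarith) hq0 hβq hαq (by linarith) (by positivity)
    (by rw [one_div_one_div]) Prod.snd Prod.fst measurable_snd measurable_fst
    (fun φ => if |cos φ| < 1 / 2 then (0:ℂ) else 1)
    (Measurable.ite cos_set_meas measurable_const measurable_const) (by intro φ; split_ifs <;> simp) (by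
      intro ε hε hε1
      obtain ⟨A1, hA1, a1⟩ := two_gen ε hε hε1
      obtain ⟨A2, hA2, a2⟩ := Tf_y ε hε hε1
      obtain ⟨A3, hA3, a3⟩ := Tf_xb
      refine ⟨1 + A1 + A2 + A3, by linarith, fun f δ μ hδ hμ hf hz => ⟨?_, ?_, ?_⟩⟩
      · refine le_trans (le_of_eq ?_)
          ((a1 f δ μ hδ hμ hf).trans (ofR_mono (by linarith) (by positivity)))
        exact (Measure.measurePreserving_swap (μ := (volume : Measure ℝ))
          (ν := (volume : Measure ℝ))).measure_preimage
          (measurableSet_lt measurable_const (Tf_meas hf.1).norm).nullMeasurableSet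
      · intro x; exact (a2 f δ μ hδ hμ hf x).trans (ofR_mono (by linarith) (by positivity))
      · intro y
        refine (a3 f δ μ hδ hμ hf ?_ y).trans (ofR_mono (by linarith) (by positivity))
        intro t ht
        exact hz t (if_pos ht))
  obtain ⟨K1, hK1, s1⟩ := wcircle_shift (by positivity) hur
  obtain ⟨K2, hK2, s2⟩ := wcircle_shift (by positivity) hvr
  refine ⟨C1 * (2 * K1) ^ q + C2 * (2 * K2) ^ q, by positivity, fun F hF W hW hWF l hl => ?_⟩
  have b1 := k1 F hF (K1 * W) (by positivity) (s1 F W hW hWF) (l / 2) (by positivity)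
  have b2 := k2 F hF (K2 * W) (by positivity) (s2 F W hW hWF) (l / 2) (by positivity)
  have hm2 : Measurable (fun φ => F φ * if |cos φ| < 1 / 2 then (0:ℂ) else 1) :=
    hF.mul (Measurable.ite cos_set_meas measurable_const measurable_const)
  have b2' : volume {p : ℝ × ℝ | l / 2 * ((1 + |p.1|) ^ α * (1 + |p.2|) ^ β) <
      ‖Tf (fun φ => F φ * if |cos φ| < 1 / 2 then (0:ℂ) else 1) p.1 p.2‖} ≤
      ENNReal.ofReal (C2 * (K2 * W / (l / 2)) ^ q) := by
    refine le_trans (le_of_eq ?_) b2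
    refine ((Measure.measurePreserving_swap (μ := (volume : Measure ℝ))
          (ν := (volume : Measure ℝ))).measure_preimage (s := {p : ℝ × ℝ |
      l / 2 * ((1 + |p.1|) ^ α * (1 + |p.2|) ^ β) <
      ‖Tf (fun φ => F φ * if |cos φ| < 1 / 2 then (0:ℂ) else 1) p.1 p.2‖}) ?_).symm.trans ?_
    swap
    · congr 1
      ext p
      simp only [Set.mem_preimage, Set.mem_ofPred_eq, Prod.fst_swap, Prod.snd_swap]
      rw [mul_comm ((1 + |p.2|) ^ α)]
    · refine (measurableSet_lt ?_ (Tf_meas hm2).norm).nullMeasurableSet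
      fun_prop
  have hs : {p : ℝ × ℝ | l * ((1 + |p.1|) ^ α * (1 + |p.2|) ^ β) < ‖Tf F p.1 p.2‖} ⊆
      {p : ℝ × ℝ | l / 2 * ((1 + |p.1|) ^ α * (1 + |p.2|) ^ β) <
        ‖Tf (fun φ => F φ * if |cos φ| < 1 / 2 then (1:ℂ) else 0) p.1 p.2‖} ∪
      {p : ℝ × ℝ | l / 2 * ((1 + |p.1|) ^ α * (1 + |p.2|) ^ β) <
        ‖Tf (fun φ => F φ * if |cos φ| < 1 / 2 then (0:ℂ) else 1) p.1 p.2‖} := by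
    intro p hp
    by_contra hn
    simp only [Set.mem_union, Set.mem_ofPred_eq, not_or, not_lt] at hn hp
    have := Tf_split F hF (fun φ => |cos φ| < 1 / 2) cos_set_meas p.1 p.2
    linarith [hn.1, hn.2]
  calc _ ≤ _ := measure_mono hs
    _ ≤ _ := measure_union_le _ _
    _ ≤ ENNReal.ofReal (C1 * (K1 * W / (l / 2)) ^ q) + ENNReal.ofReal (C2 * (K2 * W / (l / 2)) ^ q) :=
      add_le_add b1 b2'
    _ = _ := by
      rw [← ENNReal.ofReal_add (by positivity) (by positivity)]
      have e : ∀ K : ℝ, K * W / (l / 2) = (2 * K) * (W / l) := fun K => by field_simp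
      rw [e, e, Real.mul_rpow (x := 2 * K1) (by positivity) (by positivity),
        Real.mul_rpow (x := 2 * K2) (by positivity) (by positivity)]
      congr 1; ring

lemma case2 (α β r q : ℝ) (hβ0 : 0 ≤ β) (hβα : β ≤ α) (hr : 1 < r) (hq : 1 < q)
    (h1 : α = 1 / q) (h2 : 2 / q - (1 - 1 / r) < 2 * β) : Weak α β r q := by
  have hq0 : 0 < q := by linarith
  have hqi : 0 < 1 / q := by positivity
  have hr1 : 1 / r < 1 := by rw [div_lt_one (by linarith)]; exact hr
  have hr0 : 0 < 1 / r := by positivity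
  have e2 : 2 / q = 2 * (1 / q) := by ring
  have e3 : 3 / q = 3 * (1 / q) := by ring
  obtain ⟨a, _, ha, -, ⟨p1, p2, p3⟩, -⟩ := near_q (fun a => 0 < a ∧ 2 / q - 1 / 2 < a + min β a ∧
      3 / q - (1 - 1 / r) < a + 2 * min β a) α (by
    have hm : min β α = β := min_eq_left hβα
    refine (lt_mem_nhds (by linarith)).and ((ContinuousAt.eventually_lt continuousAt_const
      (by fun_prop) ?_).and (ContinuousAt.eventually_lt continuousAt_const (by fun_prop) ?_))
    · rw [hm]; linarith
    · rw [hm]; linarith)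
  exact (case3 a (min β a) r q (le_min hβ0 p1.le) (min_le_right _ _) hr hq (by linarith) p2 p3.le).mono
    ha.le (min_le_left _ _)

lemma case1a (α β r q : ℝ) (hβ0 : 0 ≤ β) (hr : 1 < r) (hq : 1 < q) (hβ : β < 1 / q)
    (h1 : 1 / q < α) (h2 : 2 / q - (1 - 1 / r) ≤ 2 * β) : Weak α β r q := by
  have hq0 : 0 < q := by linarith
  have hr0 : 0 < r := by linarith
  have hrp : 0 < 1 / r := by positivity
  have hα0 : 0 < α := lt_trans (by positivity) h1
  set u := 1 + 2 * β - 2 / q with hu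
  have hu1 : 1 / r ≤ u := by linarith
  have hu0 : 0 < u := by linarith
  have hur : 1 / u ≤ r := by rw [div_le_comm₀ hu0 hr0]; exact hu1
  refine Weak.embed (s := 1 / u) ?_ (by positivity) hur
  have hβq : β * q < 1 := by rwa [lt_div_iff₀ hq0] at hβ
  have hαq : 1 < α * q := by rwa [div_lt_iff₀ hq0] at h1
  have h4 : 2 - 2 * β * q < q := by
    have := mul_pos hu0 hq0
    have e : u * q = q + 2 * β * q - 2 := by rw [hu]; field_simp
    rw [e] at this; linarith
  obtain ⟨q0, q1, h01, h12, ⟨hb0, hc0, hd0⟩, ⟨hb1, hc1, hd1⟩⟩ := near_q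
    (fun s => β * s < 1 ∧ 2 - 2 * β * s < s ∧ 0 < s) q (by
      refine (((continuous_const.mul continuous_id).continuousAt.eventually_lt continuousAt_const hβq).and
        ((ContinuousAt.eventually_lt (f := fun s => 2 - 2 * β * s) (g := fun s => s)
          (by fun_prop) (by fun_prop) h4).and
        (lt_mem_nhds hq0))))
  have key : ∀ s : ℝ, β * s < 1 → 2 - 2 * β * s < s → 0 < s →
      ∃ C : ℝ, 0 < C ∧ ∀ x f δ l, 0 < δ → 0 < l → Nrm f δ →
        volume {y : ℝ | l * (1 + |y|) ^ β < ‖Tf f x y‖} ≤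
        ENNReal.ofReal (C * (l ^ (-s) * δ ^ (s * (1 + 2 * β) - 2))) := by
    intro s h2 h3 h5
    obtain ⟨ε, hε, hε1, h⟩ := RW1 β s hβ0 h5 h2 h3
    obtain ⟨A, hA, a⟩ := Tf_x ε hε hε1
    obtain ⟨C, hC, h⟩ := h (1 + A) (by linarith)
    refine ⟨C, hC, fun x f δ l hδ hl hf => ?_⟩
    refine h (fun y => ‖Tf f x y‖) δ hδ (fun y => Tf_bd hδ.le hf _ _) ?_ l hl
    intro μ hμ _
    exact (a f δ μ hδ hμ hf x).trans (ofR_mono (by linarith) (by positivity))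
  obtain ⟨C1, hC1, k1⟩ := key q0 hb0 hc0 hd0
  obtain ⟨C2, hC2, k2⟩ := key q1 hb1 hc1 hd1
  obtain ⟨C, hC, h⟩ := interpT q0 q q1 (1 + 2 * β) 2 (1 / u) (C1 + C2) hd0 h01 h12 (by norm_num)
    (by positivity) (by rw [one_div_one_div]) (by positivity)
  have hI : Integrable (fun x : ℝ => (1 + ‖x‖) ^ (-(α * q))) volume :=
    integrable_one_add_norm (by simpa using hαq)
  set I := ∫ x : ℝ, (1 + ‖x‖) ^ (-(α * q)) with hIdef
  have hI0 : 0 ≤ I := integral_nonneg fun x => by positivity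
  refine ⟨C * (1 + I), by positivity, fun F hF W hW hWF l hl => ?_⟩
  have hx : ∀ x : ℝ, volume {y : ℝ | l * ((1 + |x|) ^ α * (1 + |y|) ^ β) < ‖Tf F x y‖} ≤
      ENNReal.ofReal (C * (W / l) ^ q * (1 + ‖x‖) ^ (-(α * q))) := by
    intro x
    have hxp : 0 < (1 + |x|) ^ α := by positivity
    have := h ℝ volume (fun y => (1 + |y|) ^ β) (fun _ => x) (fun y => y) (fun _ => 1)
      (fun y => wt_one y β hβ0) measurable_const (by simp) (by
        intro f δ l hδ hl hf hz
        refine ⟨(k1 x f δ l hδ hl hf).trans (ENNReal.ofReal_le_ofReal ?_),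
          (k2 x f δ l hδ hl hf).trans (ENNReal.ofReal_le_ofReal ?_)⟩
        · gcongr; linarith
        · gcongr; linarith) F hF W hW hWF (l * (1 + |x|) ^ α) (by positivity)
    simp only [mul_one] at this
    simp only [← mul_assoc]
    refine this.trans_eq ?_
    congr 1
    rw [Real.norm_eq_abs, Real.rpow_neg (by positivity), Real.rpow_mul (by positivity), ← div_div,
      Real.div_rpow (by positivity) hxp.le, mul_assoc, div_eq_mul_inv]
  have hmeas : MeasurableSet {p : ℝ × ℝ | l * ((1 + |p.1|) ^ α * (1 + |p.2|) ^ β) < ‖Tf F p.1 p.2‖} :=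
    measurableSet_lt (by fun_prop) (Tf_meas hF).norm
  have hv : (volume : Measure (ℝ × ℝ)) = (volume : Measure ℝ).prod volume := rfl
  rw [hv, Measure.prod_apply hmeas]
  calc _ ≤ ∫⁻ x : ℝ, ENNReal.ofReal (C * (W / l) ^ q * (1 + ‖x‖) ^ (-(α * q))) :=
        lintegral_mono fun x => hx x
    _ = ENNReal.ofReal (∫ x : ℝ, C * (W / l) ^ q * (1 + ‖x‖) ^ (-(α * q))) := by
        rw [ofReal_integral_eq_lintegral_ofReal (hI.const_mul _) (ae_of_all _ fun x => by positivity)]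
    _ ≤ _ := by
        rw [integral_const_mul]
        refine ENNReal.ofReal_le_ofReal ?_
        rw [mul_right_comm]
        have : 0 ≤ C * (W / l) ^ q := by positivity
        nlinarith

lemma case1 (α β r q : ℝ) (hβ0 : 0 ≤ β) (hr : 1 < r) (hq : 1 < q)
    (h1 : 1 / q < α) (h2 : 2 / q - (1 - 1 / r) ≤ 2 * β) : Weak α β r q := by
  by_cases hβ : β < 1 / q
  · exact case1a α β r q hβ0 hr hq hβ h1 h2
  · have hqi : 0 < 1 / q := by positivity
    have hr1 : 1 / r < 1 := by rw [div_lt_one (by linarith)]; exact hr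
    have e2 : 2 / q = 2 * (1 / q) := by ring
    obtain ⟨b, _, hb, -, ⟨p1, p2⟩, -⟩ := near_q (fun b => 0 < b ∧ 2 / q - (1 - 1 / r) < 2 * b) (1 / q) (by
      refine (lt_mem_nhds hqi).and (ContinuousAt.eventually_lt continuousAt_const (by fun_prop) ?_)
      linarith)
    exact (case1a α b r q p1.le hr hq hb h1 p2.le).mono le_rfl (by linarith)

lemma Rab_lt (α β : ℝ) (F : ℝ → ℂ) (x y t : ℝ) (ht : t < ‖Rab α β F x y‖) :
    t * ((1 + |x|) ^ α * (1 + |y|) ^ β) < ‖Tf F x y‖ := by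
  have hR : Rext F x y = Complex.ofReal (1 / (2 * π)) * Tf F x y := by
    rw [Rext, Tf, ν0, intervalIntegral.integral_of_le (by positivity)]
  have hx : 0 < (1 + |x|) ^ α := by positivity
  have hy : 0 < (1 + |y|) ^ β := by positivity
  rw [Rab, hR, norm_mul, norm_mul, Complex.norm_real, Complex.norm_real,
    Real.norm_of_nonneg (by positivity), Real.norm_of_nonneg (by positivity),
    Real.rpow_neg (by positivity), Real.rpow_neg (by positivity), ← mul_inv, ← div_eq_mul_inv,
    lt_div_iff₀ (by positivity)] at ht
  refine ht.trans_le ?_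
  have h1 : 1 / (2 * π) ≤ 1 := by
    rw [div_le_one (by positivity)]; linarith [Real.pi_gt_three]
  calc _ ≤ 1 * ‖Tf F x y‖ := by gcongr
    _ = _ := one_mul _

lemma Weak.final {α β r q : ℝ} (hq : 0 < q) (h : Weak α β r q) :
    ∃ C : ℝ, 0 < C ∧ ∀ F : ℝ → ℂ, Measurable F →
      wplane q (fun p => Rab α β F p.1 p.2) ≤ ENNReal.ofReal C * wcircle r F := by
  obtain ⟨C, hC, h⟩ := h
  set K := C ^ (1 / q) with hK
  have hK0 : 0 < K := by positivity
  refine ⟨K, hK0, fun F hF => ?_⟩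
  by_cases htop : wcircle r F = ⊤
  · rw [htop, ENNReal.mul_top (by simpa using hK0)]; exact le_top
  refine iSup₂_le fun t ht => ?_
  have main : ∀ W : ℝ, 0 < W → wcircle r F ≤ ENNReal.ofReal W →
      ENNReal.ofReal t * (volume {p : ℝ × ℝ | t < ‖Rab α β F p.1 p.2‖}) ^ (1 / q) ≤
        ENNReal.ofReal (K * W) := by
    intro W hW hWF
    have h1 : volume {p : ℝ × ℝ | t < ‖Rab α β F p.1 p.2‖} ≤ ENNReal.ofReal (C * (W / t) ^ q) :=
      (measure_mono fun p hp => Rab_lt α β F p.1 p.2 t hp).trans (h F hF W hW hWF t ht)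
    calc _ ≤ ENNReal.ofReal t * (ENNReal.ofReal (C * (W / t) ^ q)) ^ (1 / q) := by gcongr
      _ = _ := by
        rw [ENNReal.ofReal_rpow_of_pos (by positivity), ← ENNReal.ofReal_mul ht.le,
          Real.mul_rpow hC.le (by positivity), ← Real.rpow_mul (by positivity),
          mul_one_div_cancel hq.ne', Real.rpow_one]
        congr 1
        rw [← hK]
        field_simp
  refine ENNReal.le_of_forall_pos_le_add fun ε hε _ => ?_
  have hε' : (0:ℝ) < ε := hε
  set w := (wcircle r F).toReal with hw
  have hw0 : 0 ≤ w := ENNReal.toReal_nonneg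
  have hwe : wcircle r F = ENNReal.ofReal w := (ENNReal.ofReal_toReal htop).symm
  refine (main (w + ε / K) (by positivity) ?_).trans_eq ?_
  · rw [hwe]; exact ENNReal.ofReal_le_ofReal (by linarith [div_pos hε' hK0])
  · rw [hwe, ← ENNReal.ofReal_mul hK0.le, ← ENNReal.ofReal_coe_nnreal (p := ε),
      ← ENNReal.ofReal_add (by positivity) hε'.le]
    congr 1
    field_simp


/-- Corollary 10 (case `s = ∞`): restricted weak-type mapping properties
`L^{r,∞}(S¹) → L^{q,∞}(ℝ²)` of `R*_{α,β}` for `1 < r, q < ∞`. -/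
theorem statement7 (α β r q : ℝ) (hβ0 : 0 ≤ β) (hβα : β ≤ α)
    (hr : 1 < r) (hq : 1 < q)
    (hcase :
      (1 / q < α ∧ 2 / q - (1 - 1 / r) ≤ 2 * β) ∨
      (α = 1 / q ∧ 2 / q - (1 - 1 / r) < 2 * β) ∨
      (α < 1 / q ∧ 2 / q - 1 / 2 < α + β ∧ 3 / q - (1 - 1 / r) ≤ α + 2 * β)) :
    ∃ C : ℝ, 0 < C ∧ ∀ F : ℝ → ℂ, Measurable F →
      wplane q (fun p => Rab α β F p.1 p.2) ≤ ENNReal.ofReal C * wcircle r F := by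
  have hq0 : 0 < q := by linarith
  rcases hcase with ⟨h1, h2⟩ | ⟨h1, h2⟩ | ⟨h1, h2, h3⟩
  · exact (case1 α β r q hβ0 hr hq h1 h2).final hq0
  · exact (case2 α β r q hβ0 hβα hr hq h1 h2).final hq0
  · exact (case3 α β r q hβ0 hβα hr hq h1 h2 h3).final hq0
end
end

section
/- Let 0 ≤ β ≤ α < ∞, 1 ≤ r ≤ ∞ and 0 < q < ∞. If there exists C > 0 such that ‖R*_{α,β}F‖_{L^q(ℝ²)} ≤ C · ‖F‖_{L^r(S¹)} for all measurable F : ℝ → ℂ, then α + β > 2/q − 1/2. -/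
open MeasureTheory Real Set Filter
open scoped ENNReal

noncomputable section

noncomputable def Iint (r b : ℝ) : ℝ := ∫ t in (0:ℝ)..b, Real.sin (r * (1 - Real.cos t))
noncomputable def hfun (r t : ℝ) : ℝ := (1 - Real.cos (r * (1 - Real.cos t))) / (r * Real.sin t)

lemma G_deriv (r t : ℝ) (hr : 0 < r) (h0 : 0 < t) (h1 : t < π / 2) :
    HasDerivAt (fun t => Iint r t - hfun r t)
      ((1 - Real.cos (r * (1 - Real.cos t))) * Real.cos t / (r * Real.sin t ^ 2)) t := by
  have hs : 0 < Real.sin t := Real.sin_pos_of_pos_of_lt_pi h0 (by linarith [Real.pi_pos])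
  have hc : Continuous fun t : ℝ => Real.sin (r * (1 - Real.cos t)) := by fun_prop
  have hI : HasDerivAt (Iint r) (Real.sin (r * (1 - Real.cos t))) t :=
    intervalIntegral.integral_hasDerivAt_right (hc.intervalIntegrable _ _)
      hc.stronglyMeasurable.stronglyMeasurableAtFilter hc.continuousAt
  have hu : HasDerivAt (fun t : ℝ => r * (1 - Real.cos t)) (r * Real.sin t) t := by
    have := ((Real.hasDerivAt_cos t).const_sub 1).const_mul r
    simpa using this
  have hn : HasDerivAt (fun t : ℝ => 1 - Real.cos (r * (1 - Real.cos t)))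
      (Real.sin (r * (1 - Real.cos t)) * (r * Real.sin t)) t := by
    have := (hu.cos).const_sub 1
    simpa using this
  have hd : HasDerivAt (fun t : ℝ => r * Real.sin t) (r * Real.cos t) t :=
    (Real.hasDerivAt_sin t).const_mul r
  have hh := hn.div hd (by positivity)
  have := hI.sub hh
  refine this.congr_deriv ?_
  field_simp
  ring

lemma hfun_nonneg (r t : ℝ) (hr : 0 < r) (h0 : 0 ≤ t) (h1 : t ≤ π / 2) : 0 ≤ hfun r t := by
  have hs : 0 ≤ Real.sin t := Real.sin_nonneg_of_nonneg_of_le_pi h0 (by linarith [Real.pi_pos])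
  have := Real.cos_le_one (r * (1 - Real.cos t))
  exact div_nonneg (by linarith) (by positivity)

lemma hfun_le (r t : ℝ) (hr : 0 < r) (h0 : 0 ≤ t) (h1 : t ≤ π / 2) :
    hfun r t ≤ r * Real.sin t ^ 3 / 2 := by
  have hs : 0 ≤ Real.sin t := Real.sin_nonneg_of_nonneg_of_le_pi h0 (by linarith [Real.pi_pos])
  have hcc : 0 ≤ Real.cos t := Real.cos_nonneg_of_neg_pi_div_two_le_of_le (by linarith) h1
  rcases hs.eq_or_lt with hs0 | hs
  · simp [hfun, ← hs0]
  unfold hfun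
  rw [div_le_iff₀ (by positivity)]
  have h2 := Real.one_sub_sq_div_two_le_cos (x := r * (1 - Real.cos t))
  have h3 : 1 - Real.cos t ≤ Real.sin t ^ 2 := by
    nlinarith [Real.sin_sq_add_cos_sq t, Real.cos_le_one t]
  have h4 : 0 ≤ 1 - Real.cos t := by linarith [Real.cos_le_one t]
  have h5 : (1 - Real.cos t)^2 ≤ (Real.sin t ^ 2)^2 := by gcongr
  have h6 : r^2 * (1 - Real.cos t)^2 ≤ r^2 * (Real.sin t ^ 2)^2 := by gcongr
  nlinarith

lemma hfun_zero (r : ℝ) : hfun r 0 = 0 := by simp [hfun]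

lemma G_cont (r : ℝ) (hr : 0 < r) :
    ContinuousOn (fun t => Iint r t - hfun r t) (Icc 0 (π / 2)) := by
  have hc : Continuous fun t : ℝ => Real.sin (r * (1 - Real.cos t)) := by fun_prop
  have hI : Continuous (Iint r) :=
    intervalIntegral.continuous_primitive (fun a b => hc.intervalIntegrable a b) 0
  refine hI.continuousOn.sub ?_
  intro t ht
  rcases ht.1.eq_or_lt with h | h
  · subst h
    unfold ContinuousWithinAt
    rw [hfun_zero]
    have hl : Tendsto (fun t : ℝ => r * Real.sin t ^ 3 / 2) (nhdsWithin 0 (Icc 0 (π/2))) (nhds 0) := by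
      have : Continuous (fun t : ℝ => r * Real.sin t ^ 3 / 2) := by fun_prop
      have := (this.tendsto 0).mono_left (nhdsWithin_le_nhds (s := Icc 0 (π/2)))
      simpa using this
    refine tendsto_of_tendsto_of_tendsto_of_le_of_le' tendsto_const_nhds hl ?_ ?_
    · filter_upwards [self_mem_nhdsWithin] with t ht using hfun_nonneg r t hr ht.1 ht.2
    · filter_upwards [self_mem_nhdsWithin] with t ht using hfun_le r t hr ht.1 ht.2
  · have hs : 0 < Real.sin t := Real.sin_pos_of_pos_of_lt_pi h (by linarith [Real.pi_pos, ht.2])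
    apply ContinuousAt.continuousWithinAt
    unfold hfun
    apply ContinuousAt.div (by fun_prop) (by fun_prop) (by positivity)

lemma G_mono (r : ℝ) (hr : 0 < r) :
    MonotoneOn (fun t => Iint r t - hfun r t) (Icc 0 (π / 2)) := by
  apply monotoneOn_of_deriv_nonneg (convex_Icc _ _) (G_cont r hr)
  · rw [interior_Icc]
    exact fun t ht => (G_deriv r t hr ht.1 ht.2).differentiableAt.differentiableWithinAt
  · rw [interior_Icc]
    intro t ht
    rw [(G_deriv r t hr ht.1 ht.2).deriv]
    have hcc : 0 ≤ Real.cos t := Real.cos_nonneg_of_neg_pi_div_two_le_of_le (by linarith [ht.1, Real.pi_pos]) ht.2.le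
    have := Real.cos_le_one (r * (1 - Real.cos t))
    exact div_nonneg (mul_nonneg (by linarith) hcc) (by positivity)

lemma I_nonneg (r b : ℝ) (hr : 0 < r) (h0 : 0 ≤ b) (h1 : b ≤ π / 2) : 0 ≤ Iint r b := by
  have := G_mono r hr (a := 0) ⟨le_rfl, by positivity⟩ (b := b) ⟨h0, h1⟩ h0
  have h2 := hfun_nonneg r b hr h0 h1
  simp only [hfun_zero] at this
  have h3 : Iint r 0 = 0 := by simp [Iint]
  linarith

lemma one_sub_cos_ge (t : ℝ) (h : |t| ≤ π) : t ^ 2 / 5 ≤ 1 - Real.cos t := by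
  have h1 := Real.cos_le_one_sub_mul_cos_sq h
  have h2 : (1:ℝ)/5 ≤ 2 / π ^ 2 := by
    rw [div_le_div_iff₀ (by norm_num) (by positivity)]
    nlinarith [Real.pi_lt_d2, Real.pi_pos]
  nlinarith [sq_nonneg t]

lemma I_lower (r b : ℝ) (hr : 4 ≤ r) (h0 : π / 4 ≤ b) (h1 : b ≤ π / 2) :
    1 / 8000 / √r ≤ Iint r b := by
  have hr0 : 0 < r := by linarith
  have hsr : 2 ≤ √r := by
    rw [show (2:ℝ) = √4 by rw [show (4:ℝ) = 2^2 by norm_num]; simp]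
    exact Real.sqrt_le_sqrt hr
  have hsq : √r ^ 2 = r := Real.sq_sqrt hr0.le
  set e : ℝ := 1 / √r with he
  have he0 : 0 < e := by positivity
  have he1 : e ≤ 1 / 2 := by rw [he]; gcongr
  have hre : r * e ^ 2 = 1 := by rw [he, div_pow, hsq]; field_simp
  have hpi := Real.pi_gt_three
  have hb0 : 0 ≤ b := by linarith
  have key : 1 / 4000 * (e - e / 2) ≤ (Iint r e - hfun r e) - (Iint r (e/2) - hfun r (e/2)) := by
    refine (convex_Icc (e/2) e).mul_sub_le_image_sub_of_le_deriv (f := fun t => Iint r t - hfun r t) ((G_cont r hr0).mono (Icc_subset_Icc (by positivity) (by linarith))) ?_ ?_ _ (left_mem_Icc.2 (by linarith)) _ (right_mem_Icc.2 (by linarith)) (by linarith)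
    · rw [interior_Icc]
      exact fun t ht => (G_deriv r t hr0 (by linarith [ht.1]) (by linarith [ht.2])).differentiableAt.differentiableWithinAt
    · rw [interior_Icc]
      intro t ht
      obtain ⟨ht1, ht2⟩ := ht
      have ht0 : 0 < t := by linarith
      rw [(G_deriv r t hr0 ht0 (by linarith)).deriv]
      have hs : 0 < Real.sin t := Real.sin_pos_of_pos_of_lt_pi ht0 (by linarith)
      have hst : Real.sin t ≤ t := Real.sin_le ht0.le
      have hrt : r * t ^ 2 ≤ 1 := by rw [← hre]; gcongr
      have hrt' : 1 / 4 ≤ r * t ^ 2 := by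
        have : r * (e/2)^2 ≤ r * t ^ 2 := by gcongr
        nlinarith
      have hct : 1 / 2 ≤ Real.cos t := by
        have := Real.one_sub_sq_div_two_le_cos (x := t)
        nlinarith
      have hu1 : 1 / 20 ≤ r * (1 - Real.cos t) := by
        have := one_sub_cos_ge t (by rw [abs_of_pos ht0]; linarith)
        nlinarith
      have hu2 : r * (1 - Real.cos t) ≤ 1 / 2 := by
        have := Real.one_sub_sq_div_two_le_cos (x := t)
        nlinarith
      have hv := one_sub_cos_ge (r * (1 - Real.cos t)) (by rw [abs_of_pos (by linarith)]; linarith)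
      have hv' : 1 / 2000 ≤ 1 - Real.cos (r * (1 - Real.cos t)) := by nlinarith
      rw [le_div_iff₀ (by positivity)]
      have : r * Real.sin t ^ 2 ≤ 1 := le_trans (by gcongr) hrt
      nlinarith
  have m1 := G_mono r hr0 (a := 0) ⟨le_rfl, by positivity⟩ (b := e/2) ⟨by positivity, by linarith⟩ (by positivity)
  have m2 := G_mono r hr0 (a := e) ⟨by positivity, by linarith⟩ (b := b) ⟨hb0, h1⟩ (by linarith)
  have h2 := hfun_nonneg r b hr0 hb0 h1
  simp only [hfun_zero] at m1 m2
  have h3 : Iint r 0 = 0 := by simp [Iint]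
  have : 1 / 8000 / √r = 1/8000 * e := by rw [he]; ring
  rw [this]
  linarith

lemma Rext_lower (x y : ℝ) (hx : 4 ≤ x) (hy : 0 ≤ y) (hyx : y ≤ x) :
    1 / (2 * π) * (1 / 8000 / √(2 * x)) ≤
      ‖Rext ((Ioc (0:ℝ) (π / 2)).indicator fun _ => (1:ℂ)) x y‖ := by
  have hpi := Real.pi_pos
  obtain ⟨r, θ, hr4, hr2, hθ0, hθ1, hxr, hyr⟩ : ∃ r θ : ℝ, 4 ≤ r ∧ r ≤ 2 * x ∧ 0 ≤ θ ∧ θ ≤ π / 2 ∧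
      x = r * Real.cos θ ∧ y = r * Real.sin θ := by
    refine ⟨‖(⟨x, y⟩ : ℂ)‖, Complex.arg ⟨x, y⟩, ?_, ?_, ?_, ?_, ?_, ?_⟩
    · have := Complex.re_le_norm (⟨x, y⟩ : ℂ)
      simp only at this
      linarith
    · have := Complex.norm_le_abs_re_add_abs_im (⟨x, y⟩ : ℂ)
      simp only at this
      rw [abs_of_nonneg hy, abs_of_nonneg (by linarith)] at this
      linarith
    · exact Complex.arg_nonneg_iff.2 hy
    · exact (abs_le.1 (Complex.abs_arg_le_pi_div_two_iff.2 (show 0 ≤ (⟨x, y⟩ : ℂ).re by simp only; linarith))).2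
    · exact (Complex.norm_mul_cos_arg ⟨x, y⟩).symm
    · exact (Complex.norm_mul_sin_arg ⟨x, y⟩).symm
  have hr0 : 0 < r := by linarith
  have hcs : Continuous fun t : ℝ => Real.sin (r * (1 - Real.cos t)) := by fun_prop
  have hsum : 1 / 8000 / √r ≤ Iint r θ + Iint r (π / 2 - θ) := by
    rcases le_total (π / 4) θ with h | h
    · have := I_lower r θ hr4 h hθ1
      have := I_nonneg r (π / 2 - θ) hr0 (by linarith) (by linarith)
      linarith
    · have := I_nonneg r θ hr0 hθ0 hθ1
      have := I_lower r (π / 2 - θ) hr4 (by linarith) (by linarith)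
      linarith
  have hint : ∫ φ in (0:ℝ)..(π / 2), Real.sin (r * (1 - Real.cos (φ - θ))) =
      Iint r θ + Iint r (π / 2 - θ) := by
    rw [intervalIntegral.integral_comp_sub_right (fun t => Real.sin (r * (1 - Real.cos t))) θ,
      ← intervalIntegral.integral_add_adjacent_intervals (b := 0)
        (hcs.intervalIntegrable _ _) (hcs.intervalIntegrable _ _)]
    congr 1
    have := intervalIntegral.integral_comp_neg (a := 0) (b := θ)
      (fun t => Real.sin (r * (1 - Real.cos t)))
    simp only [Real.cos_neg, neg_zero] at this
    rw [zero_sub, ← this]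
    rfl
  set J : ℂ := ∫ φ in (0:ℝ)..(π / 2), Complex.exp (Complex.I * Complex.ofReal (r * Real.cos (φ - θ))) with hJ
  have hRe : Rext ((Ioc (0:ℝ) (π / 2)).indicator fun _ => (1:ℂ)) x y = Complex.ofReal (1 / (2 * π)) * J := by
    unfold Rext
    congr 1
    rw [hJ, intervalIntegral.integral_of_le (by positivity), intervalIntegral.integral_of_le (by positivity)]
    rw [← integral_indicator measurableSet_Ioc, ← integral_indicator measurableSet_Ioc]
    congr 1
    ext φ
    have hsub : φ ∈ Ioc (0:ℝ) (π / 2) → φ ∈ Ioc (0:ℝ) (2 * π) := fun h => ⟨h.1, by linarith [h.2]⟩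
    have hph : x * Real.cos φ + y * Real.sin φ = r * Real.cos (φ - θ) := by
      rw [Real.cos_sub, hxr, hyr]; ring
    by_cases h : φ ∈ Ioc (0:ℝ) (π / 2)
    · rw [indicator_of_mem (hsub h), indicator_of_mem h, indicator_of_mem h, hph, one_mul]
    · rw [indicator_of_notMem h]
      by_cases h' : φ ∈ Ioc (0:ℝ) (2 * π)
      · rw [indicator_of_mem h', indicator_of_notMem h, zero_mul]
      · rw [indicator_of_notMem h']
  have hJn : Iint r θ + Iint r (π / 2 - θ) ≤ ‖J‖ := by
    have h1 : Complex.exp (Complex.I * Complex.ofReal (-r)) * J =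
        ∫ φ in (0:ℝ)..(π / 2), Complex.exp (Complex.I * Complex.ofReal (-(r * (1 - Real.cos (φ - θ))))) := by
      rw [hJ, ← intervalIntegral.integral_const_mul]
      congr 1
      ext φ
      rw [← Complex.exp_add]
      congr 1
      push_cast
      ring
    have hcE : Continuous fun φ : ℝ => Complex.exp (Complex.I * Complex.ofReal (-(r * (1 - Real.cos (φ - θ))))) := by
      fun_prop
    have h2 : (Complex.exp (Complex.I * Complex.ofReal (-r)) * J).im = -(Iint r θ + Iint r (π / 2 - θ)) := by
      rw [h1, ← hint, ← intervalIntegral.integral_neg]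
      have := Complex.imCLM.intervalIntegral_comp_comm (hcE.intervalIntegrable (μ := volume) 0 (π / 2))
      simp only [Complex.imCLM_apply] at this
      rw [← this]
      congr 1
      ext φ
      rw [mul_comm, Complex.exp_ofReal_mul_I_im, Real.sin_neg]
    have h3 : ‖Complex.exp (Complex.I * Complex.ofReal (-r)) * J‖ = ‖J‖ := by
      rw [norm_mul, mul_comm Complex.I, Complex.norm_exp_ofReal_mul_I, one_mul]
    rw [← h3]
    have h4 := Complex.abs_im_le_norm (Complex.exp (Complex.I * Complex.ofReal (-r)) * J)
    rw [h2, abs_neg] at h4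
    exact (le_abs_self _).trans h4
  rw [hRe, norm_mul, Complex.norm_real, Real.norm_of_nonneg (by positivity)]
  gcongr
  refine le_trans ?_ (hsum.trans hJn)
  gcongr

lemma lint_top (c : ℝ) (hc : 0 < c) :
    ∫⁻ p : ℝ × ℝ, ({p : ℝ × ℝ | 4 < p.1 ∧ 0 < p.2 ∧ p.2 ≤ p.1}).indicator
      (fun p => ENNReal.ofReal (c * (2 * p.1) ^ (-2 : ℝ))) p = ∞ := by
  have hS : MeasurableSet {p : ℝ × ℝ | 4 < p.1 ∧ 0 < p.2 ∧ p.2 ≤ p.1} := by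
    refine (measurableSet_lt measurable_const measurable_fst).inter
      ((measurableSet_lt measurable_const measurable_snd).inter
        (measurableSet_le measurable_snd measurable_fst))
  rw [Measure.volume_eq_prod, lintegral_prod _ (by
    apply Measurable.aemeasurable
    apply Measurable.indicator _ hS
    fun_prop)]
  have h1 : ∀ x : ℝ, (∫⁻ y : ℝ, ({p : ℝ × ℝ | 4 < p.1 ∧ 0 < p.2 ∧ p.2 ≤ p.1}).indicator
      (fun p => ENNReal.ofReal (c * (2 * p.1) ^ (-2 : ℝ))) (x, y)) =
      (Ioi (4:ℝ)).indicator (fun x => ENNReal.ofReal (c / 4 * x⁻¹)) x := by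
    intro x
    by_cases hx : 4 < x
    · rw [indicator_of_mem (by exact hx)]
      have : ∀ y : ℝ, ({p : ℝ × ℝ | 4 < p.1 ∧ 0 < p.2 ∧ p.2 ≤ p.1}).indicator
        (fun p => ENNReal.ofReal (c * (2 * p.1) ^ (-2 : ℝ))) (x, y) =
        (Ioc 0 x).indicator (fun _ => ENNReal.ofReal (c * (2 * x) ^ (-2 : ℝ))) y := by
        intro y
        simp [indicator, hx]
      simp_rw [this]
      rw [lintegral_indicator measurableSet_Ioc, setLIntegral_const, Real.volume_Ioc,
        ← ENNReal.ofReal_mul (by positivity)]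
      congr 1
      rw [Real.rpow_neg (by positivity), show (2:ℝ) = ((2:ℕ):ℝ) by norm_num, Real.rpow_natCast]
      have : x ≠ 0 := by linarith
      push_cast
      field_simp
      ring
    · rw [indicator_of_notMem (by exact hx)]
      simp [indicator, hx]
  simp_rw [h1]
  rw [lintegral_indicator measurableSet_Ioi]
  by_contra hne
  have hint : IntegrableOn (fun x : ℝ => c / 4 * x⁻¹) (Ioi 4) := by
    refine ⟨by fun_prop, ?_⟩
    rw [hasFiniteIntegral_iff_ofReal]
    · exact lt_top_iff_ne_top.2 hne
    · filter_upwards [ae_restrict_mem measurableSet_Ioi] with x hx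
      have : (0:ℝ) < x := by linarith [show (4:ℝ) < x from hx]
      positivity
  have h2 := hint.const_mul (4 / c)
  apply not_integrableOn_Ioi_inv (a := 4)
  have h3 : (fun x : ℝ => 4 / c * (c / 4 * x⁻¹)) = fun x : ℝ => x⁻¹ := by
    ext x
    rw [← mul_assoc, show 4 / c * (c / 4) = 1 by field_simp, one_mul]
  rw [h3] at h2
  exact h2

/-- Lemma 11 (necessity): if `R*_{α,β} : L^r(S¹) → L^q(ℝ²)` is bounded, then
`α + β > 2/q - 1/2`. -/
theorem statement8 (α β : ℝ) (hβ0 : 0 ≤ β) (hβα : β ≤ α)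
    (r : ℝ≥0∞) (hr : 1 ≤ r) (q : ℝ) (hq : 0 < q)
    (hbdd : ∃ C : ℝ, 0 < C ∧ ∀ F : ℝ → ℂ, Measurable F →
      planeLp (ENNReal.ofReal q) (fun p => Rab α β F p.1 p.2) ≤
        ENNReal.ofReal C * circleLp r F) :
    α + β > 2 / q - 1 / 2 := by
  by_contra hcon
  push Not at hcon
  obtain ⟨C, hC, hb⟩ := hbdd
  have hpi := Real.pi_pos
  set F : ℝ → ℂ := (Ioc (0:ℝ) (π / 2)).indicator fun _ => (1:ℂ) with hF
  have hFm : Measurable F := measurable_const.indicator measurableSet_Ioc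
  have hfin : circleLp r F < ∞ := by
    have : MemLp F r (volume.restrict (Ioc (0:ℝ) (2 * π))) :=
      (memLp_const (1:ℂ)).indicator measurableSet_Ioc
    exact this.2
  have hlt := (hb F hFm).trans_lt (ENNReal.mul_lt_top ENNReal.ofReal_lt_top hfin)
  have hlt2 := lintegral_rpow_enorm_lt_top_of_eLpNorm_lt_top (by simpa using hq) ENNReal.ofReal_ne_top hlt
  rw [ENNReal.toReal_ofReal hq.le] at hlt2
  obtain ⟨k, hk⟩ : ∃ k : ℝ, k = 1 / (2 * π) * (1 / 8000) := ⟨_, rfl⟩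
  have hk0 : 0 < k := by rw [hk]; positivity
  refine absurd hlt2 (not_lt.2 ?_)
  rw [← lint_top (k ^ q) (by positivity)]
  apply lintegral_mono
  intro p
  obtain ⟨x, y⟩ := p
  apply indicator_apply_le'
  swap
  · intro _; exact bot_le
  rintro ⟨hx, hy, hyx⟩
  simp only at hx hy hyx ⊢
  have hx0 : 0 < x := by linarith
  rw [← ofReal_norm, ENNReal.ofReal_rpow_of_nonneg (norm_nonneg _) hq.le]
  apply ENNReal.ofReal_le_ofReal
  have hR := Rext_lower x y hx.le hy.le hyx
  have hsq : 1 / (2 * π) * (1 / 8000 / √(2 * x)) = k * (2 * x) ^ (-(1/2) : ℝ) := by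
    rw [Real.rpow_neg (by positivity), ← Real.sqrt_eq_rpow, hk]; ring
  rw [hsq] at hR
  have ha : (2 * x) ^ (-α) ≤ (1 + |x|) ^ (-α) := by
    rw [abs_of_pos hx0]
    exact Real.rpow_le_rpow_of_nonpos (by positivity) (by linarith) (by linarith)
  have hbb : (2 * x) ^ (-β) ≤ (1 + |y|) ^ (-β) := by
    rw [abs_of_pos hy]
    exact Real.rpow_le_rpow_of_nonpos (by positivity) (by linarith) (by linarith)
  have hmain : k * (2 * x) ^ (-(1 / 2 + α + β)) ≤ ‖Rab α β F x y‖ := by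
    unfold Rab
    rw [norm_mul, Complex.norm_real, Real.norm_of_nonneg (by positivity)]
    calc k * (2 * x) ^ (-(1 / 2 + α + β))
        = (k * (2 * x) ^ (-(1/2) : ℝ)) * ((2 * x) ^ (-α) * (2 * x) ^ (-β)) := by
          rw [mul_assoc, ← Real.rpow_add (by positivity) (-α), ← Real.rpow_add (by positivity)]
          congr 2; ring
      _ ≤ _ := by gcongr
  calc k ^ q * (2 * x) ^ (-2 : ℝ) ≤ k ^ q * ((2 * x) ^ (-(1 / 2 + α + β))) ^ q := by
        gcongr
        rw [← Real.rpow_mul (by positivity)]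
        apply Real.rpow_le_rpow_of_exponent_le (by linarith)
        have : (α + β + 1 / 2) * q ≤ 2 := by
          rw [← le_div_iff₀ hq]; linarith
        linarith
    _ = (k * (2 * x) ^ (-(1 / 2 + α + β))) ^ q := by
        rw [Real.mul_rpow (x := k) (by positivity) (by positivity)]
    _ ≤ _ := by gcongr
end
end

section
/- Let 0 ≤ β ≤ α < ∞, 1 ≤ r ≤ ∞ and 0 < q < ∞, and suppose there exists C > 0 with ‖R*_{α,β}F‖_{L^q(ℝ²)} ≤ C · ‖F‖_{L^r(S¹)} for all measurable F : ℝ → ℂ. Then: (i) if α > 1/q, then either r > 1 and 2β ≥ 2/q − 1/r′, or r = 1 and 2β > 2/q; (ii) if α = 1/q, then 2β > 2/q − 1/r′; (iii) if α < 1/q, then α + 2β ≥ 3/q − 1/r′. -/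
open MeasureTheory Real Set Filter
open scoped ENNReal

noncomputable section

def J9 (a R : ℝ) : ℝ≥0∞ := ∫⁻ x in Icc (0:ℝ) R, ENNReal.ofReal ((1 + x) ^ (-a))

lemma J9_ge (a R : ℝ) (ha : 0 ≤ a) (hR : 1 ≤ R) :
    ENNReal.ofReal (2 ^ (-a) * R ^ (1 - a)) ≤ J9 a R := by
  have h1 : ∫⁻ x in Icc (0:ℝ) R, ENNReal.ofReal ((2 * R) ^ (-a)) ≤ J9 a R := by
    refine setLIntegral_mono' measurableSet_Icc fun x hx => ?_
    apply ENNReal.ofReal_le_ofReal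
    exact Real.rpow_le_rpow_of_nonpos (by linarith [hx.1]) (by linarith [hx.2]) (by linarith)
  refine le_trans (le_of_eq ?_) h1
  rw [setLIntegral_const, Real.volume_Icc, ← ENNReal.ofReal_mul (by positivity)]
  congr 1
  rw [Real.mul_rpow (by norm_num) (by linarith), mul_assoc, sub_zero, sub_eq_add_neg, add_comm,
    Real.rpow_add (by linarith), Real.rpow_one]

lemma J9_one (a R : ℝ) (ha : 0 ≤ a) (hR : 1 ≤ R) :
    ENNReal.ofReal (2 ^ (-a)) ≤ J9 a R := by
  have h := J9_ge a 1 ha le_rfl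
  rw [Real.one_rpow, mul_one] at h
  exact h.trans (lintegral_mono_set (Icc_subset_Icc_right hR))

lemma J9_log (a R : ℝ) (ha : a ≤ 1) (hR : 1 ≤ R) :
    ENNReal.ofReal (Real.log (1 + R)) ≤ J9 a R := by
  have h1 : ∫⁻ x in Icc (0:ℝ) R, ENNReal.ofReal ((1 + x)⁻¹) ≤ J9 a R := by
    refine setLIntegral_mono' measurableSet_Icc fun x hx => ?_
    apply ENNReal.ofReal_le_ofReal
    rw [← Real.rpow_neg_one]
    exact Real.rpow_le_rpow_of_exponent_le (by linarith [hx.1]) (by linarith)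
  refine le_trans (le_of_eq ?_) h1
  have hc : ContinuousOn (fun x : ℝ => (1 + x)⁻¹) (Icc 0 R) := by
    apply ContinuousOn.inv₀ (by fun_prop)
    intro x hx
    linarith [hx.1]
  rw [← ofReal_integral_eq_lintegral_ofReal (hc.integrableOn_compact isCompact_Icc)]
  · congr 1
    rw [integral_Icc_eq_integral_Ioc, ← intervalIntegral.integral_of_le (by linarith)]
    rw [intervalIntegral.integral_comp_add_left (fun x => x⁻¹) 1, integral_inv_of_pos (by norm_num) (by linarith)]
    simp
  · filter_upwards [ae_restrict_mem measurableSet_Icc] with x hx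
    have := hx.1
    simp only [Pi.zero_apply]
    positivity

def F9 (N : ℝ) : ℝ → ℂ := (Icc (π / 2) (π / 2 + 1 / (2 * N))).indicator fun _ => (1:ℂ)

lemma F9_meas (N : ℝ) : Measurable (F9 N) := measurable_const.indicator measurableSet_Icc

lemma F9_sub (N : ℝ) (hN : 1 ≤ N) :
    Icc (π / 2) (π / 2 + 1 / (2 * N)) ⊆ Ioc 0 (2 * π) := by
  have : 1 / (2 * N) ≤ 1 := by
    rw [div_le_one (by linarith)]; linarith
  intro x hx
  have := Real.pi_gt_three
  constructor <;> linarith [hx.1, hx.2]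

lemma F9_norm (r : ℝ≥0∞) (N : ℝ) (hN : 1 ≤ N) :
    circleLp r (F9 N) ≤ ENNReal.ofReal ((1 / (2 * N)) ^ (r⁻¹.toReal)) := by
  unfold circleLp F9
  refine (eLpNorm_indicator_const_le _ _).trans (le_of_eq ?_)
  rw [Measure.restrict_apply measurableSet_Icc, inter_eq_self_of_subset_left (F9_sub N hN),
    Real.volume_Icc, add_sub_cancel_left, enorm_one, one_mul, ENNReal.toReal_inv, one_div,
    ENNReal.ofReal_rpow_of_pos (by positivity)]
  simp

lemma Rext_ge (N x y : ℝ) (hN : 1 ≤ N) (hx : x ∈ Icc 0 N) (hy : y ∈ Icc 0 (N ^ 2)) :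
    1 / (8 * π) * N⁻¹ ≤ ‖Rext (F9 N) x y‖ := by
  obtain ⟨hx0, hx1⟩ := hx
  obtain ⟨hy0, hy1⟩ := hy
  have hpi := Real.pi_pos
  set δ := 1 / (2 * N) with hδ
  have hδ0 : 0 < δ := by positivity
  have hδN : N * δ = 1 / 2 := by rw [hδ]; field_simp
  have hint : (∫ φ in (0:ℝ)..(2 * π), F9 N φ *
      Complex.exp (Complex.I * Complex.ofReal (x * Real.cos φ + y * Real.sin φ))) =
      ∫ φ in Icc (π / 2) (π / 2 + δ),
        Complex.exp (Complex.I * Complex.ofReal (x * Real.cos φ + y * Real.sin φ)) := by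
    rw [intervalIntegral.integral_of_le (by positivity)]
    have : (fun φ => F9 N φ *
      Complex.exp (Complex.I * Complex.ofReal (x * Real.cos φ + y * Real.sin φ))) =
      (Icc (π / 2) (π / 2 + δ)).indicator (fun φ =>
        Complex.exp (Complex.I * Complex.ofReal (x * Real.cos φ + y * Real.sin φ))) := by
      funext φ
      by_cases h : φ ∈ Icc (π / 2) (π / 2 + δ)
      · simp only [F9, ← hδ, indicator_of_mem h, one_mul]
      · simp only [F9, ← hδ, indicator_of_notMem h, zero_mul]
    rw [this, setIntegral_indicator measurableSet_Icc,
      inter_eq_self_of_subset_right (F9_sub N hN)]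
  have hmul : Complex.exp (Complex.I * Complex.ofReal (-y)) *
      (∫ φ in Icc (π / 2) (π / 2 + δ),
        Complex.exp (Complex.I * Complex.ofReal (x * Real.cos φ + y * Real.sin φ))) =
      ∫ φ in Icc (π / 2) (π / 2 + δ),
        Complex.exp (Complex.I * Complex.ofReal (x * Real.cos φ + y * Real.sin φ - y)) := by
    rw [← integral_const_mul]
    congr 1
    funext φ
    rw [← Complex.exp_add]
    congr 1
    push_cast
    ring
  have hI : IntegrableOn (fun φ : ℝ =>
        Complex.exp (Complex.I * Complex.ofReal (x * Real.cos φ + y * Real.sin φ - y)))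
        (Icc (π / 2) (π / 2 + δ)) := by
    apply ContinuousOn.integrableOn_compact isCompact_Icc
    apply Continuous.continuousOn
    fun_prop
  have hre : δ / 2 ≤ (∫ φ in Icc (π / 2) (π / 2 + δ),
        Complex.exp (Complex.I * Complex.ofReal (x * Real.cos φ + y * Real.sin φ - y))).re := by
    have e : (∫ φ in Icc (π / 2) (π / 2 + δ),
        Complex.exp (Complex.I * Complex.ofReal (x * Real.cos φ + y * Real.sin φ - y))).re =
        ∫ φ in Icc (π / 2) (π / 2 + δ), (Complex.exp (Complex.I *
          Complex.ofReal (x * Real.cos φ + y * Real.sin φ - y))).re :=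
      (integral_re hI).symm
    rw [e]
    have e2 : δ / 2 = ∫ φ in Icc (π / 2) (π / 2 + δ), (1 / 2 : ℝ) := by
      rw [setIntegral_const]
      simp [Measure.real, hδ0.le]
      ring
    rw [e2]
    refine setIntegral_mono_on (by simp) hI.re measurableSet_Icc fun φ hφ => ?_
    have e3 : (Complex.exp (Complex.I *
          Complex.ofReal (x * Real.cos φ + y * Real.sin φ - y))).re =
        Real.cos (x * Real.cos φ + y * Real.sin φ - y) := by
      rw [mul_comm, Complex.exp_ofReal_mul_I_re]
    rw [e3]
    obtain ⟨θ, rfl⟩ : ∃ θ, φ = θ + π / 2 := ⟨φ - π / 2, by ring⟩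
    have hθ0 : 0 ≤ θ := by linarith [hφ.1]
    have hθ1 : θ ≤ δ := by linarith [hφ.2]
    rw [Real.cos_add_pi_div_two, Real.sin_add_pi_div_two]
    have hs1 : Real.sin θ ≤ θ := Real.sin_le hθ0
    have hNδ1 : δ ≤ 1 / 2 := by nlinarith
    have hs0 : 0 ≤ Real.sin θ := Real.sin_nonneg_of_nonneg_of_le_pi hθ0
      (by linarith [Real.pi_gt_three])
    have hc1 := Real.one_sub_sq_div_two_le_cos (x := θ)
    have hc0 := Real.cos_le_one θ
    have a1 : x * Real.sin θ ≤ 1 / 2 := by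
      rw [← hδN]; exact mul_le_mul hx1 (hs1.trans hθ1) hs0 (by linarith)
    have a0 : 0 ≤ x * Real.sin θ := by positivity
    have b0 : 0 ≤ y * (1 - Real.cos θ) := mul_nonneg hy0 (by linarith)
    have b1 : y * (1 - Real.cos θ) ≤ 1 / 2 := by
      have h1 : 1 - Real.cos θ ≤ δ ^ 2 / 2 := by nlinarith
      calc y * (1 - Real.cos θ) ≤ N ^ 2 * (δ ^ 2 / 2) :=
            mul_le_mul hy1 h1 (by linarith) (by positivity)
        _ = (N * δ) ^ 2 / 2 := by ring
        _ ≤ 1 / 2 := by rw [hδN]; norm_num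
    have h2 := Real.one_sub_sq_div_two_le_cos (x := x * -Real.sin θ + y * Real.cos θ - y)
    have h3 : (x * -Real.sin θ + y * Real.cos θ - y) ^ 2 ≤ 1 := by
      rw [sq_le_one_iff_abs_le_one, abs_le]
      constructor <;> linarith
    linarith
  have hn : δ / 2 ≤ ‖∫ φ in Icc (π / 2) (π / 2 + δ),
        Complex.exp (Complex.I * Complex.ofReal (x * Real.cos φ + y * Real.sin φ))‖ := by
    have h1 := hre.trans ((le_abs_self _).trans (Complex.abs_re_le_norm _))
    rw [← hmul, norm_mul, mul_comm Complex.I, Complex.norm_exp_ofReal_mul_I, one_mul] at h1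
    exact h1
  unfold Rext
  rw [hint, norm_mul, Complex.norm_real, Real.norm_of_nonneg (by positivity)]
  calc 1 / (8 * π) * N⁻¹ = 1 / (2 * π) * (δ / 2) := by rw [hδ]; field_simp; norm_num
    _ ≤ _ := by gcongr

lemma plane_ge (α β q N : ℝ) (hq : 0 < q) (hN : 1 ≤ N) :
    ENNReal.ofReal ((1 / (8 * π) * N⁻¹) ^ q) * (J9 (α * q) N * J9 (β * q) (N ^ 2)) ≤
      planeLp (ENNReal.ofReal q) (fun p => Rab α β (F9 N) p.1 p.2) ^ q := by
  have hpi := Real.pi_pos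
  unfold planeLp
  rw [eLpNorm_eq_lintegral_rpow_enorm_toReal (by simpa using hq) (by simp),
    ENNReal.toReal_ofReal hq.le, ← ENNReal.rpow_mul, one_div_mul_cancel hq.ne',
    ENNReal.rpow_one]
  have hm : ∀ a : ℝ, Measurable fun x : ℝ => ENNReal.ofReal ((1 + x) ^ (-a)) := by
    intro a; fun_prop
  unfold J9
  rw [← lintegral_prod_mul (hm _).aemeasurable (hm _).aemeasurable, Measure.prod_restrict,
    ← lintegral_const_mul _ (by have := hm (α * q); have := hm (β * q); fun_prop)]
  refine le_trans ?_ (setLIntegral_le_lintegral (Icc 0 N ×ˢ Icc 0 (N ^ 2)) _)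
  refine setLIntegral_mono' (measurableSet_Icc.prod measurableSet_Icc) fun p hp => ?_
  obtain ⟨hx, hy⟩ := hp
  have h := Rext_ge N p.1 p.2 hN hx hy
  have hx0 : 0 ≤ p.1 := hx.1
  have hy0 : 0 ≤ p.2 := hy.1
  rw [← ofReal_norm_eq_enorm, ENNReal.ofReal_rpow_of_nonneg (norm_nonneg _) hq.le,
    ← ENNReal.ofReal_mul (by positivity), ← ENNReal.ofReal_mul (by positivity)]
  apply ENNReal.ofReal_le_ofReal
  unfold Rab
  rw [norm_mul, Complex.norm_real, abs_of_nonneg hx0, abs_of_nonneg hy0,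
    Real.norm_of_nonneg (by positivity), Real.mul_rpow (norm_nonneg _) (by positivity),
    Real.mul_rpow (x := (1 + p.1) ^ (-α)) (by positivity) (by positivity),
    ← Real.rpow_mul (by positivity), ← Real.rpow_mul (by positivity), neg_mul, neg_mul]
  gcongr

lemma key9 (α β : ℝ) (r : ℝ≥0∞) (q : ℝ) (hq : 0 < q)
    (hbdd : ∃ C : ℝ, 0 < C ∧ ∀ F : ℝ → ℂ, Measurable F →
      planeLp (ENNReal.ofReal q) (fun p => Rab α β F p.1 p.2) ≤
        ENNReal.ofReal C * circleLp r F) :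
    ∃ K : ℝ, ∀ N A B : ℝ, 1 ≤ N → 0 ≤ A → 0 ≤ B → ENNReal.ofReal A ≤ J9 (α * q) N →
      ENNReal.ofReal B ≤ J9 (β * q) (N ^ 2) →
      A * B ≤ K * N ^ (q * (1 - r⁻¹.toReal)) := by
  obtain ⟨C, hC, H⟩ := hbdd
  have hpi := Real.pi_pos
  set ρ := r⁻¹.toReal with hρ
  refine ⟨(C * (1 / 2) ^ ρ * (8 * π)) ^ q, fun N A B hN hA hB hA' hB' => ?_⟩
  have hN0 : 0 < N := by linarith
  have h1 := (plane_ge α β q N hq hN).trans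
    (ENNReal.rpow_le_rpow ((H _ (F9_meas N)).trans (mul_le_mul_right (F9_norm r N hN) _)) hq.le)
  have h2 := (mul_le_mul_right (mul_le_mul' hA' hB') _).trans h1
  rw [← ENNReal.ofReal_mul hA, ← ENNReal.ofReal_mul (by positivity),
    ← ENNReal.ofReal_mul (by positivity), ENNReal.ofReal_rpow_of_nonneg (by positivity) hq.le,
    ENNReal.ofReal_le_ofReal_iff (by positivity), ← hρ] at h2
  have hp : 0 < (1 / (8 * π) * N⁻¹) ^ q := by positivity
  rw [← mul_le_mul_iff_right₀ hp]
  refine h2.trans (le_of_eq ?_)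
  rw [mul_comm q, Real.rpow_mul hN0.le, ← Real.mul_rpow (by positivity) (by positivity),
    ← Real.mul_rpow (by positivity) (by positivity)]
  congr 1
  rw [Real.rpow_sub hN0, Real.rpow_one, Real.div_rpow (by norm_num) (by positivity),
    Real.div_rpow (by norm_num) (by positivity), Real.mul_rpow (by norm_num) hN0.le]
  have := (Real.rpow_pos_of_pos hN0 ρ).ne'
  field_simp

lemma pow_cmp9 (s t c K : ℝ) (hc : 0 < c) (h : ∀ N : ℝ, 1 ≤ N → c * N ^ s ≤ K * N ^ t) :
    s ≤ t := by
  by_contra! hst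
  have h1 := (tendsto_rpow_atTop (sub_pos.2 hst)).const_mul_atTop hc
  obtain ⟨N, hN, hN1⟩ := ((h1.eventually_gt_atTop K).and (eventually_ge_atTop 1)).exists
  have hN0 : 0 < N := by linarith
  have h2 := h N hN1
  rw [Real.rpow_sub hN0] at hN
  have h3 : 0 < N ^ t := by positivity
  rw [← mul_div_assoc, lt_div_iff₀ h3] at hN
  linarith

lemma log_cmp9 (s t c K : ℝ) (hc : 0 < c)
    (h : ∀ N : ℝ, 1 ≤ N → c * (Real.log (1 + N) * N ^ s) ≤ K * N ^ t) :
    s < t := by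
  by_contra! hst
  have h1 := (Real.tendsto_log_atTop.comp (tendsto_atTop_add_const_left atTop (1:ℝ) tendsto_id)).const_mul_atTop hc
  obtain ⟨N, hN, hN1⟩ := ((h1.eventually_gt_atTop K).and (eventually_ge_atTop 1)).exists
  have hN0 : 0 < N := by linarith
  have h2 := h N hN1
  simp only [Function.comp, id] at hN
  have h3 : 0 < N ^ t := by positivity
  have h4 : N ^ t ≤ N ^ s := Real.rpow_le_rpow_of_exponent_le hN1 hst
  have h5 : 0 < Real.log (1 + N) := Real.log_pos (by linarith)
  have h6 : c * Real.log (1 + N) * N ^ t ≤ c * Real.log (1 + N) * N ^ s := by gcongr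
  nlinarith

/-- Lemma 12 (Knapp-type necessity) for `R*_{α,β}`. -/
theorem statement9 (α β : ℝ) (hβ0 : 0 ≤ β) (hβα : β ≤ α)
    (r : ℝ≥0∞) (hr : 1 ≤ r) (q : ℝ) (hq : 0 < q)
    (hbdd : ∃ C : ℝ, 0 < C ∧ ∀ F : ℝ → ℂ, Measurable F →
      planeLp (ENNReal.ofReal q) (fun p => Rab α β F p.1 p.2) ≤
        ENNReal.ofReal C * circleLp r F) :
    (α > 1 / q →
      (1 < r ∧ 2 * β ≥ 2 / q - (1 - r⁻¹.toReal)) ∨ (r = 1 ∧ 2 * β > 2 / q)) ∧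
    (α = 1 / q → 2 * β > 2 / q - (1 - r⁻¹.toReal)) ∧
    (α < 1 / q → α + 2 * β ≥ 3 / q - (1 - r⁻¹.toReal)) := by

  obtain ⟨K, hK⟩ := key9 α β r q hq hbdd
  have hα0 : 0 ≤ α := hβ0.trans hβα
  have hαq : 0 ≤ α * q := by positivity
  have hβq : 0 ≤ β * q := by positivity
  have hB : ∀ N : ℝ, 1 ≤ N →
      ENNReal.ofReal (2 ^ (-(β * q)) * N ^ (2 * (1 - β * q))) ≤ J9 (β * q) (N ^ 2) := by
    intro N hN
    have h := J9_ge (β * q) (N ^ 2) hβq (by nlinarith)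
    rw [← Real.rpow_natCast, ← Real.rpow_mul (by linarith)] at h
    simpa using h
  have hcα : (0:ℝ) < 2 ^ (-(α * q)) := by positivity
  have hcβ : (0:ℝ) < 2 ^ (-(β * q)) := by positivity
  have conv : ∀ a b : ℝ, a * q ≤ b * q → a ≤ b := fun a b h => le_of_mul_le_mul_right h hq
  refine ⟨fun _ => ?_, fun h => ?_, fun _ => ?_⟩
  · rcases hr.eq_or_lt with h1 | h1
    · right
      refine ⟨h1.symm, ?_⟩
      by_contra! hlt
      have hle : β * q ≤ 1 := by
        have : β ≤ 1 / q := by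
          rw [show 2 / q = 2 * (1 / q) by ring] at hlt; linarith
        rwa [le_div_iff₀ hq] at this
      have := log_cmp9 0 0 (2 ^ (-(α * q))) K hcα (fun N hN => by
        have h2 := hK N _ (Real.log (1 + N ^ 2)) hN hcα.le
          (Real.log_nonneg (by nlinarith)) (J9_one _ N hαq hN)
          (J9_log _ _ hle (by nlinarith))
        rw [← h1] at h2
        simp only [inv_one, ENNReal.toReal_one, sub_self, mul_zero] at h2
        refine le_trans ?_ h2
        rw [Real.rpow_zero, mul_one]
        gcongr
        nlinarith)
      exact lt_irrefl _ this
    · left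
      refine ⟨h1, ?_⟩
      have := pow_cmp9 (2 * (1 - β * q)) (q * (1 - r⁻¹.toReal)) (2 ^ (-(α * q)) * 2 ^ (-(β * q))) K
        (by positivity) (fun N hN => by
          have h2 := hK N _ _ hN hcα.le (by positivity) (J9_one _ N hαq hN) (hB N hN)
          linarith)
      have e : 2 / q * q = 2 := by field_simp
      apply conv
      linarith
  · have := log_cmp9 (2 * (1 - β * q)) (q * (1 - r⁻¹.toReal)) (2 ^ (-(β * q))) K
      hcβ (fun N hN => by
        have h2 := hK N _ _ hN (Real.log_nonneg (by linarith : (1:ℝ) ≤ 1 + N)) (by positivity)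
          (J9_log _ N (by rw [h]; field_simp; rfl) hN) (hB N hN)
        linarith)
    have e : 2 / q * q = 2 := by field_simp
    apply lt_of_mul_lt_mul_right _ hq.le
    linarith
  · have := pow_cmp9 ((1 - α * q) + 2 * (1 - β * q)) (q * (1 - r⁻¹.toReal))
      (2 ^ (-(α * q)) * 2 ^ (-(β * q))) K
      (by positivity) (fun N hN => by
        have h2 := hK N _ _ hN (by positivity) (by positivity) (J9_ge _ N hαq hN) (hB N hN)
        rw [Real.rpow_add (by linarith)]
        linarith)
    have e : 3 / q * q = 3 := by field_simp
    apply conv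
    linarith
end
end
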